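/- arXiv:2603.18553 — 2 statements merged into one kernel-verified Lean document; each statement's English description precedes it below -/
import Mathlib

section
/- Fix an integer k ≥ 3. There exists a constant c₀ > 0 such that the number of labelled C_k-free oriented graphs G on [n] with b(G) < c₀·n is o(f(n,C_k)) as n → ∞; equivalently, (Σ_{m < c₀ n} |F_m|) / f(n,C_k) → 0. -/
open scoped Classical

/-- An arc set on `Fin n`: a digraph on vertex set `[n]` is identified with its
finite set of arcs. -/
abbrev ArcSet (n : ℕ) := Finset (Fin n × Fin n)

/-- A digraph is loopless. -/
def IsLoopless {n : ℕ} (E : ArcSet n) : Prop := ∀ v : Fin n, (v, v) ∉ E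

/-- An oriented graph: loopless and at most one of the arcs `(u,v)`, `(v,u)`
is present for each pair. -/
def IsOriented {n : ℕ} (E : ArcSet n) : Prop :=
  IsLoopless E ∧ ∀ u v : Fin n, (u, v) ∈ E → (v, u) ∉ E

/-- `E` contains a (not necessarily induced) copy of the directed cycle `C_k`. -/
def ContainsCycle {n : ℕ} (k : ℕ) (E : ArcSet n) : Prop :=
  ∃ f : ZMod k → Fin n, Function.Injective f ∧ ∀ i : ZMod k, (f i, f (i + 1)) ∈ E

/-- `E` is `C_k`-free. -/
def CkFree {n : ℕ} (k : ℕ) (E : ArcSet n) : Prop := ¬ ContainsCycle k E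

/-- The number of backwards arcs of `E` with respect to the ordering `σ`:
arcs `(u,v)` with `σ u > σ v`. -/
def backCount {n : ℕ} (E : ArcSet n) (σ : Equiv.Perm (Fin n)) : ℕ :=
  (E.filter fun e => σ e.2 < σ e.1).card

/-- `b(E)`: the minimum number of backwards arcs over all orderings, i.e. the
number of backwards arcs in a transitive-optimal ordering. -/
noncomputable def bMin {n : ℕ} (E : ArcSet n) : ℕ :=
  Finset.univ.inf' Finset.univ_nonempty (backCount E)

/-- The number of labelled `C_k`-free oriented graphs on `[n]`. -/
noncomputable def fnk (n k : ℕ) : ℕ :=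
  (Finset.univ.filter fun E : ArcSet n => IsOriented E ∧ CkFree k E).card

open Finset

/-- `HasWalk H l i j`: there is a walk with `l + 1` arcs from `i` to `j` in `H`. -/
def HasWalk (H : Finset (ℕ × ℕ)) : ℕ → ℕ → ℕ → Prop
  | 0, i, j => (i, j) ∈ H
  | l + 1, i, j => ∃ w, HasWalk H l i w ∧ (w, j) ∈ H

/-- The pairs `(i, j)` with `i < j < n`. -/
def forwardPairs (n : ℕ) : Finset (ℕ × ℕ) :=
  (range n ×ˢ range n).filter fun e => e.1 < e.2

/-- The number of `i < j` with no walk of `l + 1` arcs from `i` to `j`. -/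
noncomputable def missIn (l : ℕ) (H : Finset (ℕ × ℕ)) (j : ℕ) : ℕ :=
  #{i ∈ range j | ¬ HasWalk H l i j}

/-- The number of pairs `i < j < n` with no walk of `l + 1` arcs from `i` to `j`. -/
noncomputable def miss (n l : ℕ) (H : Finset (ℕ × ℕ)) : ℕ :=
  ∑ j ∈ range n, missIn l H j

/-- Fewer than a quarter of the vertices strictly between `i` and `j` are endpoints of a walk
of `l + 1` arcs from `i`. -/
def Sparse (l : ℕ) (H : Finset (ℕ × ℕ)) (i j : ℕ) : Prop :=
  4 * #{w ∈ Ioo i j | HasWalk H l i w} + i + 1 < j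

/-- The number of `i < j` for which `(i, j)` is sparse. -/
noncomputable def sparseIn (l : ℕ) (H : Finset (ℕ × ℕ)) (j : ℕ) : ℕ :=
  #{i ∈ range j | Sparse l H i j}

/-- The number of sparse pairs below `n`. -/
noncomputable def sparse (n l : ℕ) (H : Finset (ℕ × ℕ)) : ℕ :=
  ∑ j ∈ range n, sparseIn l H j

lemma mem_forwardPairs {n : ℕ} {e : ℕ × ℕ} : e ∈ forwardPairs n ↔ e.1 < e.2 ∧ e.2 < n := by
  simp only [forwardPairs, mem_filter, mem_product, mem_range]
  omega

lemma HasWalk.mono {H H' : Finset (ℕ × ℕ)} (h : H ⊆ H') {l i j : ℕ} :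
    HasWalk H l i j → HasWalk H' l i j := by
  induction l generalizing j with
  | zero => exact fun hw => h hw
  | succ l ih =>
    rintro ⟨w, hw, hj⟩
    exact ⟨w, ih hw, h hj⟩

lemma hasWalk_filter_iff {H : Finset (ℕ × ℕ)} (hH : ∀ e ∈ H, e.1 < e.2) {l i j t : ℕ}
    (hj : j ≤ t) : HasWalk (H.filter fun e => e.2 ≤ t) l i j ↔ HasWalk H l i j := by
  refine ⟨HasWalk.mono (filter_subset _ _), ?_⟩
  induction l generalizing j with
  | zero => exact fun h => mem_filter.2 ⟨h, hj⟩
  | succ l ih =>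
    rintro ⟨w, hw, hwj⟩
    exact ⟨w, ih ((hH _ hwj).le.trans hj) hw, mem_filter.2 ⟨hwj, hj⟩⟩

lemma sum_powerset_union {α M : Type*} [DecidableEq α] [AddCommMonoid M] {P Q : Finset α}
    (h : Disjoint P Q) (f : Finset α → M) :
    ∑ H ∈ (P ∪ Q).powerset, f H = ∑ A ∈ P.powerset, ∑ B ∈ Q.powerset, f (A ∪ B) := by
  rw [← sum_product']
  refine (sum_bij' (fun x _ => x.1 ∪ x.2) (fun H _ => (H ∩ P, H ∩ Q)) ?_ ?_ ?_ ?_ ?_).symm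
  · rintro ⟨A, B⟩ hx
    simp only [mem_product, mem_powerset] at hx ⊢
    exact union_subset_union hx.1 hx.2
  · intro H _
    simp
  · rintro ⟨A, B⟩ hx
    simp only [mem_product, mem_powerset] at hx
    have h1 : ∀ x ∈ P, x ∉ Q := fun x hx hx' => disjoint_left.1 h hx hx'
    ext x
    · have := @hx.1 x
      have := @hx.2 x
      have := h1 x
      simp only [mem_inter, mem_union]
      tauto
    · have := @hx.1 x
      have := @hx.2 x
      have := h1 x
      simp only [mem_inter, mem_union]
      tauto
  · intro H hH
    rw [mem_powerset] at hH
    simp only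
    rw [← inter_union_distrib_left, inter_eq_left.2 hH]
  · simp

/-- If the factor `F t` only depends on the part of the random set `H` of rank at most `t`, and
its mean given the part of rank less than `t` is at most `κ`, then the mean of the product of
the first `T` factors is at most `κ ^ T`. -/
lemma sum_powerset_prod_le {α : Type*} [DecidableEq α] (E : Finset α) (ρ : α → ℕ)
    (F : ℕ → Finset α → ℝ) (κ : ℝ) (hκ : 0 ≤ κ) (hF : ∀ t H, 0 ≤ F t H)
    (hloc : ∀ t, ∀ H ⊆ E, F t (H.filter fun e => ρ e ≤ t) = F t H)
    (hstep : ∀ t, ∀ H ⊆ E.filter (fun e => ρ e < t),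
      ∑ S ∈ (E.filter fun e => ρ e = t).powerset, F t (H ∪ S)
        ≤ κ * 2 ^ #(E.filter fun e => ρ e = t)) (T : ℕ) :
    ∑ H ∈ (E.filter fun e => ρ e < T).powerset, ∏ t ∈ range T, F t H
      ≤ κ ^ T * 2 ^ #(E.filter fun e => ρ e < T) := by
  induction T with
  | zero => simp
  | succ T ih =>
    have hun : E.filter (fun e => ρ e < T + 1)
        = E.filter (fun e => ρ e < T) ∪ E.filter fun e => ρ e = T := by
      ext e
      simp only [mem_filter, mem_union]
      have : ρ e < T + 1 ↔ ρ e < T ∨ ρ e = T := by omega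
      rw [this]
      tauto
    have hdis : Disjoint (E.filter fun e => ρ e < T) (E.filter fun e => ρ e = T) := by
      rw [disjoint_filter]
      intro e _ h1 h2
      omega
    rw [hun, sum_powerset_union hdis, card_union_of_disjoint hdis]
    have key : ∀ A ∈ (E.filter fun e => ρ e < T).powerset,
        ∑ B ∈ (E.filter fun e => ρ e = T).powerset, ∏ t ∈ range (T + 1), F t (A ∪ B)
          ≤ (∏ t ∈ range T, F t A) * (κ * 2 ^ #(E.filter fun e => ρ e = T)) := by
      intro A hA
      rw [mem_powerset] at hA
      have : ∀ B ∈ (E.filter fun e => ρ e = T).powerset,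
          ∏ t ∈ range (T + 1), F t (A ∪ B) = (∏ t ∈ range T, F t A) * F T (A ∪ B) := by
        intro B hB
        rw [mem_powerset] at hB
        rw [prod_range_succ]
        congr 1
        refine prod_congr rfl fun t ht => ?_
        rw [mem_range] at ht
        rw [← hloc t (A ∪ B) (union_subset (hA.trans (filter_subset _ _))
          (hB.trans (filter_subset _ _))), ← hloc t A (hA.trans (filter_subset _ _)),
          filter_union]
        congr 1
        rw [union_eq_left]
        intro e he
        rw [mem_filter] at he
        have := (mem_filter.1 (hB he.1)).2
        omega
      rw [sum_congr rfl this, ← mul_sum]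
      exact mul_le_mul_of_nonneg_left (hstep T A hA) (prod_nonneg fun t _ => hF t A)
    refine (sum_le_sum key).trans ?_
    rw [← sum_mul, pow_add, pow_succ]
    calc _ ≤ (κ ^ T * 2 ^ #(E.filter fun e => ρ e < T)) *
          (κ * 2 ^ #(E.filter fun e => ρ e = T)) :=
          mul_le_mul_of_nonneg_right ih (by positivity)
      _ = _ := by ring

lemma sum_powerset_pow_card_inter {α : Type*} [DecidableEq α] (E I : Finset α) (hI : I ⊆ E)
    (x : ℝ) : ∑ S ∈ E.powerset, x ^ #(S ∩ I) = ((1 + x) / 2) ^ #I * 2 ^ #E := by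
  have h1 : ∀ S : Finset α, x ^ #(S ∩ I) = ∏ e ∈ S, if e ∈ I then x else 1 := by
    intro S
    rw [prod_ite, prod_const, prod_const_one, mul_one, filter_mem_eq_inter]
  simp_rw [h1]
  rw [← prod_one_add]
  have h2 : ∀ e ∈ E, (1 + if e ∈ I then x else (1 : ℝ)) = (if e ∈ I then (1 + x) / 2 else 1) * 2 := by
    intro e _
    split_ifs <;> ring
  rw [prod_congr rfl h2, prod_mul_distrib, prod_const, prod_ite, prod_const, prod_const_one,
    mul_one, filter_mem_eq_inter, inter_eq_right.2 hI]

lemma sparse_eq_sum_rows (n l : ℕ) (H : Finset (ℕ × ℕ)) :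
    sparse n l H = ∑ i ∈ range n, #{j ∈ range n | i < j ∧ Sparse l H i j} := by
  have h1 : sparse n l H
      = ∑ j ∈ range n, ∑ i ∈ range n, if i < j ∧ Sparse l H i j then 1 else 0 := by
    refine sum_congr rfl fun j hj => ?_
    rw [sparseIn, ← card_filter]
    congr 1
    ext i
    simp only [mem_filter, mem_range] at hj ⊢
    constructor
    · rintro ⟨h1, h2⟩
      exact ⟨h1.trans hj, h1, h2⟩
    · tauto
  rw [h1, sum_comm]
  simp_rw [card_filter]

lemma miss_eq_sum_rows (n l : ℕ) (H : Finset (ℕ × ℕ)) :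
    miss n l H = ∑ i ∈ range n, #{j ∈ range n | i < j ∧ ¬ HasWalk H l i j} := by
  have h1 : miss n l H
      = ∑ j ∈ range n, ∑ i ∈ range n, if i < j ∧ ¬ HasWalk H l i j then 1 else 0 := by
    refine sum_congr rfl fun j hj => ?_
    rw [missIn, ← card_filter]
    congr 1
    ext i
    simp only [mem_filter, mem_range] at hj ⊢
    constructor
    · rintro ⟨h1, h2⟩
      exact ⟨h1.trans hj, h1, h2⟩
    · tauto
  rw [h1, sum_comm]
  simp_rw [card_filter]

lemma sparse_le (n l : ℕ) (H : Finset (ℕ × ℕ)) : sparse n l H ≤ 2 * miss n l H + n := by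
  have hrow : ∀ i ∈ range n, #{j ∈ range n | i < j ∧ Sparse l H i j}
      ≤ 2 * #{j ∈ range n | i < j ∧ ¬ HasWalk H l i j} + 1 := by
    intro i _
    rcases ({j ∈ range n | i < j ∧ Sparse l H i j} : Finset ℕ).eq_empty_or_nonempty with h | h
    · simp [h]
    obtain ⟨m, hm, hmax⟩ := exists_max_image _ id h
    simp only [mem_filter, mem_range, id] at hm hmax
    have h1 : #{j ∈ range n | i < j ∧ Sparse l H i j} ≤ m - i := by
      rw [← Nat.card_Ioc]
      refine card_le_card fun j hj => ?_
      have hj' := hmax j (by simpa using hj)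
      simp only [mem_filter] at hj
      exact mem_Ioc.2 ⟨hj.2.1, hj'⟩
    have h2 : #{w ∈ Ioo i m | ¬ HasWalk H l i w}
        ≤ #{j ∈ range n | i < j ∧ ¬ HasWalk H l i j} := by
      refine card_le_card fun j hj => ?_
      simp only [mem_filter, mem_Ioo, mem_range] at hj ⊢
      exact ⟨hj.1.2.trans hm.1, hj.1.1, hj.2⟩
    have h3 := card_filter_add_card_filter_not (s := Ioo i m) (fun w => HasWalk H l i w)
    rw [Nat.card_Ioo] at h3
    have h4 := hm.2.2
    unfold Sparse at h4
    omega
  rw [sparse_eq_sum_rows, miss_eq_sum_rows, mul_sum]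
  refine (sum_le_sum hrow).trans ?_
  rw [sum_add_distrib]
  simp
lemma sparse_congr {l : ℕ} {H H' : Finset (ℕ × ℕ)} {i j : ℕ}
    (h : ∀ w < j, HasWalk H l i w ↔ HasWalk H' l i w) : Sparse l H i j ↔ Sparse l H' i j := by
  unfold Sparse
  rw [filter_congr fun w hw => h w (mem_Ioo.1 hw).2]

lemma sum_pow_le_of_injOn {ι : Type*} (J : Finset ι) (g : ι → ℕ) (hg : Set.InjOn g J) {x : ℝ}
    (h0 : 0 ≤ x) (h1 : x < 1) : ∑ j ∈ J, x ^ g j ≤ 1 / (1 - x) := by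
  rw [← sum_image (f := fun d => x ^ d) hg, one_div, ← tsum_geometric_of_lt_one h0 h1]
  exact (summable_geometric_of_lt_one h0 h1).sum_le_tsum _ fun d _ => pow_nonneg h0 d

/-- A set of naturals contained in an interval of length `d j` for some `j` of its elements has
exponential weight at most `1 + ∑ a ^ d j`. -/
lemma pow_card_le_one_add_sum {J : Finset ℕ} {d : ℕ → ℕ} {a : ℝ} (ha : 1 ≤ a)
    (hd : J.Nonempty → ∃ j ∈ J, #J ≤ d j) : a ^ #J ≤ 1 + ∑ j ∈ J, a ^ d j := by
  rcases J.eq_empty_or_nonempty with h | h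
  · simp [h]
  obtain ⟨j, hj, hle⟩ := hd h
  have h1 : a ^ d j ≤ ∑ j ∈ J, a ^ d j :=
    single_le_sum (f := fun j => a ^ d j) (fun i _ => by positivity) hj
  have h2 := pow_le_pow_right₀ ha hle
  linarith

lemma exp_moment_sparse_zero (n : ℕ) :
    ∑ H ∈ (forwardPairs n).powerset, (11 / 10 : ℝ) ^ sparse n 0 H
      ≤ 100 ^ n * 2 ^ #(forwardPairs n) := by
  have hE : (forwardPairs n).filter (fun e => e.1 < n) = forwardPairs n := by
    rw [filter_eq_self]
    intro e he
    rw [mem_forwardPairs] at he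
    omega
  have key := sum_powerset_prod_le (forwardPairs n) (fun e => e.1)
    (fun i H => (11 / 10 : ℝ) ^ #{j ∈ range n | i < j ∧ Sparse 0 H i j}) 100 (by norm_num)
    (fun t H => by positivity) ?_ ?_ n
  · rw [hE] at key
    refine le_trans (le_of_eq ?_) key
    refine sum_congr rfl fun H _ => ?_
    rw [sparse_eq_sum_rows, prod_pow_eq_pow_sum]
  · intro t H _
    have : ∀ j, Sparse 0 (H.filter fun e => e.1 ≤ t) t j ↔ Sparse 0 H t j := by
      refine fun j => sparse_congr fun w _ => ?_
      simp [HasWalk]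
    simp only [this]
  · intro i H hH
    set R := (forwardPairs n).filter fun e => e.1 = i with hR
    have hsp : ∀ S ⊆ R, ∀ j, Sparse 0 (H ∪ S) i j →
        (1 : ℝ) ≤ (3 / 2) ^ (j - i - 1) * (16 / 81) ^ #(S ∩ (Ioo i j).image fun w => (i, w)) := by
      intro S hS j hj
      have hc : #(S ∩ (Ioo i j).image fun w => (i, w))
          = #{w ∈ Ioo i j | HasWalk (H ∪ S) 0 i w} := by
        rw [← card_image_of_injective {w ∈ Ioo i j | HasWalk (H ∪ S) 0 i w}
          (f := fun w => (i, w)) (fun a b h => (Prod.mk.inj h).2)]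
        congr 1
        ext ⟨x, y⟩
        simp only [mem_inter, mem_image, mem_filter, HasWalk, mem_union, Prod.mk.injEq]
        constructor
        · rintro ⟨h1, w, hw, rfl, rfl⟩
          exact ⟨w, ⟨hw, Or.inr h1⟩, rfl, rfl⟩
        · rintro ⟨w, ⟨hw, h1⟩, rfl, rfl⟩
          refine ⟨h1.resolve_left fun h => ?_, w, hw, rfl, rfl⟩
          have := (mem_filter.1 (hH h)).2
          simp at this
      rw [hc]
      unfold Sparse at hj
      set c := #{w ∈ Ioo i j | HasWalk (H ∪ S) 0 i w}
      have h1 : (3 / 2 : ℝ) ^ (4 * c) ≤ (3 / 2) ^ (j - i - 1) :=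
        pow_le_pow_right₀ (by norm_num) (by omega)
      calc (1 : ℝ) = (3 / 2) ^ (4 * c) * (16 / 81) ^ c := by
            rw [pow_mul, ← mul_pow]; norm_num
        _ ≤ _ := by gcongr
    have hcount : ∀ j ∈ Ioo i n, ∑ S ∈ R.powerset, (if Sparse 0 (H ∪ S) i j then (1 : ℝ) else 0)
        ≤ (97 / 108) ^ (j - i - 1) * 2 ^ #R := by
      intro j hj
      rw [mem_Ioo] at hj
      have hsub : (Ioo i j).image (fun w => (i, w)) ⊆ R := by
        intro e he
        simp only [mem_image, mem_Ioo] at he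
        obtain ⟨w, hw, rfl⟩ := he
        rw [hR, mem_filter, mem_forwardPairs]
        exact ⟨⟨hw.1, hw.2.trans hj.2⟩, rfl⟩
      have hcard : #((Ioo i j).image fun w => (i, w)) = j - i - 1 := by
        rw [card_image_of_injective _ (fun a b h => (Prod.mk.inj h).2), Nat.card_Ioo]
      calc _ ≤ ∑ S ∈ R.powerset, (3 / 2 : ℝ) ^ (j - i - 1) *
            (16 / 81) ^ #(S ∩ (Ioo i j).image fun w => (i, w)) := by
            refine sum_le_sum fun S hS => ?_
            split_ifs with h
            · exact hsp S (mem_powerset.1 hS) j h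
            · positivity
        _ = _ := by
            rw [← mul_sum, sum_powerset_pow_card_inter _ _ hsub, hcard, ← mul_assoc, ← mul_pow]
            norm_num
    calc ∑ S ∈ R.powerset, (11 / 10 : ℝ) ^ #{j ∈ range n | i < j ∧ Sparse 0 (H ∪ S) i j}
        ≤ ∑ S ∈ R.powerset, (1 + ∑ j ∈ Ioo i n,
            (if Sparse 0 (H ∪ S) i j then (1 : ℝ) else 0) * (11 / 10) ^ (j - i)) := by
          refine sum_le_sum fun S _ => ?_
          refine (pow_card_le_one_add_sum (d := fun j => j - i) (by norm_num) ?_).trans ?_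
          · intro hne
            obtain ⟨m, hm, hmax⟩ := exists_max_image _ id hne
            refine ⟨m, hm, ?_⟩
            rw [← Nat.card_Ioc]
            refine card_le_card fun j hj => mem_Ioc.2 ⟨?_, hmax j hj⟩
            exact (mem_filter.1 hj).2.1
          · have : ({j ∈ range n | i < j ∧ Sparse 0 (H ∪ S) i j} : Finset ℕ)
                = {j ∈ Ioo i n | Sparse 0 (H ∪ S) i j} := by
              ext j
              simp only [mem_filter, mem_range, mem_Ioo]
              tauto
            rw [this, sum_filter]
            simp only [ite_mul, one_mul, zero_mul, le_refl]
      _ = 2 ^ #R + ∑ j ∈ Ioo i n, (∑ S ∈ R.powerset,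
            (if Sparse 0 (H ∪ S) i j then (1 : ℝ) else 0)) * (11 / 10) ^ (j - i) := by
          rw [sum_add_distrib, sum_comm]
          simp only [sum_const, card_powerset, nsmul_eq_mul, mul_one, sum_mul]
          push_cast
          rfl
      _ ≤ 2 ^ #R + ∑ j ∈ Ioo i n, (11 / 10 * 2 ^ #R) * (1067 / 1080 : ℝ) ^ (j - i - 1) := by
          refine add_le_add_right (sum_le_sum fun j hj => ?_) _
          have hj' := mem_Ioo.1 hj
          refine (mul_le_mul_of_nonneg_right (hcount j hj) (by positivity)).trans (le_of_eq ?_)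
          have : j - i = (j - i - 1) + 1 := by omega
          rw [this, pow_succ, Nat.add_sub_cancel,
            show (1067 / 1080 : ℝ) = 97 / 108 * (11 / 10) by norm_num, mul_pow]
          ring
      _ ≤ 100 * 2 ^ #R := by
          rw [← mul_sum]
          have hg := sum_pow_le_of_injOn (Ioo i n) (fun j => j - i - 1) (fun a ha b hb h => by
            have ha := mem_Ioo.1 (mem_coe.1 ha)
            have hb := mem_Ioo.1 (mem_coe.1 hb)
            simp only at h
            omega) (x := 1067 / 1080) (by norm_num) (by norm_num)
          have h2 : (0 : ℝ) < 2 ^ #R := by positivity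
          have h3 := mul_le_mul_of_nonneg_left hg (by positivity : (0 : ℝ) ≤ 11 / 10 * 2 ^ #R)
          norm_num at h3
          nlinarith

lemma exp_moment_missIn_step {n l j : ℕ} {a : ℝ} (ha : 1 ≤ a) (ha' : a ≤ 11 / 10) (hj : j < n)
    (H : Finset (ℕ × ℕ)) :
    ∑ S ∈ ((forwardPairs n).filter fun e => e.2 = j).powerset, a ^ missIn (l + 1) (H ∪ S) j
      ≤ a ^ sparseIn l H j * (20 * 2 ^ #((forwardPairs n).filter fun e => e.2 = j)) := by
  set R := (forwardPairs n).filter fun e => e.2 = j with hR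
  let N : ℕ → Finset (ℕ × ℕ) := fun i => {w ∈ Ioo i j | HasWalk H l i w}.image fun w => (w, j)
  have hNR : ∀ i, N i ⊆ R := by
    intro i e he
    simp only [N, mem_image, mem_filter, mem_Ioo] at he
    obtain ⟨w, hw, rfl⟩ := he
    rw [hR, mem_filter, mem_forwardPairs]
    exact ⟨⟨hw.1.2, hj⟩, rfl⟩
  have hNc : ∀ i, #(N i) = #{w ∈ Ioo i j | HasWalk H l i w} := fun i =>
    card_image_of_injective _ (fun a b h => (Prod.mk.inj h).1)
  let J : Finset (ℕ × ℕ) → Finset ℕ := fun S => {i ∈ range j | ¬ Sparse l H i j ∧ S ∩ N i = ∅}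
  have hmiss : ∀ S, missIn (l + 1) (H ∪ S) j ≤ sparseIn l H j + #(J S) := by
    intro S
    refine le_trans (card_le_card ?_) (card_union_le _ _)
    intro i hi
    simp only [mem_union, mem_filter, J] at hi ⊢
    by_cases h : Sparse l H i j
    · exact Or.inl ⟨hi.1, h⟩
    refine Or.inr ⟨hi.1, h, ?_⟩
    rw [eq_empty_iff_forall_notMem]
    intro e he
    simp only [N, mem_inter, mem_image, mem_filter] at he
    obtain ⟨heS, w, ⟨_, hw⟩, rfl⟩ := he
    exact hi.2 ⟨w, hw.mono subset_union_left, mem_union_right _ heS⟩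
  have hcount : ∀ i ∈ range j, ∑ S ∈ R.powerset,
      (if ¬ Sparse l H i j ∧ S ∩ N i = ∅ then (1 : ℝ) else 0)
        ≤ (17 / 20) ^ (j - i - 1) * 2 ^ #R := by
    intro i hi
    by_cases h : Sparse l H i j
    · simp only [h, not_true_eq_false, false_and, if_false, sum_const_zero]
      positivity
    have h1 : ∀ S : Finset (ℕ × ℕ),
        (if ¬ Sparse l H i j ∧ S ∩ N i = ∅ then (1 : ℝ) else 0) = 0 ^ #(S ∩ N i) := by
      intro S
      rw [zero_pow_eq]
      simp [h]
    simp_rw [h1]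
    rw [sum_powerset_pow_card_inter _ _ (hNR i), hNc]
    refine mul_le_mul_of_nonneg_right ?_ (by positivity)
    unfold Sparse at h
    set c := #{w ∈ Ioo i j | HasWalk H l i w}
    calc ((1 + 0) / 2 : ℝ) ^ c ≤ ((17 / 20) ^ 4) ^ c := by gcongr; norm_num
      _ = (17 / 20) ^ (4 * c) := by rw [pow_mul]
      _ ≤ _ := pow_le_pow_of_le_one (by norm_num) (by norm_num) (by omega)
  have ha0 : 0 < a := by linarith
  calc ∑ S ∈ R.powerset, a ^ missIn (l + 1) (H ∪ S) j
      ≤ ∑ S ∈ R.powerset, a ^ sparseIn l H j * (1 + ∑ i ∈ range j,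
          (if ¬ Sparse l H i j ∧ S ∩ N i = ∅ then (1 : ℝ) else 0) * (11 / 10) ^ (j - i)) := by
        refine sum_le_sum fun S _ => ?_
        refine (pow_le_pow_right₀ ha (hmiss S)).trans ?_
        rw [pow_add]
        refine mul_le_mul_of_nonneg_left ?_ (by positivity)
        refine (pow_le_pow_left₀ ha0.le ha' _).trans ?_
        refine (pow_card_le_one_add_sum (d := fun i => j - i) (by norm_num) ?_).trans ?_
        · intro hne
          obtain ⟨m, hm, hmin⟩ := exists_min_image _ id hne
          refine ⟨m, hm, ?_⟩
          rw [← Nat.card_Ico]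
          refine card_le_card fun i hi => mem_Ico.2 ⟨hmin i hi, ?_⟩
          exact mem_range.1 (mem_filter.1 hi).1
        · simp only [J, sum_filter]
          simp only [ite_mul, one_mul, zero_mul, le_refl]
    _ = a ^ sparseIn l H j * (2 ^ #R + ∑ i ∈ range j, (∑ S ∈ R.powerset,
          (if ¬ Sparse l H i j ∧ S ∩ N i = ∅ then (1 : ℝ) else 0)) * (11 / 10) ^ (j - i)) := by
        rw [← mul_sum, sum_add_distrib, sum_comm]
        simp only [sum_const, card_powerset, nsmul_eq_mul, mul_one, sum_mul]
        push_cast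
        rfl
    _ ≤ a ^ sparseIn l H j * (2 ^ #R +
          ∑ i ∈ range j, (11 / 10 * 2 ^ #R) * (187 / 200 : ℝ) ^ (j - i - 1)) := by
        refine mul_le_mul_of_nonneg_left ?_ (by positivity)
        refine add_le_add_right (sum_le_sum fun i hi => ?_) _
        refine (mul_le_mul_of_nonneg_right (hcount i hi) (by positivity)).trans (le_of_eq ?_)
        rw [mem_range] at hi
        have : j - i = (j - i - 1) + 1 := by omega
        rw [this, pow_succ, Nat.add_sub_cancel,
          show (187 / 200 : ℝ) = 17 / 20 * (11 / 10) by norm_num, mul_pow]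
        ring
    _ ≤ _ := by
        refine mul_le_mul_of_nonneg_left ?_ (by positivity)
        rw [← mul_sum]
        have hg := sum_pow_le_of_injOn (range j) (fun i => j - i - 1) (fun a ha b hb h => by
          have ha := mem_range.1 (mem_coe.1 ha)
          have hb := mem_range.1 (mem_coe.1 hb)
          simp only at h
          omega) (x := 187 / 200) (by norm_num) (by norm_num)
        have h2 : (0 : ℝ) < 2 ^ #R := by positivity
        have h3 := mul_le_mul_of_nonneg_left hg (by positivity : (0 : ℝ) ≤ 11 / 10 * 2 ^ #R)
        norm_num at h3
        nlinarith

lemma exp_moment_miss_div_sparse (n l : ℕ) {a : ℝ} (ha : 1 ≤ a) (ha' : a ≤ 11 / 10) :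
    ∑ H ∈ (forwardPairs n).powerset, a ^ miss n (l + 1) H / a ^ sparse n l H
      ≤ 20 ^ n * 2 ^ #(forwardPairs n) := by
  have ha0 : 0 < a := by linarith
  have hE : (forwardPairs n).filter (fun e => e.2 < n) = forwardPairs n := by
    rw [filter_eq_self]
    intro e he
    rw [mem_forwardPairs] at he
    omega
  have hlt : ∀ H ⊆ forwardPairs n, ∀ e ∈ H, e.1 < e.2 := fun H hH e he =>
    (mem_forwardPairs.1 (hH he)).1
  have key := sum_powerset_prod_le (forwardPairs n) (fun e => e.2)
    (fun j H => if j < n then a ^ missIn (l + 1) H j / a ^ sparseIn l H j else 0) 20 (by norm_num)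
    (fun t H => by split_ifs <;> positivity) ?_ ?_ n
  · rw [hE] at key
    refine le_trans (le_of_eq ?_) key
    refine sum_congr rfl fun H _ => ?_
    rw [miss, sparse, ← prod_pow_eq_pow_sum, ← prod_pow_eq_pow_sum, ← prod_div_distrib]
    refine prod_congr rfl fun j hj => ?_
    rw [if_pos (mem_range.1 hj)]
  · intro t H hH
    have h1 : missIn (l + 1) (H.filter fun e => e.2 ≤ t) t = missIn (l + 1) H t := by
      simp only [missIn, hasWalk_filter_iff (hlt H hH) le_rfl]
    have h2 : sparseIn l (H.filter fun e => e.2 ≤ t) t = sparseIn l H t := by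
      simp only [sparseIn, sparse_congr fun w (hw : w < t) =>
        hasWalk_filter_iff (hlt H hH) hw.le]
    simp only [h1, h2]
  · intro j H hH
    by_cases hj : j < n
    · simp only [if_pos hj]
      have hs : ∀ S ∈ ((forwardPairs n).filter fun e => e.2 = j).powerset,
          sparseIn l (H ∪ S) j = sparseIn l H j := by
        intro S hS
        rw [mem_powerset] at hS
        have hsub : H ∪ S ⊆ forwardPairs n := union_subset (hH.trans (filter_subset _ _))
          (hS.trans (filter_subset _ _))
        have : ∀ i, Sparse l (H ∪ S) i j ↔ Sparse l H i j := by
          refine fun i => sparse_congr fun w hw => ?_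
          rw [← hasWalk_filter_iff (hlt _ hsub) (Nat.le_sub_one_of_lt hw)]
          have : (H ∪ S).filter (fun e => e.2 ≤ j - 1) = H := by
            ext e
            simp only [mem_filter, mem_union]
            have h1 := @hH e
            have h2 := @hS e
            simp only [mem_filter] at h1 h2
            constructor
            · rintro ⟨h | h, h'⟩
              · exact h
              · have := (h2 h).2
                omega
            · intro h
              have := (h1 h).2
              exact ⟨Or.inl h, by omega⟩
          rw [this]
        simp only [sparseIn, this]
      rw [sum_congr rfl fun S hS => by rw [hs S hS], ← sum_div,
        div_le_iff₀ (by positivity), mul_comm _ (a ^ _)]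
      exact exp_moment_missIn_step ha ha' hj H
    · simp only [if_neg hj, sum_const_zero]
      positivity

lemma exists_one_lt_pow_eq {a : ℝ} (ha : 1 < a) {p : ℕ} (hp : p ≠ 0) :
    ∃ b : ℝ, 1 < b ∧ b ^ p = a := by
  have h : (a ^ ((p : ℝ)⁻¹)) ^ p = a := Real.rpow_inv_natCast_pow (by linarith) hp
  exact ⟨_, Real.one_lt_rpow ha (by positivity), h⟩

lemma exp_moment_miss_succ {l : ℕ} {a K : ℝ} (ha : 1 < a) (ha' : a ≤ 11 / 10) (hK : 1 ≤ K)
    (h : ∀ n, ∑ H ∈ (forwardPairs n).powerset, a ^ sparse n l H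
      ≤ K ^ n * 2 ^ #(forwardPairs n)) :
    ∃ b L : ℝ, 1 < b ∧ b ≤ 11 / 10 ∧ 1 ≤ L ∧ ∀ n,
      ∑ H ∈ (forwardPairs n).powerset, b ^ miss n (l + 1) H ≤ L ^ n * 2 ^ #(forwardPairs n) := by
  obtain ⟨b, hb, hba⟩ := exists_one_lt_pow_eq ha two_ne_zero
  have hb0 : 0 < b := by linarith
  refine ⟨b, 20 * K, hb, by nlinarith, by linarith, fun n => ?_⟩
  have hcs := sum_mul_sq_le_sq_mul_sq (forwardPairs n).powerset
    (fun H => b ^ miss n (l + 1) H / b ^ sparse n l H) (fun H => b ^ sparse n l H)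
  have e1 : ∀ H, b ^ miss n (l + 1) H / b ^ sparse n l H * b ^ sparse n l H
      = b ^ miss n (l + 1) H := fun H => div_mul_cancel₀ _ (by positivity)
  have e2 : ∀ H, (b ^ miss n (l + 1) H / b ^ sparse n l H) ^ 2
      = a ^ miss n (l + 1) H / a ^ sparse n l H := by
    intro H
    rw [div_pow, ← pow_mul, ← pow_mul, mul_comm, pow_mul, mul_comm, pow_mul, hba]
  have e3 : ∀ H, (b ^ sparse n l H) ^ 2 = a ^ sparse n l H := by
    intro H
    rw [← pow_mul, mul_comm, pow_mul, hba]
  simp only [e1, e2, e3] at hcs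
  have h1 := exp_moment_miss_div_sparse n l ha.le ha'
  have h2 := h n
  refine le_of_sq_le_sq ?_ (by positivity)
  refine hcs.trans ((mul_le_mul h1 h2 (sum_nonneg fun _ _ => by positivity)
    (by positivity)).trans ?_)
  rw [show (20 : ℝ) ^ n * 2 ^ #(forwardPairs n) * (K ^ n * 2 ^ #(forwardPairs n))
    = (20 * K) ^ n * (2 ^ #(forwardPairs n)) ^ 2 by rw [mul_pow]; ring, mul_pow ((20 * K) ^ n)]
  refine mul_le_mul_of_nonneg_right ?_ (by positivity)
  exact le_self_pow₀ (one_le_pow₀ (by linarith)) two_ne_zero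

lemma exp_moment_sparse_of_miss {l : ℕ} {a K : ℝ} (ha : 1 < a) (ha' : a ≤ 11 / 10) (hK : 1 ≤ K)
    (h : ∀ n, ∑ H ∈ (forwardPairs n).powerset, a ^ miss n l H
      ≤ K ^ n * 2 ^ #(forwardPairs n)) :
    ∃ b L : ℝ, 1 < b ∧ b ≤ 11 / 10 ∧ 1 ≤ L ∧ ∀ n,
      ∑ H ∈ (forwardPairs n).powerset, b ^ sparse n l H ≤ L ^ n * 2 ^ #(forwardPairs n) := by
  obtain ⟨b, hb, hba⟩ := exists_one_lt_pow_eq ha two_ne_zero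
  refine ⟨b, b * K, hb, by nlinarith, by nlinarith, fun n => ?_⟩
  calc _ ≤ ∑ H ∈ (forwardPairs n).powerset, b ^ n * a ^ miss n l H := by
        refine sum_le_sum fun H _ => (pow_le_pow_right₀ hb.le (sparse_le n l H)).trans ?_
        rw [pow_add, pow_mul, hba, mul_comm]
    _ ≤ b ^ n * (K ^ n * 2 ^ #(forwardPairs n)) := by
        rw [← mul_sum]
        exact mul_le_mul_of_nonneg_left (h n) (by positivity)
    _ = _ := by rw [mul_pow]; ring

lemma exp_moment_sparse (l : ℕ) : ∃ a K : ℝ, 1 < a ∧ a ≤ 11 / 10 ∧ 1 ≤ K ∧ ∀ n,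
    ∑ H ∈ (forwardPairs n).powerset, a ^ sparse n l H ≤ K ^ n * 2 ^ #(forwardPairs n) := by
  induction l with
  | zero => exact ⟨11 / 10, 100, by norm_num, le_rfl, by norm_num, exp_moment_sparse_zero⟩
  | succ l ih =>
    obtain ⟨a, K, ha, ha', hK, h⟩ := ih
    obtain ⟨b, L, hb, hb', hL, h'⟩ := exp_moment_miss_succ ha ha' hK h
    exact exp_moment_sparse_of_miss hb hb' hL h'

/-- The number of pairs not joined by a walk of `l + 2` arcs has a finite exponential moment per
vertex in a uniformly random forward graph. -/
lemma exp_moment_miss (l : ℕ) : ∃ a K : ℝ, 1 < a ∧ 1 ≤ K ∧ ∀ n,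
    ∑ H ∈ (forwardPairs n).powerset, a ^ miss n (l + 1) H ≤ K ^ n * 2 ^ #(forwardPairs n) := by
  obtain ⟨a, K, ha, ha', hK, h⟩ := exp_moment_sparse l
  obtain ⟨b, L, hb, _, hL, h'⟩ := exp_moment_miss_succ ha ha' hK h
  exact ⟨b, L, hb, hL, h'⟩

section Acyclic

variable {n : ℕ}

/-- All arcs of `D` go forward in the ordering `σ`. -/
def Respects (σ : Equiv.Perm (Fin n)) (D : ArcSet n) : Prop := ∀ e ∈ D, σ e.1 < σ e.2

/-- The acyclic digraphs on `Fin n`. -/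
noncomputable def dags (n : ℕ) : Finset (ArcSet n) :=
  univ.filter fun D => ∃ σ : Equiv.Perm (Fin n), Respects σ D

/-- A topological ordering of an acyclic digraph. -/
noncomputable def topo (D : ArcSet n) : Equiv.Perm (Fin n) :=
  if h : ∃ σ : Equiv.Perm (Fin n), Respects σ D then h.choose else 1

lemma respects_topo {D : ArcSet n} (hD : D ∈ dags n) : Respects (topo D) D := by
  have h := (mem_filter.1 hD).2
  rw [topo, dif_pos h]
  exact h.choose_spec

/-- The arcs of `D`, written in terms of the positions of their ends in `σ`. -/
noncomputable def place (σ : Equiv.Perm (Fin n)) (D : ArcSet n) : Finset (ℕ × ℕ) :=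
  D.image fun e => ((σ e.1 : ℕ), (σ e.2 : ℕ))

/-- The digraph whose arcs have the positions given by `H`. -/
noncomputable def unplace (σ : Equiv.Perm (Fin n)) (H : Finset (ℕ × ℕ)) : ArcSet n :=
  univ.filter fun e => ((σ e.1 : ℕ), (σ e.2 : ℕ)) ∈ H

lemma place_pair_injective (σ : Equiv.Perm (Fin n)) :
    Function.Injective fun e : Fin n × Fin n => ((σ e.1 : ℕ), (σ e.2 : ℕ)) := by
  rintro ⟨a, b⟩ ⟨c, d⟩ h
  simp only [Prod.mk.injEq] at h
  rw [σ.injective (Fin.ext h.1), σ.injective (Fin.ext h.2)]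

lemma place_injective (σ : Equiv.Perm (Fin n)) : Function.Injective (place σ) :=
  image_injective (place_pair_injective σ)

lemma place_subset {σ : Equiv.Perm (Fin n)} {D : ArcSet n} (h : Respects σ D) :
    place σ D ⊆ forwardPairs n := by
  intro e he
  obtain ⟨x, hx, rfl⟩ := mem_image.1 he
  exact mem_forwardPairs.2 ⟨h x hx, (σ x.2).2⟩

lemma unplace_mem_dags (σ : Equiv.Perm (Fin n)) {H : Finset (ℕ × ℕ)} (hH : H ⊆ forwardPairs n) :
    unplace σ H ∈ dags n :=
  mem_filter.2 ⟨mem_univ _, σ, fun _ he => (mem_forwardPairs.1 (hH (mem_filter.1 he).2)).1⟩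

lemma place_unplace (σ : Equiv.Perm (Fin n)) {H : Finset (ℕ × ℕ)} (hH : H ⊆ forwardPairs n) :
    place σ (unplace σ H) = H := by
  ext ⟨x, y⟩
  constructor
  · intro h
    obtain ⟨e, he, h⟩ := mem_image.1 h
    rw [← h]
    exact (mem_filter.1 he).2
  · intro h
    have h' := mem_forwardPairs.1 (hH h)
    simp only at h'
    refine mem_image.2 ⟨(σ.symm ⟨x, h'.1.trans h'.2⟩, σ.symm ⟨y, h'.2⟩), ?_, ?_⟩
    · simpa [unplace] using h
    · simp

lemma eq_of_strictMono_comp {σ τ : Equiv.Perm (Fin n)} (h : StrictMono (σ.symm.trans τ)) :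
    σ = τ := by
  have := (h.range_inj strictMono_id).1 (by rw [Equiv.range_eq_univ, Set.range_id])
  ext x
  have h2 := congrFun this (σ x)
  simp at h2
  rw [h2]

/-- A Hamiltonian path determines the topological ordering. -/
lemma unplace_ordering_unique {σ τ : Equiv.Perm (Fin n)} {A B : Finset (ℕ × ℕ)}
    (hA : ∀ i, i + 1 < n → (i, i + 1) ∈ A) (hB : B ⊆ forwardPairs n)
    (h : unplace σ A = unplace τ B) : σ = τ := by
  apply eq_of_strictMono_comp
  cases n with
  | zero => exact fun a => a.elim0
  | succ n =>
    rw [Fin.strictMono_iff_lt_succ]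
    intro i
    have h1 : (σ.symm i.castSucc, σ.symm i.succ) ∈ unplace σ A := by
      simpa [unplace] using hA i (by omega)
    rw [h] at h1
    exact (mem_forwardPairs.1 (hB (mem_filter.1 h1).2)).1

lemma factorial_mul_le_card_dags (n : ℕ) :
    n.factorial * 2 ^ #(forwardPairs n) ≤ 2 ^ n * #(dags n) := by
  set P : Finset (ℕ × ℕ) := (range (n - 1)).image fun i => (i, i + 1) with hP
  have hPE : P ⊆ forwardPairs n := by
    intro e he
    obtain ⟨i, hi, rfl⟩ := mem_image.1 he
    rw [mem_range] at hi
    exact mem_forwardPairs.2 ⟨by simp, by simp only; omega⟩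
  have hPm : ∀ H : Finset (ℕ × ℕ), ∀ i, i + 1 < n → (i, i + 1) ∈ H ∪ P := by
    intro H i hi
    refine mem_union_right _ (mem_image.2 ⟨i, ?_, rfl⟩)
    rw [mem_range]
    omega
  have hPc : #P ≤ n := card_image_le.trans (by rw [card_range]; omega)
  have key : #((univ : Finset (Equiv.Perm (Fin n))) ×ˢ (forwardPairs n).powerset)
      ≤ #(P.powerset ×ˢ dags n) := by
    refine card_le_card_of_injOn (fun x => (x.2 ∩ P, unplace x.1 (x.2 ∪ P))) ?_ ?_
    · rintro ⟨σ, H⟩ hx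
      simp only [coe_product, Set.mem_prod, mem_coe, mem_powerset] at hx ⊢
      exact ⟨inter_subset_right, unplace_mem_dags _ (union_subset hx.2 hPE)⟩
    · rintro ⟨σ, H⟩ hx ⟨τ, K⟩ hy h
      simp only [coe_product, Set.mem_prod, mem_coe, mem_powerset] at hx hy
      simp only [Prod.mk.injEq] at h
      have hσ := unplace_ordering_unique (hPm H) (union_subset hy.2 hPE) h.2
      subst hσ
      have h2 := congrArg (place σ) h.2
      rw [place_unplace _ (union_subset hx.2 hPE), place_unplace _ (union_subset hy.2 hPE)] at h2
      congr 1
      ext e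
      have e1 := congrArg (e ∈ ·) h.1
      have e2 := congrArg (e ∈ ·) h2
      simp only [mem_inter, mem_union, eq_iff_iff] at e1 e2
      tauto
  rw [card_product, card_product, card_powerset, card_powerset, card_univ, Fintype.card_perm,
    Fintype.card_fin] at key
  exact key.trans (Nat.mul_le_mul_right _ (Nat.pow_le_pow_right two_pos hPc))

lemma sum_dags_le (n : ℕ) (g : Finset (ℕ × ℕ) → ℝ) (hg : ∀ H, 0 ≤ g H) :
    ∑ D ∈ dags n, g (place (topo D) D)
      ≤ n.factorial * ∑ H ∈ (forwardPairs n).powerset, g H := by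
  have hinj : Set.InjOn (fun D : ArcSet n => (topo D, place (topo D) D)) (dags n) := by
    intro D _ D' _ h
    simp only [Prod.mk.injEq] at h
    obtain ⟨h1, h2⟩ := h
    rw [h1] at h2
    exact place_injective _ h2
  calc _ = ∑ x ∈ (dags n).image fun D => (topo D, place (topo D) D), g x.2 :=
        (sum_image (f := fun x : Equiv.Perm (Fin n) × Finset (ℕ × ℕ) => g x.2) hinj).symm
    _ ≤ ∑ x ∈ (univ : Finset (Equiv.Perm (Fin n))) ×ˢ (forwardPairs n).powerset, g x.2 := by
        refine sum_le_sum_of_subset_of_nonneg ?_ fun _ _ _ => hg _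
        intro x hx
        obtain ⟨D, hD, rfl⟩ := mem_image.1 hx
        exact mem_product.2 ⟨mem_univ _, mem_powerset.2 (place_subset (respects_topo hD))⟩
    _ = _ := by
        rw [sum_product]
        simp [Fintype.card_perm]

/-- The pairs which, added to the acyclic digraph `D`, are backward arcs closing no cycle
of length `l + 2`. -/
noncomputable def addable (l : ℕ) (D : ArcSet n) : ArcSet n :=
  univ.filter fun e => topo D e.2 < topo D e.1 ∧
    ¬ HasWalk (place (topo D) D) l (topo D e.2) (topo D e.1)

lemma card_addable_le (l : ℕ) (D : ArcSet n) :
    #(addable l D) ≤ miss n l (place (topo D) D) := by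
  set H := place (topo D) D
  rw [miss]
  simp_rw [missIn]
  rw [← card_sigma]
  refine card_le_card_of_injOn (fun e => ⟨topo D e.1, topo D e.2⟩) ?_ ?_
  · intro e he
    simp only [addable, coe_filter, mem_univ, true_and, Set.mem_ofPred_eq] at he
    simp only [coe_sigma, Set.mem_sigma_iff, mem_coe, mem_filter, mem_range]
    exact ⟨(topo D e.1).2, he.1, he.2⟩
  · rintro ⟨a, b⟩ _ ⟨c, d⟩ _ h
    simp only [Sigma.mk.injEq, heq_eq_eq] at h
    rw [(topo D).injective (Fin.ext h.1), (topo D).injective (Fin.ext h.2)]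

lemma HasWalk.exists_seq {H : Finset (ℕ × ℕ)} {l i j : ℕ} (h : HasWalk H l i j) :
    ∃ p : ℕ → ℕ, p 0 = i ∧ p (l + 1) = j ∧ ∀ t ≤ l, (p t, p (t + 1)) ∈ H := by
  induction l generalizing j with
  | zero =>
    refine ⟨fun t => if t = 0 then i else j, by simp, by simp, fun t ht => ?_⟩
    obtain rfl : t = 0 := by omega
    simpa [HasWalk] using h
  | succ l ih =>
    obtain ⟨w, hw, hj⟩ := h
    obtain ⟨p, h0, h1, h2⟩ := ih hw
    refine ⟨fun t => if t ≤ l + 1 then p t else j, by simp [h0], by simp, fun t ht => ?_⟩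
    rcases Nat.lt_or_ge t (l + 1) with h | h
    · simp only [if_pos ht, if_pos (show t + 1 ≤ l + 1 by omega)]
      exact h2 t (by omega)
    · obtain rfl : t = l + 1 := by omega
      simp only [le_refl, if_true, if_neg (show ¬ l + 1 + 1 ≤ l + 1 by omega), h1]
      exact hj

/-- A walk that goes forward in an ordering, together with an arc back, is a directed cycle. -/
lemma containsCycle_of_hasWalk {σ : Equiv.Perm (Fin n)} {D G : ArcSet n} (hσ : Respects σ D)
    (hDG : D ⊆ G) {l : ℕ} {u v : Fin n} (hvu : (v, u) ∈ G)
    (hw : HasWalk (place σ D) l (σ u) (σ v)) : ContainsCycle (l + 2) G := by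
  obtain ⟨p, h0, h1, h2⟩ := hw.exists_seq
  have harc : ∀ t ≤ l, ∃ e ∈ D, (σ e.1 : ℕ) = p t ∧ (σ e.2 : ℕ) = p (t + 1) := by
    intro t ht
    obtain ⟨e, he, h⟩ := mem_image.1 (h2 t ht)
    simp only [Prod.mk.injEq] at h
    exact ⟨e, he, h⟩
  have hlt : ∀ t < l + 2, p t < n := by
    intro t ht
    rcases Nat.lt_or_ge t (l + 1) with h | h
    · obtain ⟨e, _, h, _⟩ := harc t (by omega)
      rw [← h]
      exact (σ e.1).2
    · obtain rfl : t = l + 1 := by omega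
      rw [h1]
      exact (σ v).2
  have hmono : ∀ s t, s < t → t < l + 2 → p s < p t := by
    intro s t hst
    induction t, hst using Nat.le_induction with
    | base =>
      intro ht
      obtain ⟨e, he, h, h'⟩ := harc s (by omega)
      rw [← h, ← h']
      exact hσ e he
    | succ t _ ih =>
      intro ht
      obtain ⟨e, he, h, h'⟩ := harc t (by omega)
      refine (ih (by omega)).trans ?_
      rw [← h, ← h']
      exact hσ e he
  let f : Fin (l + 2) → Fin n := fun x => σ.symm ⟨p x, hlt x x.2⟩
  refine ⟨f, ?_, ?_⟩
  · change ∀ x y : Fin (l + 2), f x = f y → x = y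
    intro x y h
    have h' : p x = p y := by simpa [f] using h
    by_contra hne
    rcases lt_or_gt_of_ne (fun h => hne (Fin.ext h) : (x : ℕ) ≠ y) with h3 | h3
    · exact absurd h' (hmono _ _ h3 y.2).ne
    · exact absurd h' (hmono _ _ h3 x.2).ne'
  · change ∀ i : Fin (l + 2), (f i, f (i + 1)) ∈ G
    intro i
    by_cases hi : i = Fin.last (l + 1)
    · subst hi
      have e1 : f (Fin.last (l + 1)) = v := by
        simp only [f, Equiv.symm_apply_eq]
        exact Fin.ext h1
      have e2 : f (Fin.last (l + 1) + 1) = u := by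
        simp only [f, Equiv.symm_apply_eq, Fin.last_add_one]
        exact Fin.ext h0
      rw [e1, e2]
      exact hvu
    · have hi' : ((i + 1 : Fin (l + 2)) : ℕ) = i + 1 := by
        rw [Fin.val_add_one, if_neg hi]
      have hil : (i : ℕ) ≤ l := by
        have := Fin.val_lt_last hi
        omega
      obtain ⟨e, he, h, h'⟩ := harc i hil
      have e1 : f i = e.1 := by
        simp only [f, Equiv.symm_apply_eq]
        exact Fin.ext h.symm
      have e2 : f (i + 1) = e.2 := by
        simp only [f, Equiv.symm_apply_eq]
        refine Fin.ext ?_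
        simp only [hi']
        exact h'.symm
      rw [e1, e2]
      exact hDG he

/-- Removing the backward arcs of an optimal ordering of `G` leaves an acyclic digraph `D` such
that every removed arc is backward for every topological ordering of `D`. -/
lemma exists_dag_union {l : ℕ} {G : ArcSet n} (hor : IsOriented G) (hfree : CkFree (l + 2) G) :
    ∃ D ∈ dags n, ∃ B ⊆ addable l D, #B = bMin G ∧ D ∪ B = G := by
  obtain ⟨σ, _, hσ⟩ := exists_mem_eq_inf' (univ_nonempty (α := Equiv.Perm (Fin n))) (backCount G)
  set B := G.filter fun e => σ e.2 < σ e.1 with hB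
  set D := G.filter fun e => ¬ σ e.2 < σ e.1 with hD
  have hBc : #B = bMin G := hσ.symm
  have hDB : D ∪ B = G := by
    rw [union_comm]
    exact filter_union_filter_not_eq _ _
  have hDσ : Respects σ D := by
    rintro ⟨u, v⟩ he
    rw [hD, mem_filter] at he
    refine lt_of_le_of_ne (not_lt.1 he.2) fun h => ?_
    have : u = v := σ.injective h
    subst this
    exact hor.1 u he.1
  have hDd : D ∈ dags n := mem_filter.2 ⟨mem_univ _, σ, hDσ⟩
  have hτ := respects_topo hDd
  have hsub : G.filter (fun e => topo D e.2 < topo D e.1) ⊆ B := by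
    intro e he
    rw [mem_filter] at he
    by_contra hne
    have : e ∈ D := by
      have := he.1
      rw [← hDB, mem_union] at this
      tauto
    exact absurd he.2 (hτ e this).asymm
  have heq : G.filter (fun e => topo D e.2 < topo D e.1) = B := by
    refine eq_of_subset_of_card_le hsub ?_
    rw [hBc]
    exact inf'_le (backCount G) (mem_univ (topo D))
  refine ⟨D, hDd, B, ?_, hBc, hDB⟩
  rintro ⟨v, u⟩ he
  have he' := he
  rw [← heq, mem_filter] at he'
  refine mem_filter.2 ⟨mem_univ _, he'.2, fun hw => hfree ?_⟩
  exact containsCycle_of_hasWalk hτ (filter_subset _ _) he'.1 hw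

lemma card_few_backwards_le (l q : ℕ) (n : ℕ) :
    #{G : ArcSet n | IsOriented G ∧ CkFree (l + 2) G ∧ q * bMin G ≤ n}
      ≤ ∑ D ∈ dags n, #{B ∈ (addable l D).powerset | q * #B ≤ n} := by
  rw [← card_sigma]
  refine (card_le_card ?_).trans
    (card_image_le (f := fun x : (Σ _ : ArcSet n, ArcSet n) => x.1 ∪ x.2))
  intro G hG
  obtain ⟨h1, h2, h3⟩ := (mem_filter.1 hG).2
  obtain ⟨D, hD, B, hB, hBc, hDB⟩ := exists_dag_union h1 h2
  refine mem_image.2 ⟨⟨D, B⟩, mem_sigma.2 ⟨hD, mem_filter.2 ⟨mem_powerset.2 hB, ?_⟩⟩, hDB⟩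
  rw [hBc]
  exact h3

end Acyclic

lemma card_small_subsets_le {α : Type*} [DecidableEq α] (X : Finset α) {q n : ℕ} {t μ : ℝ}
    (ht : 0 < t) (hμ : 1 ≤ μ) (htμ : 1 / t ≤ μ ^ q) :
    (#{B ∈ X.powerset | q * #B ≤ n} : ℝ) ≤ μ ^ n * (1 + t) ^ #X := by
  have h1 : ∀ B : Finset α, q * #B ≤ n → (1 : ℝ) ≤ μ ^ n * t ^ #B := by
    intro B hB
    calc (1 : ℝ) = (1 / t) ^ #B * t ^ #B := by
          rw [← mul_pow, one_div_mul_cancel ht.ne', one_pow]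
      _ ≤ (μ ^ q) ^ #B * t ^ #B := by gcongr
      _ ≤ μ ^ n * t ^ #B := by
          rw [← pow_mul]
          gcongr
  calc (#{B ∈ X.powerset | q * #B ≤ n} : ℝ)
      = ∑ B ∈ X.powerset with q * #B ≤ n, (1 : ℝ) := by simp
    _ ≤ ∑ B ∈ X.powerset with q * #B ≤ n, μ ^ n * t ^ #B :=
        sum_le_sum fun B hB => h1 B (mem_filter.1 hB).2
    _ ≤ ∑ B ∈ X.powerset, μ ^ n * t ^ #B :=
        sum_le_sum_of_subset_of_nonneg (filter_subset _ _) fun _ _ _ => by positivity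
    _ = _ := by
        rw [← mul_sum]
        congr 1
        have := prod_one_add (f := fun _ : α => t) X
        simpa using this.symm

/-- For every `μ > 1` some positive density of backward arcs costs at most a factor `μ ^ n`
compared with acyclic digraphs. -/
lemma exists_card_few_backwards_le (l : ℕ) {μ : ℝ} (hμ : 1 < μ) : ∃ q : ℕ, 0 < q ∧ ∀ n,
    (#{G : ArcSet n | IsOriented G ∧ CkFree (l + 3) G ∧ q * bMin G ≤ n} : ℝ)
      ≤ #(dags n) * μ ^ (2 * n) := by
  obtain ⟨a, K, ha, hK, hmom⟩ := exp_moment_miss l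
  obtain ⟨p, hp⟩ := pow_unbounded_of_one_lt (2 * K) hμ
  have hp' : 2 * K ≤ μ ^ (p + 1) := hp.le.trans (pow_le_pow_right₀ hμ.le (Nat.le_succ p))
  obtain ⟨b, hb, hba⟩ := exists_one_lt_pow_eq ha (Nat.succ_ne_zero p)
  have ht : 0 < b - 1 := by linarith
  obtain ⟨q, hq⟩ := pow_unbounded_of_one_lt (1 / (b - 1)) hμ
  refine ⟨q + 1, Nat.succ_pos q, fun n => ?_⟩
  have hq' : 1 / (b - 1) ≤ μ ^ (q + 1) := hq.le.trans (pow_le_pow_right₀ hμ.le (Nat.le_succ q))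
  set m : ArcSet n → ℕ := fun D => miss n (l + 1) (place (topo D) D) with hm
  set d : ℝ := (#(dags n) : ℝ) with hd
  have hd0 : 0 < d := by
    have : (∅ : ArcSet n) ∈ dags n := mem_filter.2 ⟨mem_univ _, 1, fun e he => by simp at he⟩
    exact Nat.cast_pos.2 (card_pos.2 ⟨_, this⟩)
  have h1 : ∑ D ∈ dags n, a ^ m D ≤ d * (μ ^ n) ^ (p + 1) := by
    calc ∑ D ∈ dags n, a ^ m D
        ≤ n.factorial * ∑ H ∈ (forwardPairs n).powerset, a ^ miss n (l + 1) H :=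
          sum_dags_le n (fun H => a ^ miss n (l + 1) H) fun H => by positivity
      _ ≤ n.factorial * (K ^ n * 2 ^ #(forwardPairs n)) :=
          mul_le_mul_of_nonneg_left (hmom n) (by positivity)
      _ = K ^ n * ((n.factorial * 2 ^ #(forwardPairs n) : ℕ) : ℝ) := by push_cast; ring
      _ ≤ K ^ n * ((2 ^ n * #(dags n) : ℕ) : ℝ) := by
          exact mul_le_mul_of_nonneg_left (Nat.cast_le.2 (factorial_mul_le_card_dags n))
            (by positivity)
      _ = d * (2 * K) ^ n := by push_cast; rw [mul_pow]; ring
      _ ≤ d * (μ ^ (p + 1)) ^ n := by gcongr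
      _ = _ := by rw [← pow_mul, ← pow_mul, mul_comm n]
  have h2 : ∑ D ∈ dags n, b ^ m D ≤ d * μ ^ n := by
    have hpm := pow_sum_div_card_le_sum_pow (s := dags n) (f := fun D => b ^ m D) (n := p)
      (fun D _ => by positivity)
    have e : ∀ D, (b ^ m D) ^ (p + 1) = a ^ m D := by
      intro D
      rw [← pow_mul, mul_comm, pow_mul, hba]
    simp only [e] at hpm
    rw [div_le_iff₀ (by positivity)] at hpm
    refine le_of_pow_le_pow_left₀ (Nat.succ_ne_zero p) (by positivity) (hpm.trans ?_)
    calc _ ≤ d * (μ ^ n) ^ (p + 1) * d ^ p := by gcongr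
      _ = _ := by rw [mul_pow, pow_succ d, Nat.succ_eq_add_one]; ring
  calc (#{G : ArcSet n | IsOriented G ∧ CkFree (l + 3) G ∧ (q + 1) * bMin G ≤ n} : ℝ)
      ≤ ((∑ D ∈ dags n, #{B ∈ (addable (l + 1) D).powerset | (q + 1) * #B ≤ n} : ℕ) : ℝ) :=
        Nat.cast_le.2 (card_few_backwards_le (l + 1) (q + 1) n)
    _ = ∑ D ∈ dags n, (#{B ∈ (addable (l + 1) D).powerset | (q + 1) * #B ≤ n} : ℝ) := by
        push_cast
        rfl
    _ ≤ ∑ D ∈ dags n, μ ^ n * b ^ m D := by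
        refine sum_le_sum fun D _ => (card_small_subsets_le _ ht hμ.le hq').trans ?_
        rw [add_sub_cancel]
        gcongr
        · exact hb.le
        · exact card_addable_le (l + 1) D
    _ ≤ μ ^ n * (d * μ ^ n) := by
        rw [← mul_sum]
        exact mul_le_mul_of_nonneg_left h2 (by positivity)
    _ = _ := by ring

section Twist

variable {n : ℕ}

/-- `u` and `v` have positions in a common block of length `r`, whose index lies in `S`. -/
def SameBlock (r : ℕ) (τ : Equiv.Perm (Fin n)) (S : Finset ℕ) (u v : Fin n) : Prop :=
  (τ u : ℕ) / r = (τ v : ℕ) / r ∧ (τ u : ℕ) / r ∈ S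

/-- Replace the subgraph of `D` induced on each block with index in `S` by a directed cycle. -/
noncomputable def twist (r : ℕ) (D : ArcSet n) (S : Finset ℕ) : ArcSet n :=
  univ.filter fun e =>
    (SameBlock r (topo D) S e.1 e.2 ∧ (topo D e.2 : ℕ) % r = ((topo D e.1 : ℕ) % r + 1) % r) ∨
    (¬ SameBlock r (topo D) S e.1 e.2 ∧ e ∈ D)

lemma mem_twist {r : ℕ} {D : ArcSet n} {S : Finset ℕ} {u v : Fin n} : (u, v) ∈ twist r D S ↔
    (SameBlock r (topo D) S u v ∧ (topo D v : ℕ) % r = ((topo D u : ℕ) % r + 1) % r) ∨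
    (¬ SameBlock r (topo D) S u v ∧ (u, v) ∈ D) := by
  simp [twist]

/-- The position of a vertex, rounded down to the start of its block if its index lies in `S`. -/
noncomputable def blockStart (r : ℕ) (S : Finset ℕ) (p : ℕ) : ℕ :=
  if p / r ∈ S then p / r * r else p

lemma blockStart_lt {r : ℕ} (hr : 0 < r) {S : Finset ℕ} {p q : ℕ} (hpq : p < q)
    (h : ¬ (p / r = q / r ∧ p / r ∈ S)) : blockStart r S p < blockStart r S q := by
  have hdiv : p / r ≤ q / r := Nat.div_le_div_right hpq.le
  have hp := Nat.div_mul_le_self p r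
  have hp' := Nat.lt_div_mul_add hr (a := p)
  unfold blockStart
  by_cases h1 : p / r ∈ S
  · have hlt : p / r < q / r := lt_of_le_of_ne hdiv fun h' => h ⟨h', h1⟩
    have h2 : (p / r + 1) * r ≤ q / r * r := Nat.mul_le_mul_right r hlt
    have hq := Nat.div_mul_le_self q r
    rw [add_mul, one_mul] at h2
    split_ifs <;> omega
  · by_cases h2 : q / r ∈ S
    · have hlt : p / r < q / r := lt_of_le_of_ne hdiv fun h' => h1 (h' ▸ h2)
      have h3 : (p / r + 1) * r ≤ q / r * r := Nat.mul_le_mul_right r hlt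
      rw [add_mul, one_mul] at h3
      rw [if_neg h1, if_pos h2]
      omega
    · rw [if_neg h1, if_neg h2]
      exact hpq

/-- A transitive relation containing all arcs of `twist r D S`, whose symmetric part is
`SameBlock`. -/
def Precedes (r : ℕ) (τ : Equiv.Perm (Fin n)) (S : Finset ℕ) (u v : Fin n) : Prop :=
  blockStart r S (τ u) < blockStart r S (τ v) ∨ SameBlock r τ S u v

lemma SameBlock.blockStart_eq {r : ℕ} {τ : Equiv.Perm (Fin n)} {S : Finset ℕ} {u v : Fin n}
    (h : SameBlock r τ S u v) : blockStart r S (τ u) = blockStart r S (τ v) := by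
  have h2 := h.2
  have h1 := h.1
  unfold blockStart
  rw [← h1, if_pos h2, if_pos h2]

lemma Precedes.trans {r : ℕ} {τ : Equiv.Perm (Fin n)} {S : Finset ℕ} {u v w : Fin n}
    (h1 : Precedes r τ S u v) (h2 : Precedes r τ S v w) : Precedes r τ S u w := by
  rcases h1 with h1 | h1 <;> rcases h2 with h2 | h2
  · exact Or.inl (h1.trans h2)
  · exact Or.inl (h2.blockStart_eq ▸ h1)
  · exact Or.inl (h1.blockStart_eq ▸ h2)
  · exact Or.inr ⟨h1.1.trans h2.1, h1.2⟩

lemma Precedes.sameBlock {r : ℕ} {τ : Equiv.Perm (Fin n)} {S : Finset ℕ} {u v : Fin n}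
    (h1 : Precedes r τ S u v) (h2 : Precedes r τ S v u) : SameBlock r τ S u v := by
  rcases h1 with h1 | h1
  · rcases h2 with h2 | h2
    · exact absurd h1 h2.asymm
    · exact absurd h2.blockStart_eq h1.ne'
  · exact h1

lemma precedes_of_mem_twist {r : ℕ} (hr : 0 < r) {D : ArcSet n} (hD : D ∈ dags n)
    {S : Finset ℕ} {u v : Fin n} (h : (u, v) ∈ twist r D S) : Precedes r (topo D) S u v := by
  rcases mem_twist.1 h with h | h
  · exact Or.inr h.1
  · exact Or.inl (blockStart_lt hr (respects_topo hD _ h.2) h.1)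

lemma isOriented_twist {r : ℕ} (hr : 3 ≤ r) {D : ArcSet n} (hD : D ∈ dags n)
    (S : Finset ℕ) : IsOriented (twist r D S) := by
  have hr0 : 0 < r := by omega
  have hanti : ∀ u v : Fin n, (u, v) ∈ twist r D S → (v, u) ∉ twist r D S := by
    intro u v h1 h2
    have hs := (precedes_of_mem_twist hr0 hD h1).sameBlock (precedes_of_mem_twist hr0 hD h2)
    have hs' := (precedes_of_mem_twist hr0 hD h2).sameBlock (precedes_of_mem_twist hr0 hD h1)
    have e1 := ((mem_twist.1 h1).resolve_right fun h => h.1 hs).2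
    have e2 := ((mem_twist.1 h2).resolve_right fun h => h.1 hs').2
    have hu := Nat.mod_lt (topo D u : ℕ) hr0
    rw [e1] at e2
    generalize (topo D u : ℕ) % r = x at hu e2
    rcases Nat.lt_or_ge (x + 1) r with h | h
    · rw [Nat.mod_eq_of_lt h] at e2
      rcases Nat.lt_or_ge (x + 1 + 1) r with h' | h'
      · rw [Nat.mod_eq_of_lt h'] at e2
        omega
      · rw [show x + 1 + 1 = r by omega, Nat.mod_self] at e2
        omega
    · rw [show x + 1 = r by omega, Nat.mod_self, Nat.mod_eq_of_lt (by omega)] at e2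
      omega
  exact ⟨fun v h => hanti v v h h, hanti⟩

lemma ckFree_twist {k r : ℕ} (hk : 0 < k) (hkr : k < r) {D : ArcSet n} (hD : D ∈ dags n)
    (S : Finset ℕ) : CkFree k (twist r D S) := by
  rintro ⟨f, _, hf⟩
  have hr : 0 < r := by omega
  set g : ℕ → Fin n := fun t => f (t : ZMod k) with hg
  have harc : ∀ t, (g t, g (t + 1)) ∈ twist r D S := by
    intro t
    simp only [hg]
    push_cast
    exact hf _
  have hper : ∀ t, g (t + k) = g t := by
    intro t
    simp [hg]
  have hprec : ∀ s t, Precedes r (topo D) S (g s) (g (s + t + 1)) := by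
    intro s t
    induction t with
    | zero => exact precedes_of_mem_twist hr hD (harc s)
    | succ t ih => exact ih.trans (precedes_of_mem_twist hr hD (harc (s + t + 1)))
  have hback : ∀ t, Precedes r (topo D) S (g (t + 1)) (g t) := by
    intro t
    rcases Nat.lt_or_ge 1 k with h | h
    · have := hprec (t + 1) (k - 2)
      rwa [show t + 1 + (k - 2) + 1 = t + k by omega, hper] at this
    · obtain rfl : k = 1 := by omega
      have := hprec t 0
      rw [add_zero, hper] at this
      rwa [hper]
  have hmod : ∀ t, (topo D (g (t + 1)) : ℕ) % r = ((topo D (g t) : ℕ) % r + 1) % r := fun t =>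
    ((mem_twist.1 (harc t)).resolve_right fun h => h.1 ((hprec t 0).sameBlock (hback t))).2
  have hmod' : ∀ t, (topo D (g t) : ℕ) % r = ((topo D (g 0) : ℕ) + t) % r := by
    intro t
    induction t with
    | zero => simp
    | succ t ih => rw [hmod, ih, Nat.mod_add_mod, add_assoc]
  have h1 := hmod' k
  have h2 := hper 0
  rw [zero_add] at h2
  rw [h2] at h1
  have h3 : (topo D (g 0) : ℕ) + 0 ≡ (topo D (g 0) : ℕ) + k [MOD r] := h1
  have h4 := Nat.ModEq.add_left_cancel' _ h3
  have h5 : 0 % r = k % r := h4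
  rw [Nat.zero_mod, Nat.mod_eq_of_lt hkr] at h5
  omega

/-- The pairs of vertices reachable from each other by directed walks. -/
noncomputable def mutuallyReachable (G : ArcSet n) : ArcSet n :=
  univ.filter fun e => Relation.TransGen (fun u v => (u, v) ∈ G) e.1 e.2 ∧
    Relation.TransGen (fun u v => (u, v) ∈ G) e.2 e.1

lemma transGen_twist_of_sameBlock {r N : ℕ} (hr : 0 < r) (hN : N * r ≤ n) {D : ArcSet n}
    {S : Finset ℕ} (hS : S ⊆ range N) {u v : Fin n} (h : SameBlock r (topo D) S u v) :
    Relation.TransGen (fun u v => (u, v) ∈ twist r D S) u v := by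
  set τ := topo D with hτ
  set b := (τ u : ℕ) / r with hb
  have hbN : b < N := mem_range.1 (hS h.2)
  have hpos : ∀ y, y < r → b * r + y < n := by
    intro y hy
    have : (b + 1) * r ≤ N * r := Nat.mul_le_mul_right r hbN
    rw [add_mul, one_mul] at this
    omega
  have hdm : ∀ y, y < r → (b * r + y) / r = b ∧ (b * r + y) % r = y := by
    intro y hy
    rw [mul_comm, Nat.mul_add_div hr, Nat.mul_add_mod, Nat.div_eq_of_lt hy, Nat.mod_eq_of_lt hy]
    exact ⟨rfl, rfl⟩
  have key : ∀ t, ∀ w : Fin n, (τ w : ℕ) / r = b → (τ w : ℕ) % r = ((τ u : ℕ) + t + 1) % r →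
      Relation.TransGen (fun u v => (u, v) ∈ twist r D S) u w := by
    intro t
    induction t with
    | zero =>
      intro w h1 h2
      refine Relation.TransGen.single (mem_twist.2 (Or.inl ⟨⟨h1.symm, h.2⟩, ?_⟩))
      rw [Nat.mod_add_mod]
      exact h2
    | succ t ih =>
      intro w h1 h2
      have hy := Nat.mod_lt ((τ u : ℕ) + t + 1) hr
      let x : Fin n := τ.symm ⟨b * r + ((τ u : ℕ) + t + 1) % r, hpos _ hy⟩
      have hx : (τ x : ℕ) = b * r + ((τ u : ℕ) + t + 1) % r := by simp [x]
      have hx1 : (τ x : ℕ) / r = b := by rw [hx]; exact (hdm _ hy).1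
      have hx2 : (τ x : ℕ) % r = ((τ u : ℕ) + t + 1) % r := by rw [hx]; exact (hdm _ hy).2
      refine (ih x hx1 hx2).tail (mem_twist.2 (Or.inl ⟨⟨hx1.trans h1.symm, ?_⟩, ?_⟩))
      · rw [← hτ, hx1]
        exact h.2
      · rw [← hτ, hx2, h2, Nat.mod_add_mod]
        rfl
  have hu := Nat.mod_lt (τ u : ℕ) hr
  have hu' := Nat.div_add_mod (τ u : ℕ) r
  refine key ((τ v : ℕ) % r + r - (τ u : ℕ) % r - 1) v h.1.symm ?_
  have e : (τ u : ℕ) + ((τ v : ℕ) % r + r - (τ u : ℕ) % r - 1) + 1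
      = r * ((τ u : ℕ) / r + 1) + (τ v : ℕ) % r := by
    rw [mul_add, mul_one]
    omega
  rw [e, Nat.mul_add_mod, Nat.mod_mod]

lemma mem_mutuallyReachable_twist {r N : ℕ} (hr : 0 < r) (hN : N * r ≤ n) {D : ArcSet n}
    (hD : D ∈ dags n) {S : Finset ℕ} (hS : S ⊆ range N) {u v : Fin n} :
    (u, v) ∈ mutuallyReachable (twist r D S) ↔ SameBlock r (topo D) S u v := by
  have hgen : ∀ x y, Relation.TransGen (fun u v => (u, v) ∈ twist r D S) x y →
      Precedes r (topo D) S x y := by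
    intro x y h
    induction h with
    | single h => exact precedes_of_mem_twist hr hD h
    | tail _ h ih => exact ih.trans (precedes_of_mem_twist hr hD h)
  simp only [mutuallyReachable, mem_filter, mem_univ, true_and]
  constructor
  · rintro ⟨h1, h2⟩
    exact (hgen _ _ h1).sameBlock (hgen _ _ h2)
  · intro h
    exact ⟨transGen_twist_of_sameBlock hr hN hS h,
      transGen_twist_of_sameBlock hr hN hS ⟨h.1.symm, h.1 ▸ h.2⟩⟩

lemma card_mutuallyReachable_twist_le {r N : ℕ} (hr : 0 < r) (hN : N * r ≤ n) {D : ArcSet n}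
    (hD : D ∈ dags n) {S : Finset ℕ} (hS : S ⊆ range N) :
    #(mutuallyReachable (twist r D S)) ≤ #S * r ^ 2 := by
  have : #(S ×ˢ range r ×ˢ range r) = #S * r ^ 2 := by
    simp [card_product, sq]
  rw [← this]
  refine card_le_card_of_injOn
    (fun e => ((topo D e.1 : ℕ) / r, (topo D e.1 : ℕ) % r, (topo D e.2 : ℕ) % r)) ?_ ?_
  · rintro ⟨u, v⟩ h
    have h := (mem_mutuallyReachable_twist hr hN hD hS).1 (mem_coe.1 h)
    simp only [coe_product, Set.mem_prod, mem_coe, mem_range]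
    exact ⟨h.2, Nat.mod_lt _ hr, Nat.mod_lt _ hr⟩
  · rintro ⟨u, v⟩ h ⟨u', v'⟩ h' he
    have h := (mem_mutuallyReachable_twist hr hN hD hS).1 (mem_coe.1 h)
    have h' := (mem_mutuallyReachable_twist hr hN hD hS).1 (mem_coe.1 h')
    simp only [Prod.mk.injEq] at he
    obtain ⟨e1, e2, e3⟩ := he
    have hu : (topo D u : ℕ) = topo D u' := by
      rw [← Nat.div_add_mod (topo D u : ℕ) r, e1, e2, Nat.div_add_mod]
    have hv : (topo D v : ℕ) = topo D v' := by
      rw [← Nat.div_add_mod (topo D v : ℕ) r, ← h.1, e1, h'.1, e3, Nat.div_add_mod]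
    rw [(topo D).injective (Fin.ext hu), (topo D).injective (Fin.ext hv)]

/-- Given `twist r D S`, the pair `(D, S)` is determined by the arcs of `D` lying inside the
strongly connected components of `twist r D S`. -/
lemma card_dags_mul_le {k N s : ℕ} (hk : 2 ≤ k) (hN : N * (k + 1) ≤ n)
    (𝒮 : Finset (Finset ℕ)) (h𝒮 : ∀ S ∈ 𝒮, S ⊆ range N ∧ #S = s) :
    #(dags n) * #𝒮 ≤ 2 ^ (s * (k + 1) ^ 2) * fnk n k := by
  have hr : 0 < k + 1 := by omega
  rw [← card_product]
  refine (card_le_mul_card_image (f := fun x => twist (k + 1) x.1 x.2) _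
    (2 ^ (s * (k + 1) ^ 2)) ?_).trans (Nat.mul_le_mul_left _ (card_le_card ?_))
  · intro G hG
    obtain ⟨⟨D₀, S₀⟩, h₀, rfl⟩ := mem_image.1 hG
    rw [mem_product] at h₀
    have hD₀ : D₀ ∈ dags n := h₀.1
    obtain ⟨hS₀, hc₀⟩ := h𝒮 S₀ h₀.2
    set G := twist (k + 1) D₀ S₀ with hG'
    have hle : #(mutuallyReachable G).powerset ≤ 2 ^ (s * (k + 1) ^ 2) := by
      rw [card_powerset, ← hc₀]
      exact Nat.pow_le_pow_right two_pos (card_mutuallyReachable_twist_le hr hN hD₀ hS₀)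
    refine le_trans (card_le_card_of_injOn (fun x => x.1 ∩ mutuallyReachable G) ?_ ?_) hle
    · intro x _
      simp
    · rintro ⟨D, S⟩ hx ⟨D', S'⟩ hx' he
      simp only [coe_filter, mem_product, Set.mem_ofPred_eq] at hx hx' he
      obtain ⟨⟨hD, hS⟩, hx⟩ := hx
      obtain ⟨⟨hD', hS'⟩, hx'⟩ := hx'
      have m1 : ∀ u v, (u, v) ∈ mutuallyReachable G ↔ SameBlock (k + 1) (topo D) S u v := by
        intro u v
        rw [← hx]
        exact mem_mutuallyReachable_twist hr hN hD (h𝒮 S hS).1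
      have m2 : ∀ u v, (u, v) ∈ mutuallyReachable G ↔ SameBlock (k + 1) (topo D') S' u v := by
        intro u v
        rw [← hx']
        exact mem_mutuallyReachable_twist hr hN hD' (h𝒮 S' hS').1
      have hDD : D = D' := by
        ext ⟨u, v⟩
        by_cases h : (u, v) ∈ mutuallyReachable G
        · have := congrArg ((u, v) ∈ ·) he
          simpa [h] using this
        · have g1 : (u, v) ∈ G ↔ (u, v) ∈ D := by
            rw [← hx, mem_twist]
            simp [(m1 u v).not.1 h]
          have g2 : (u, v) ∈ G ↔ (u, v) ∈ D' := by
            rw [← hx', mem_twist]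
            simp [(m2 u v).not.1 h]
          exact g1.symm.trans g2
      subst hDD
      have hblock : ∀ b < N, ∃ u : Fin n, ∀ T : Finset ℕ,
          SameBlock (k + 1) (topo D) T u u ↔ b ∈ T := by
        intro b hb
        have hlt : b * (k + 1) < n := by
          have : (b + 1) * (k + 1) ≤ N * (k + 1) := Nat.mul_le_mul_right _ hb
          rw [add_mul] at this
          omega
        refine ⟨(topo D).symm ⟨b * (k + 1), hlt⟩, fun T => ?_⟩
        simp [SameBlock, Nat.mul_div_cancel b hr]
      have hSS : S = S' := by
        ext b
        by_cases hb : b < N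
        · obtain ⟨u, hu⟩ := hblock b hb
          rw [← hu S, ← hu S', ← m1, ← m2]
        · exact iff_of_false (fun h => hb (mem_range.1 ((h𝒮 S hS).1 h)))
            fun h => hb (mem_range.1 ((h𝒮 S' hS').1 h))
      rw [hSS]
  · intro G hG
    obtain ⟨⟨D, S⟩, hx, rfl⟩ := mem_image.1 hG
    have hD := (mem_product.1 hx).1
    exact mem_filter.2 ⟨mem_univ _, isOriented_twist (by omega) hD S,
      ckFree_twist (by omega) (by omega) hD S⟩

end Twist

lemma pow_le_choose_mul {M : ℕ} (hM : 0 < M) (s : ℕ) : M ^ s ≤ (s * M).choose s := by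
  induction s with
  | zero => simp
  | succ s ih =>
    obtain ⟨t, ht⟩ : ∃ t, (s + 1) * M = t + 1 := ⟨(s + 1) * M - 1, by
      have : 0 < (s + 1) * M := by positivity
      omega⟩
    have hst : s * M ≤ t := by
      rw [add_mul, one_mul] at ht
      omega
    have h := Nat.add_one_mul_choose_eq t s
    rw [← ht] at h
    have h2 : M * (t.choose s) = ((s + 1) * M).choose (s + 1) :=
      Nat.eq_of_mul_eq_mul_left (Nat.succ_pos s) (by rw [← mul_assoc, h, mul_comm])
    rw [← h2, pow_succ, mul_comm]
    exact Nat.mul_le_mul_left _ (ih.trans (Nat.choose_le_choose s hst))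

lemma exists_two_pow_mul_card_dags_le {k : ℕ} (hk : 2 ≤ k) :
    ∃ Q : ℕ, 0 < Q ∧ ∀ n, 2 ^ (n / Q) * #(dags n) ≤ fnk n k := by
  set M := 2 ^ ((k + 1) ^ 2 + 1) with hM
  have hM0 : 0 < M := by positivity
  refine ⟨(k + 1) * M, by positivity, fun n => ?_⟩
  set s := n / ((k + 1) * M) with hs
  have hN : s * M * (k + 1) ≤ n := by
    rw [mul_assoc, mul_comm M]
    exact Nat.div_mul_le_self _ _
  have h := card_dags_mul_le hk hN (powersetCard s (range (s * M)))
    fun S hS => mem_powersetCard.1 hS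
  rw [card_powersetCard, card_range] at h
  have h2 := (Nat.mul_le_mul_left #(dags n) (pow_le_choose_mul hM0 s)).trans h
  have h3 : M ^ s = 2 ^ (s * (k + 1) ^ 2) * 2 ^ s := by
    rw [hM, ← pow_mul, ← pow_add]
    ring_nf
  rw [h3, mul_left_comm] at h2
  rw [mul_comm (2 ^ s)]
  exact Nat.le_of_mul_le_mul_left h2 (by positivity)

lemma card_dags_pos (n : ℕ) : 0 < #(dags n) :=
  card_pos.2 ⟨∅, mem_filter.2 ⟨mem_univ _, 1, by simp [Respects]⟩⟩

/-- For `k ≥ 3` there is `c₀ > 0` such that the number of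
`C_k`-free oriented graphs on `[n]` with `b(G) < c₀ n` is `o(f(n,C_k))`. -/
theorem few_graphs_with_few_backwards (k : ℕ) (hk : 3 ≤ k) :
    ∃ c₀ : ℝ, 0 < c₀ ∧
      Filter.Tendsto
        (fun n : ℕ =>
          (((Finset.univ.filter fun E : ArcSet n =>
              IsOriented E ∧ CkFree k E ∧ (bMin E : ℝ) < c₀ * n).card : ℝ) /
            (fnk n k : ℝ)))
        Filter.atTop (nhds 0) := by
  obtain ⟨l, rfl⟩ : ∃ l, k = l + 3 := ⟨k - 3, by omega⟩
  obtain ⟨Q, hQ, hlow⟩ := exists_two_pow_mul_card_dags_le (k := l + 3) (by omega)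
  obtain ⟨μ, hμ, hμQ⟩ := exists_one_lt_pow_eq (a := 3 / 2) (by norm_num)
    (p := 2 * Q) (by omega)
  obtain ⟨q, hq, hup⟩ := exists_card_few_backwards_le l hμ
  refine ⟨1 / q, by positivity, ?_⟩
  have hlim : Filter.Tendsto (fun n : ℕ => (3 / 2 : ℝ) * (3 / 4) ^ (n / Q))
      Filter.atTop (nhds 0) := by
    have h := (tendsto_pow_atTop_nhds_zero_of_lt_one (r := (3 / 4 : ℝ)) (by norm_num)
      (by norm_num)).comp (Nat.tendsto_div_const_atTop hQ.ne')
    simpa using h.const_mul (3 / 2 : ℝ)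
  refine squeeze_zero (fun n => by positivity) (fun n => ?_) hlim
  have hd : (0 : ℝ) < #(dags n) := by exact_mod_cast card_dags_pos n
  have h1 : ((univ.filter fun E : ArcSet n =>
      IsOriented E ∧ CkFree (l + 3) E ∧ (bMin E : ℝ) < 1 / q * n).card : ℝ)
        ≤ #(dags n) * μ ^ (2 * n) := by
    refine le_trans ?_ (hup n)
    norm_cast
    refine card_le_card fun E hE => ?_
    obtain ⟨-, h1, h2, h3⟩ := mem_filter.1 hE
    refine mem_filter.2 ⟨mem_univ _, h1, h2, ?_⟩
    have hq' : (0 : ℝ) < q := by exact_mod_cast hq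
    rw [one_div, inv_mul_eq_div, lt_div_iff₀ hq', mul_comm] at h3
    exact_mod_cast h3.le
  have h2 : μ ^ (2 * n) ≤ (3 / 2 : ℝ) ^ (n / Q + 1) := by
    rw [← hμQ, ← pow_mul]
    refine pow_le_pow_right₀ hμ.le ?_
    have := Nat.lt_mul_div_succ n hQ
    rw [mul_assoc]
    omega
  have h3 : (2 : ℝ) ^ (n / Q) * #(dags n) ≤ fnk n (l + 3) := by exact_mod_cast hlow n
  have h4 : (0 : ℝ) < fnk n (l + 3) := lt_of_lt_of_le (by positivity) h3
  rw [div_le_iff₀ h4]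
  calc _ ≤ #(dags n) * μ ^ (2 * n) := h1
    _ ≤ #(dags n) * (3 / 2 : ℝ) ^ (n / Q + 1) := by gcongr
    _ = 3 / 2 * (3 / 4) ^ (n / Q) * (2 ^ (n / Q) * #(dags n)) := by
      rw [show (3 / 2 : ℝ) ^ (n / Q + 1) = 3 / 2 * ((3 / 4) ^ (n / Q) * 2 ^ (n / Q)) by
        rw [← mul_pow, pow_succ]; norm_num [mul_comm]]
      ring
    _ ≤ _ := by gcongr
end

section
/- Fix an integer k ≥ 3. For every γ > 0, the number of labelled C_k-free oriented graphs G on [n] with b(G) ≥ γ·n² is o(f(n,C_k)) as n → ∞. -/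
open scoped Classical

/-- All entries of the matrix are `0` or `1`. -/
def IsZeroOne {V : Type*} (A : Matrix V V ℝ) : Prop := ∀ x y, A x y = 0 ∨ A x y = 1

theorem IsZeroOne.nonneg {V : Type*} {A : Matrix V V ℝ} (hA : IsZeroOne A) (x y : V) :
    0 ≤ A x y := by
  rcases hA x y with h | h <;> rw [h]
  exact zero_le_one

theorem IsZeroOne.le_one {V : Type*} {A : Matrix V V ℝ} (hA : IsZeroOne A) (x y : V) :
    A x y ≤ 1 := by
  rcases hA x y with h | h <;> rw [h]
  exact zero_le_one

theorem matrix_mul_nonneg {V : Type*} [Fintype V] {A B : Matrix V V ℝ}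
    (hA : ∀ x y, 0 ≤ A x y) (hB : ∀ x y, 0 ≤ B x y) (x y : V) : 0 ≤ (A * B) x y := by
  rw [Matrix.mul_apply]
  exact Finset.sum_nonneg fun z _ => mul_nonneg (hA x z) (hB z y)

theorem matrix_pow_nonneg {V : Type*} [Fintype V] [DecidableEq V] {A : Matrix V V ℝ}
    (hA : ∀ x y, 0 ≤ A x y) (i : ℕ) (x y : V) : 0 ≤ (A ^ i) x y := by
  induction i generalizing x y with
  | zero =>
    rw [pow_zero, Matrix.one_apply]
    split_ifs <;> norm_num
  | succ i ih =>
    rw [pow_succ]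
    exact matrix_mul_nonneg ih hA x y

theorem sum_mul_pow_le {V : Type*} [Fintype V] [DecidableEq V] {X A : Matrix V V ℝ}
    (hX : ∀ x y, 0 ≤ X x y) (hA : IsZeroOne A) (i : ℕ) :
    ∑ x, ∑ y, (X * A ^ i) x y ≤ (∑ x, ∑ y, X x y) * (Fintype.card V : ℝ) ^ i := by
  induction i with
  | zero => simp
  | succ i ih =>
    have h0 : ∀ x y, 0 ≤ (X * A ^ i) x y :=
      matrix_mul_nonneg hX (matrix_pow_nonneg hA.nonneg i)
    rw [pow_succ, pow_succ, ← mul_assoc, ← mul_assoc]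
    calc ∑ x, ∑ y, (X * A ^ i * A) x y
        = ∑ x, ∑ z, (X * A ^ i) x z * ∑ y, A z y := by
          refine Finset.sum_congr rfl fun x _ => ?_
          simp_rw [Matrix.mul_apply (M := X * A ^ i), Finset.mul_sum]
          exact Finset.sum_comm
      _ ≤ ∑ x, ∑ z, (X * A ^ i) x z * (Fintype.card V : ℝ) := by
          refine Finset.sum_le_sum fun x _ => Finset.sum_le_sum fun z _ =>
            mul_le_mul_of_nonneg_left ?_ (h0 x z)
          calc ∑ y, A z y ≤ ∑ _y : V, (1 : ℝ) := Finset.sum_le_sum fun y _ => hA.le_one z y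
            _ = _ := by simp
      _ = (∑ x, ∑ z, (X * A ^ i) x z) * (Fintype.card V : ℝ) := by
          simp_rw [Finset.sum_mul]
      _ ≤ _ := mul_le_mul_of_nonneg_right ih (Nat.cast_nonneg _)

theorem sum_pow_mul_pow_le {V : Type*} [Fintype V] [DecidableEq V] {A B : Matrix V V ℝ}
    (hA : IsZeroOne A) (hB : IsZeroOne B) (i j : ℕ) :
    ∑ x, ∑ y, (B ^ i * A ^ j) x y ≤ (Fintype.card V : ℝ) ^ (i + j + 1) := by
  have h1 := sum_mul_pow_le (X := B ^ i) (matrix_pow_nonneg hB.nonneg i) hA j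
  have h2 := sum_mul_pow_le (X := (1 : Matrix V V ℝ)) (A := B)
    (fun x y => by rw [Matrix.one_apply]; split_ifs <;> norm_num) hB i
  have h3 : ∑ x, ∑ y, (1 : Matrix V V ℝ) x y = (Fintype.card V : ℝ) := by
    simp [Matrix.one_apply]
  rw [h3, one_mul] at h2
  calc _ ≤ _ := h1
    _ ≤ ((Fintype.card V : ℝ) * (Fintype.card V : ℝ) ^ i) * (Fintype.card V : ℝ) ^ j := by gcongr
    _ = _ := by ring

/-- Replacing the factors of `B ^ k` by `A` one at a time inside the trace. -/
theorem trace_pow_telescope {V : Type*} [Fintype V] [DecidableEq V] {A B : Matrix V V ℝ}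
    {δ c : ℝ} (hδ : 0 ≤ δ) (hδ1 : δ ≤ 1) (hc : 0 ≤ c) (k : ℕ)
    (h : ∀ i j, i + j + 1 = k →
      δ * (B * (B ^ i * A ^ j)).trace - c ≤ (A * (B ^ i * A ^ j)).trace) :
    δ ^ k * (B ^ k).trace - k * c ≤ (A ^ k).trace := by
  have key : ∀ j i, i + j = k → δ ^ j * (B ^ k).trace - j * c ≤ (B ^ i * A ^ j).trace := by
    intro j
    induction j with
    | zero => intro i hi; simp at hi; simp [hi]
    | succ j ih =>
      intro i hi
      have h1 := ih (i + 1) (by omega)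
      have h2 := h i j (by omega)
      have e1 : (B ^ (i + 1) * A ^ j).trace = (B * (B ^ i * A ^ j)).trace := by
        rw [pow_succ', mul_assoc]
      have e2 : (B ^ i * A ^ (j + 1)).trace = (A * (B ^ i * A ^ j)).trace := by
        rw [Matrix.trace_mul_comm A, pow_succ, mul_assoc]
      rw [e2]
      rw [e1] at h1
      have h3 := mul_le_mul_of_nonneg_left h1 hδ
      have h4 : δ * (j * c) ≤ 1 * (j * c) := mul_le_mul_of_nonneg_right hδ1 (by positivity)
      push_cast
      rw [pow_succ]
      linarith
  simpa using key k 0 (by simp)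

theorem trace_mul_eq_sum {V : Type*} [Fintype V] (A N : Matrix V V ℝ) :
    (A * N).trace = ∑ x, ∑ y, A x y * N y x := by
  simp [Matrix.trace, Matrix.mul_apply]

theorem trace_mul_triple {V : Type*} [Fintype V] (A P Q R : Matrix V V ℝ) :
    (A * (P * Q * R)).trace = ∑ z, ∑ w, Q z w * ∑ x, ∑ y, R w x * A x y * P y z := by
  have e : (A * (P * Q * R)).trace = (Q * (R * A * P)).trace := by
    rw [mul_assoc P, ← mul_assoc A, Matrix.trace_mul_comm, ← mul_assoc, ← mul_assoc, ← mul_assoc,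
      Matrix.trace_mul_comm (Q * R * A)]
  rw [e, trace_mul_eq_sum]
  refine Finset.sum_congr rfl fun z _ => Finset.sum_congr rfl fun w _ => ?_
  congr 1
  simp_rw [Matrix.mul_apply, Finset.sum_mul]
  exact Finset.sum_comm

theorem sum_rect_eq {V : Type*} [Fintype V] {R P : Matrix V V ℝ} (hR : IsZeroOne R)
    (hP : IsZeroOne P) (A : Matrix V V ℝ) (w z : V) :
    ∑ x, ∑ y, R w x * A x y * P y z =
      ∑ x with R w x = 1, ∑ y with P y z = 1, A x y := by
  rw [Finset.sum_filter]
  refine Finset.sum_congr rfl fun x _ => ?_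
  rw [Finset.sum_filter]
  rcases hR w x with h | h
  · simp [h]
  · rw [if_pos h]
    refine Finset.sum_congr rfl fun y _ => ?_
    rcases hP y z with h' | h' <;> simp [h, h']

theorem trace_pow_le_of_rect {V : Type*} [Fintype V] [DecidableEq V] {A B : Matrix V V ℝ}
    (hA : IsZeroOne A) (hB : IsZeroOne B) {δ e : ℝ} (hδ : 0 ≤ δ) (hδ1 : δ ≤ 1) (he : 0 ≤ e)
    (h : ∀ S T : Finset V,
      δ * (∑ x ∈ S, ∑ y ∈ T, B x y) - e ≤ ∑ x ∈ S, ∑ y ∈ T, A x y)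
    {k : ℕ} (hk : 3 ≤ k) :
    δ ^ k * (B ^ k).trace - k * (e * (Fintype.card V : ℝ) ^ (k - 2)) ≤ (A ^ k).trace := by
  refine trace_pow_telescope hδ hδ1 (by positivity) k fun i j hij => ?_
  obtain ⟨P, R, a, b, hP, hR, hab, hN⟩ : ∃ P R : Matrix V V ℝ, ∃ a b : ℕ,
      IsZeroOne P ∧ IsZeroOne R ∧ a + b + 1 = k - 2 ∧ B ^ i * A ^ j = P * (B ^ a * A ^ b) * R := by
    rcases i with _ | i
    · obtain ⟨b, rfl⟩ : ∃ b, j = b + 2 := ⟨j - 2, by omega⟩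
      refine ⟨A, A, 0, b, hA, hA, by omega, ?_⟩
      rw [pow_zero, one_mul, one_mul, ← pow_succ', ← pow_succ]
    rcases j with _ | j
    · obtain ⟨b, rfl⟩ : ∃ b, i = b + 1 := ⟨i - 1, by omega⟩
      refine ⟨B, B, b, 0, hB, hB, by omega, ?_⟩
      rw [pow_zero, mul_one, mul_one, ← pow_succ', ← pow_succ]
    · refine ⟨B, A, i, j, hB, hA, by omega, ?_⟩
      rw [pow_succ', pow_succ]
      simp only [mul_assoc]
  rw [hN, trace_mul_triple, trace_mul_triple]
  have hQ : ∀ z w, 0 ≤ (B ^ a * A ^ b) z w :=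
    matrix_mul_nonneg (matrix_pow_nonneg hB.nonneg a) (matrix_pow_nonneg hA.nonneg b)
  have hs := sum_pow_mul_pow_le hA hB a b
  rw [hab] at hs
  have h1 : ∑ z, ∑ w, (B ^ a * A ^ b) z w *
      (δ * (∑ x, ∑ y, R w x * B x y * P y z) - e) ≤
      ∑ z, ∑ w, (B ^ a * A ^ b) z w * ∑ x, ∑ y, R w x * A x y * P y z := by
    refine Finset.sum_le_sum fun z _ => Finset.sum_le_sum fun w _ =>
      mul_le_mul_of_nonneg_left ?_ (hQ z w)
    rw [sum_rect_eq hR hP, sum_rect_eq hR hP]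
    exact h _ _
  have h2 : ∑ z, ∑ w, (B ^ a * A ^ b) z w *
      (δ * (∑ x, ∑ y, R w x * B x y * P y z) - e) =
      δ * (∑ z, ∑ w, (B ^ a * A ^ b) z w * (∑ x, ∑ y, R w x * B x y * P y z)) -
      e * ∑ z, ∑ w, (B ^ a * A ^ b) z w := by
    simp_rw [mul_sub, Finset.sum_sub_distrib, Finset.mul_sum (s := (Finset.univ : Finset V))]
    congr 1
    · refine Finset.sum_congr rfl fun z _ => Finset.sum_congr rfl fun w _ => ?_
      refine Finset.sum_congr rfl fun x _ => Finset.sum_congr rfl fun y _ => ?_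
      ring
    · refine Finset.sum_congr rfl fun z _ => Finset.sum_congr rfl fun w _ => ?_
      ring
  have h3 := mul_le_mul_of_nonneg_left hs he
  linarith

theorem trace_pow_le_add {V : Type*} [Fintype V] [DecidableEq V] {A B : Matrix V V ℝ}
    (hA : IsZeroOne A) (hB : IsZeroOne B) {m : ℝ} (hm : ∑ x, ∑ y, max (B x y - A x y) 0 ≤ m)
    {k : ℕ} (hk : 3 ≤ k) :
    (B ^ k).trace ≤ (A ^ k).trace + k * (m * (Fintype.card V : ℝ) ^ (k - 2)) := by
  have hm0 : 0 ≤ m :=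
    le_trans (Finset.sum_nonneg fun x _ => Finset.sum_nonneg fun y _ => le_max_right _ _) hm
  have := trace_pow_le_of_rect hA hB (δ := 1) (e := m) zero_le_one le_rfl hm0 (fun S T => ?_) hk
  · rw [one_pow, one_mul] at this
    linarith
  · rw [one_mul, sub_le_iff_le_add, ← sub_le_iff_le_add', ← Finset.sum_sub_distrib]
    simp_rw [← Finset.sum_sub_distrib]
    calc ∑ x ∈ S, ∑ y ∈ T, (B x y - A x y)
        ≤ ∑ x ∈ S, ∑ y ∈ T, max (B x y - A x y) 0 :=
          Finset.sum_le_sum fun x _ => Finset.sum_le_sum fun y _ => le_max_left _ _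
      _ ≤ ∑ x, ∑ y, max (B x y - A x y) 0 := by
          refine (Finset.sum_le_sum fun x _ => Finset.sum_le_sum_of_subset_of_nonneg
            (Finset.subset_univ T) fun y _ _ => le_max_right _ _).trans ?_
          exact Finset.sum_le_sum_of_subset_of_nonneg
            (Finset.subset_univ S) fun x _ _ => Finset.sum_nonneg fun y _ => le_max_right _ _
      _ ≤ m := hm

/-- The adjacency matrix of a set of arcs. -/
noncomputable def arcMatrix {V : Type*} (D : Finset (V × V)) : Matrix V V ℝ :=
  fun x y => if (x, y) ∈ D then 1 else 0

theorem arcMatrix_isZeroOne {V : Type*} (D : Finset (V × V)) : IsZeroOne (arcMatrix D) := by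
  intro x y
  unfold arcMatrix
  split_ifs <;> simp

theorem sum_path_prod {V : Type*} [Fintype V] [DecidableEq V] (A : Matrix V V ℝ) (m : ℕ)
    (F : V → V → ℝ) :
    ∑ f : Fin (m + 1) → V, (∏ i : Fin m, A (f i.castSucc) (f i.succ)) * F (f 0) (f (Fin.last m)) =
      ∑ x, ∑ y, (A ^ m) x y * F x y := by
  induction m generalizing F with
  | zero =>
    rw [← (Equiv.funUnique (Fin 1) V).symm.sum_comp]
    simp [Matrix.one_apply]
  | succ m ih =>
    rw [← (Fin.consEquiv fun _ => V).sum_comp, Fintype.sum_prod_type]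
    refine Finset.sum_congr rfl fun x _ => ?_
    have := ih (fun y b => A x y * F x b)
    simp only [Fin.consEquiv_apply, Fin.prod_univ_succ, Fin.castSucc_zero, Fin.cons_zero,
      Fin.cons_succ, ← Fin.succ_last, ← Fin.succ_castSucc]
    calc _ = _ := Finset.sum_congr rfl fun g _ => by ring
      _ = _ := this
      _ = _ := by
        rw [Finset.sum_comm]
        refine Finset.sum_congr rfl fun b _ => ?_
        rw [pow_succ', Matrix.mul_apply, Finset.sum_mul]
        refine Finset.sum_congr rfl fun y _ => ?_
        ring

theorem trace_pow_eq_sum_cycle {V : Type*} [Fintype V] [DecidableEq V] (A : Matrix V V ℝ) (m : ℕ) :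
    (A ^ (m + 1)).trace = ∑ f : Fin (m + 1) → V, ∏ i, A (f i) (f (i + 1)) := by
  have h := sum_path_prod A m fun x y => A y x
  rw [pow_succ, trace_mul_eq_sum, ← h]
  refine Finset.sum_congr rfl fun f _ => ?_
  rw [Fin.prod_univ_castSucc]
  simp

theorem card_filter_apply_eq_le {V : Type*} [Fintype V] [DecidableEq V] {m : ℕ}
    {i j : Fin (m + 1)} (hij : i ≠ j) :
    (Finset.univ.filter fun f : Fin (m + 1) → V => f i = f j).card ≤ Fintype.card V ^ m := by
  calc _ ≤ (Finset.univ : Finset (Fin m → V)).card := by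
        refine Finset.card_le_card_of_injOn (fun f l => f (j.succAbove l)) (by simp) ?_
        intro f hf g hg hfg
        simp only [Finset.coe_filter, Finset.mem_univ, true_and, Set.mem_ofPred_eq] at hf hg
        have key : ∀ l, l ≠ j → f l = g l := by
          intro l hl
          obtain ⟨l', rfl⟩ := Fin.exists_succAbove_eq hl
          exact congrFun hfg l'
        funext l
        by_cases hl : l = j
        · rw [hl, ← hf, ← hg, key i hij]
        · exact key l hl
    _ = _ := by simp

theorem card_not_injective_le {V : Type*} [Fintype V] [DecidableEq V] (m : ℕ) :
    (Finset.univ.filter fun f : Fin (m + 1) → V => ¬ Function.Injective f).card ≤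
      (m + 1) ^ 2 * Fintype.card V ^ m := by
  have hsub : (Finset.univ.filter fun f : Fin (m + 1) → V => ¬ Function.Injective f) ⊆
      ((Finset.univ : Finset (Fin (m + 1) × Fin (m + 1))).filter fun p => p.1 ≠ p.2).biUnion
        fun p => Finset.univ.filter fun f : Fin (m + 1) → V => f p.1 = f p.2 := by
    intro f hf
    simp only [Finset.mem_filter, Finset.mem_univ, true_and, Function.Injective, not_forall] at hf
    obtain ⟨i, j, h, hij⟩ := hf
    simp only [Finset.mem_biUnion, Finset.mem_filter, Finset.mem_univ, true_and]
    exact ⟨(i, j), hij, h⟩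
  refine (Finset.card_le_card hsub).trans (Finset.card_biUnion_le.trans ?_)
  calc _ ≤ ∑ _p ∈ ((Finset.univ : Finset (Fin (m + 1) × Fin (m + 1))).filter
          fun p => p.1 ≠ p.2), Fintype.card V ^ m :=
        Finset.sum_le_sum fun p hp => card_filter_apply_eq_le (Finset.mem_filter.1 hp).2
    _ = ((Finset.univ : Finset (Fin (m + 1) × Fin (m + 1))).filter
          fun p => p.1 ≠ p.2).card * Fintype.card V ^ m := by simp
    _ ≤ (m + 1) ^ 2 * Fintype.card V ^ m := by
        refine Nat.mul_le_mul_right _ ((Finset.card_le_univ _).trans ?_)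
        simp [sq]

theorem trace_pow_le_of_ckFree {n k : ℕ} (hk : 1 ≤ k) {E : ArcSet n} (hE : CkFree k E) :
    (arcMatrix E ^ k).trace ≤ (k : ℝ) ^ 2 * (n : ℝ) ^ (k - 1) := by
  obtain ⟨m, rfl⟩ : ∃ m, k = m + 1 := ⟨k - 1, by omega⟩
  rw [trace_pow_eq_sum_cycle]
  have hle : ∀ f : Fin (m + 1) → Fin n, ∏ i, arcMatrix E (f i) (f (i + 1)) ≤
      if ¬ Function.Injective f then 1 else 0 := by
    intro f
    split_ifs with hf
    · obtain ⟨i, hi⟩ : ∃ i, (f i, f (i + 1)) ∉ E := by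
        by_contra! hcon
        exact hE ⟨f, hf, hcon⟩
      exact (Finset.prod_eq_zero (Finset.mem_univ i) (by simp [arcMatrix, hi])).le
    · exact Finset.prod_le_one (fun i _ => (arcMatrix_isZeroOne E).nonneg _ _)
        fun i _ => (arcMatrix_isZeroOne E).le_one _ _
  refine (Finset.sum_le_sum fun f _ => hle f).trans ?_
  rw [Finset.sum_boole]
  have := card_not_injective_le (V := Fin n) m
  rw [Fintype.card_fin] at this
  exact_mod_cast this

/-- The sets of arcs obtained from the complete one by removing `m` rectangles. -/
noncomputable def rectangleComplements (V : Type*) [Fintype V] [DecidableEq V] :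
    ℕ → Finset (Finset (V × V))
  | 0 => {Finset.univ}
  | m + 1 => ((rectangleComplements V m) ×ˢ
      (Finset.univ : Finset (Finset V × Finset V))).image fun p => p.1 \ (p.2.1 ×ˢ p.2.2)

theorem card_rectangleComplements_le (V : Type*) [Fintype V] [DecidableEq V] (m : ℕ) :
    (rectangleComplements V m).card ≤ 2 ^ (2 * m * Fintype.card V) := by
  induction m with
  | zero => simp [rectangleComplements]
  | succ m ih =>
    refine Finset.card_image_le.trans ?_
    rw [Finset.card_product]
    calc _ ≤ 2 ^ (2 * m * Fintype.card V) * (2 ^ (2 * Fintype.card V)) := by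
          refine Nat.mul_le_mul ih ?_
          simp [← pow_add, two_mul]
      _ = _ := by rw [← pow_add]; ring_nf

theorem sum_arcMatrix_eq_card {V : Type*} [DecidableEq V] (D : Finset (V × V)) (S T : Finset V) :
    ∑ x ∈ S, ∑ y ∈ T, arcMatrix D x y = (D ∩ S ×ˢ T).card := by
  unfold arcMatrix
  rw [← Finset.sum_product']
  simp only [Finset.sum_boole, Prod.mk.eta]
  congr 2
  ext p
  simp [and_comm]

/-- Every set of arcs `G` is almost contained in a set `D` from a small family such that `G` is
relatively dense in `D` on every large rectangle. -/
theorem exists_rectangleComplement {V : Type*} [Fintype V] [DecidableEq V]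
    (G : Finset (V × V)) {δ e : ℝ}
    (hδ : 0 ≤ δ) (hδ1 : δ ≤ 1) (he : 0 < e) {m : ℕ} (hm : 1 < m * e) :
    ∃ D ∈ rectangleComplements V m,
      ((G \ D).card : ℝ) ≤ δ * (Fintype.card V : ℝ) ^ 2 ∧
      ∀ S T : Finset V, δ * (∑ x ∈ S, ∑ y ∈ T, arcMatrix D x y) - e * (Fintype.card V : ℝ) ^ 2 ≤
        ∑ x ∈ S, ∑ y ∈ T, arcMatrix G x y := by
  simp only [sum_arcMatrix_eq_card]
  have hdense : ∀ D : Finset (V × V), (Dᶜ.card : ℝ) ≤ (Fintype.card V : ℝ) ^ 2 := by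
    intro D
    have := Finset.card_le_univ Dᶜ
    rw [Fintype.card_prod, ← sq] at this
    exact_mod_cast this
  have key : ∀ j : ℕ, ∃ D ∈ rectangleComplements V j,
      ((G \ D).card : ℝ) ≤ δ * (Dᶜ.card : ℝ) ∧
      ((∀ S T : Finset V, δ * ((D ∩ S ×ˢ T).card : ℝ) - e * (Fintype.card V : ℝ) ^ 2 ≤
        (G ∩ S ×ˢ T).card) ∨ j * (e * (Fintype.card V : ℝ) ^ 2) ≤ (Dᶜ.card : ℝ)) := by
    intro j
    induction j with
    | zero =>
      refine ⟨Finset.univ, by simp [rectangleComplements], by simp, Or.inr (by simp)⟩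
    | succ j ih =>
      obtain ⟨D, hD, hGD, h⟩ := ih
      by_cases hgood : ∀ S T : Finset V,
          δ * ((D ∩ S ×ˢ T).card : ℝ) - e * (Fintype.card V : ℝ) ^ 2 ≤ (G ∩ S ×ˢ T).card
      · refine ⟨D, ?_, hGD, Or.inl hgood⟩
        exact Finset.mem_image.2 ⟨(D, ∅, ∅), by simp [hD], by simp⟩
      · have hj := h.resolve_left hgood
        push Not at hgood
        obtain ⟨S, T, hST⟩ := hgood
        refine ⟨D \ S ×ˢ T, Finset.mem_image.2 ⟨(D, S, T), by simp [hD], rfl⟩, ?_, Or.inr ?_⟩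
        all_goals
          have hc : (((D \ S ×ˢ T)ᶜ).card : ℝ) = (Dᶜ.card : ℝ) + ((D ∩ S ×ˢ T).card : ℝ) := by
            rw [← Nat.cast_add, ← Finset.card_union_of_disjoint]
            · congr 2
              ext p
              simp only [Finset.mem_compl, Finset.mem_sdiff, Finset.mem_union, Finset.mem_inter]
              tauto
            · rw [Finset.disjoint_left]
              intro p
              simp only [Finset.mem_compl, Finset.mem_inter]
              tauto
          rw [hc]
        · have h1 : ((G \ (D \ S ×ˢ T)).card : ℝ) ≤ ((G \ D).card : ℝ) + (G ∩ S ×ˢ T).card := by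
            rw [← Nat.cast_add]
            refine Nat.cast_le.2 ((Finset.card_le_card ?_).trans (Finset.card_union_le _ _))
            intro p
            simp only [Finset.mem_sdiff, Finset.mem_union, Finset.mem_inter]
            tauto
          have : 0 ≤ e * (Fintype.card V : ℝ) ^ 2 := by positivity
          linarith
        · have h1 : δ * ((D ∩ S ×ˢ T).card : ℝ) ≤ 1 * ((D ∩ S ×ˢ T).card : ℝ) := by gcongr
          have : (0 : ℝ) ≤ (G ∩ S ×ˢ T).card := by positivity
          push_cast
          linarith
  obtain ⟨D, hD, hGD, h⟩ := key m
  refine ⟨D, hD, hGD.trans (mul_le_mul_of_nonneg_left (hdense D) hδ), ?_⟩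
  rcases h with h | h
  · exact h
  · have h2 := h.trans (hdense D)
    have h0 : (0 : ℝ) ≤ (Fintype.card V : ℝ) ^ 2 := by positivity
    rcases h0.eq_or_lt with h0 | h0
    · intro S T
      have h3 : ((D ∩ S ×ˢ T).card : ℝ) ≤ (Fintype.card V : ℝ) ^ 2 := by
        have := Finset.card_le_univ (D ∩ S ×ˢ T)
        rw [Fintype.card_prod, ← sq] at this
        exact_mod_cast this
      have h4 : ((D ∩ S ×ˢ T).card : ℝ) = 0 := le_antisymm (h0 ▸ h3) (by positivity)
      rw [h4, ← h0]
      simp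
    · nlinarith

/-- Containers for `C_k`-free graphs. -/
theorem exists_container {k : ℕ} (hk : 3 ≤ k) {δ η : ℝ} (hδ : 0 < δ) (hδ1 : δ ≤ 1) (hη : 0 < η) :
    ∃ m N : ℕ, ∀ n : ℕ, N ≤ n → ∀ E : ArcSet n, CkFree k E →
      ∃ D ∈ rectangleComplements (Fin n) m, ((E \ D).card : ℝ) ≤ δ * (n : ℝ) ^ 2 ∧
        (arcMatrix D ^ k).trace ≤ η * (n : ℝ) ^ k := by
  have hk0 : (0 : ℝ) < k := by exact_mod_cast (by omega : 0 < k)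
  have hδk : 0 < δ ^ k := pow_pos hδ k
  set e : ℝ := δ ^ k * η / (2 * k) with he_def
  have he : 0 < e := by positivity
  obtain ⟨m, hm⟩ := exists_nat_gt (1 / e)
  obtain ⟨N, hN⟩ := exists_nat_gt (2 * (k : ℝ) ^ 2 / (δ ^ k * η))
  refine ⟨m, N, fun n hn E hE => ?_⟩
  obtain ⟨D, hD, h1, h2⟩ := exists_rectangleComplement E hδ.le hδ1 he ((div_lt_iff₀ he).1 hm)
  rw [Fintype.card_fin] at h1 h2
  refine ⟨D, hD, h1, ?_⟩
  have h3 := trace_pow_le_of_rect (arcMatrix_isZeroOne E) (arcMatrix_isZeroOne D) hδ.le hδ1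
    (by positivity) h2 hk
  have h4 := trace_pow_le_of_ckFree (by omega : 1 ≤ k) hE
  rw [Fintype.card_fin] at h3
  have hnN : 2 * (k : ℝ) ^ 2 / (δ ^ k * η) < n := hN.trans_le (by exact_mod_cast hn)
  rw [div_lt_iff₀ (by positivity)] at hnN
  have h5 : (n : ℝ) ^ k = (n : ℝ) ^ (k - 1) * n := by
    rw [← pow_succ]; congr 1; omega
  have h6 : e * (n : ℝ) ^ 2 * (n : ℝ) ^ (k - 2) = e * (n : ℝ) ^ k := by
    rw [mul_assoc, ← pow_add]; congr 2; omega
  rw [h6] at h3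
  have h7 : k * (e * (n : ℝ) ^ k) = δ ^ k * η / 2 * (n : ℝ) ^ k := by
    rw [he_def]; field_simp
  have h8 : (k : ℝ) ^ 2 * (n : ℝ) ^ (k - 1) ≤ δ ^ k * η / 2 * (n : ℝ) ^ k := by
    rw [h5]
    have : (0 : ℝ) ≤ (n : ℝ) ^ (k - 1) := by positivity
    nlinarith
  have h9 : δ ^ k * (arcMatrix D ^ k).trace ≤ δ ^ k * (η * (n : ℝ) ^ k) := by linarith
  exact le_of_mul_le_mul_left h9 hδk

theorem exists_minDegree_subsets {V : Type*} [Fintype V] [DecidableEq V] {M : Matrix V V ℝ}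
    (hM : ∀ x y, M x y = M y x) {θ : ℝ} (hθ : 0 ≤ θ) {X Y : Finset V}
    (h : θ * ((X.card : ℝ) + Y.card) < ∑ x ∈ X, ∑ y ∈ Y, M x y) :
    ∃ X' ⊆ X, ∃ Y' ⊆ Y, X'.Nonempty ∧ Y'.Nonempty ∧ (∀ x ∈ X', θ ≤ ∑ y ∈ Y', M x y) ∧
      ∀ y ∈ Y', θ ≤ ∑ x ∈ X', M y x := by
  obtain ⟨⟨X', Y'⟩, hmem, hmax⟩ := Finset.exists_max_image (X.powerset ×ˢ Y.powerset)
    (fun p : Finset V × Finset V =>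
      (∑ x ∈ p.1, ∑ y ∈ p.2, M x y) - θ * ((p.1.card : ℝ) + p.2.card))
    ⟨(X, Y), by simp⟩
  simp only [Finset.mem_product, Finset.mem_powerset] at hmem hmax
  obtain ⟨hX, hY⟩ := hmem
  have h0 := hmax (X, Y) ⟨subset_rfl, subset_rfl⟩
  have hpos : 0 < (∑ x ∈ X', ∑ y ∈ Y', M x y) - θ * ((X'.card : ℝ) + Y'.card) := by
    simp only at h0
    linarith
  refine ⟨X', hX, Y', hY, ?_, ?_, ?_, ?_⟩
  · by_contra hne
    rw [Finset.not_nonempty_iff_eq_empty] at hne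
    subst hne
    have : 0 ≤ θ * (Y'.card : ℝ) := by positivity
    simp at hpos
    linarith
  · by_contra hne
    rw [Finset.not_nonempty_iff_eq_empty] at hne
    subst hne
    have : 0 ≤ θ * (X'.card : ℝ) := by positivity
    simp at hpos
    linarith
  · intro x hx
    have h1 := hmax (X'.erase x, Y') ⟨(Finset.erase_subset _ _).trans hX, hY⟩
    simp only at h1
    rw [← Finset.add_sum_erase X' _ hx, Finset.card_erase_of_mem hx,
      Nat.cast_sub (Finset.card_pos.2 ⟨x, hx⟩)] at h1
    push_cast at h1
    linarith
  · intro y hy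
    have h1 := hmax (X', Y'.erase y) ⟨hX, (Finset.erase_subset _ _).trans hY⟩
    simp only at h1
    have e : ∀ x, ∑ z ∈ Y', M x z = M x y + ∑ z ∈ Y'.erase y, M x z :=
      fun x => (Finset.add_sum_erase Y' _ hy).symm
    simp_rw [e, Finset.sum_add_distrib] at h1
    rw [Finset.card_erase_of_mem hy, Nat.cast_sub (Finset.card_pos.2 ⟨y, hy⟩)] at h1
    push_cast at h1
    simp_rw [hM y]
    linarith

theorem pow_le_sum_pow_of_minDegree {V : Type*} [Fintype V] [DecidableEq V] {A M : Matrix V V ℝ}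
    (hA : ∀ x y, 0 ≤ A x y) (hMA : ∀ x y, M x y ≤ A x y)
    {θ : ℝ} (hθ : 0 ≤ θ) (l : ℕ) {X Y : Finset V}
    (hX : ∀ x ∈ X, θ ≤ ∑ y ∈ Y, M x y) (hY : ∀ y ∈ Y, θ ≤ ∑ x ∈ X, M y x) :
    ∀ x ∈ X, θ ^ l ≤ ∑ z ∈ if Even l then X else Y, (A ^ l) x z := by
  induction l generalizing X Y with
  | zero => intro x hx; simp [Matrix.one_apply, hx]
  | succ l ih =>
    intro x hx
    have hset : (if Even (l + 1) then X else Y) = if Even l then Y else X := by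
      by_cases h : Even l <;> simp [h, Nat.even_add_one]
    rw [hset]
    simp_rw [pow_succ' A, Matrix.mul_apply]
    rw [Finset.sum_comm]
    simp_rw [← Finset.mul_sum]
    calc θ ^ (l + 1) = θ * θ ^ l := pow_succ' _ _
      _ ≤ (∑ y ∈ Y, A x y) * θ ^ l := by
          gcongr
          exact (hX x hx).trans (Finset.sum_le_sum fun y _ => hMA x y)
      _ = ∑ y ∈ Y, A x y * θ ^ l := Finset.sum_mul _ _ _
      _ ≤ ∑ y ∈ Y, A x y * ∑ z ∈ if Even l then Y else X, (A ^ l) y z :=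
          Finset.sum_le_sum fun y hy => mul_le_mul_of_nonneg_left (ih hY hX y hy) (hA x y)
      _ ≤ _ := Finset.sum_le_sum_of_subset_of_nonneg (Finset.subset_univ _) fun y _ _ =>
          mul_nonneg (hA x y) (Finset.sum_nonneg fun z _ => matrix_pow_nonneg hA l y z)

theorem pow_le_sum_pow_of_dense {V : Type*} [Fintype V] [DecidableEq V] {A M : Matrix V V ℝ}
    (hA : ∀ x y, 0 ≤ A x y) (hMA : ∀ x y, M x y ≤ A x y) (hM : ∀ x y, M x y = M y x)
    (hM1 : ∀ x y, M x y ≤ 1) {θ : ℝ} (hθ : 0 ≤ θ) (l : ℕ) {X Y : Finset V}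
    (h : θ * ((X.card : ℝ) + Y.card) < ∑ x ∈ X, ∑ y ∈ Y, M x y) :
    θ ^ (l + 1) ≤ ∑ x ∈ X, ∑ z ∈ if Even l then X else Y, (A ^ l) x z := by
  obtain ⟨X', hX', Y', hY', -, ⟨y, hy⟩, hX, hY⟩ := exists_minDegree_subsets hM hθ h
  have hcard : θ ≤ X'.card := by
    refine (hY y hy).trans ((Finset.sum_le_sum fun x _ => hM1 y x).trans ?_)
    simp
  have hset : (if Even l then X' else Y') ⊆ if Even l then X else Y := by
    split_ifs <;> assumption
  calc θ ^ (l + 1) = θ * θ ^ l := pow_succ' _ _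
    _ ≤ X'.card * θ ^ l := by gcongr
    _ = ∑ _x ∈ X', θ ^ l := by simp
    _ ≤ ∑ x ∈ X', ∑ z ∈ if Even l then X' else Y', (A ^ l) x z :=
        Finset.sum_le_sum (pow_le_sum_pow_of_minDegree hA hMA hθ l hX hY)
    _ ≤ ∑ x ∈ X', ∑ z ∈ if Even l then X else Y, (A ^ l) x z :=
        Finset.sum_le_sum fun x _ => Finset.sum_le_sum_of_subset_of_nonneg hset
          fun z _ _ => matrix_pow_nonneg hA l x z
    _ ≤ _ := Finset.sum_le_sum_of_subset_of_nonneg hX'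
          fun x _ _ => Finset.sum_nonneg fun z _ => matrix_pow_nonneg hA l x z

theorem sum_sum_le_mul_mul_apply {V : Type*} [Fintype V] {A Q : Matrix V V ℝ}
    (hA : ∀ x y, 0 ≤ A x y) (hQ : ∀ x y, 0 ≤ Q x y) (w : V) {X Z : Finset V}
    (hX : ∀ x ∈ X, A w x = 1) (hZ : ∀ z ∈ Z, A z w = 1) :
    ∑ x ∈ X, ∑ z ∈ Z, Q x z ≤ (A * Q * A) w w := by
  rw [mul_assoc]
  simp only [Matrix.mul_apply]
  calc ∑ x ∈ X, ∑ z ∈ Z, Q x z = ∑ x ∈ X, A w x * ∑ z ∈ Z, Q x z * A z w := by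
        refine Finset.sum_congr rfl fun x hx => ?_
        rw [hX x hx, one_mul]
        exact Finset.sum_congr rfl fun z hz => by rw [hZ z hz, mul_one]
    _ ≤ ∑ x ∈ X, A w x * ∑ z, Q x z * A z w :=
        Finset.sum_le_sum fun x _ => mul_le_mul_of_nonneg_left
          (Finset.sum_le_sum_of_subset_of_nonneg (Finset.subset_univ _)
            fun z _ _ => mul_nonneg (hQ x z) (hA z w)) (hA w x)
    _ ≤ _ := Finset.sum_le_sum_of_subset_of_nonneg (Finset.subset_univ _)
        fun x _ _ => mul_nonneg (hA w x)
          (Finset.sum_nonneg fun z _ => mul_nonneg (hQ x z) (hA z w))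

theorem le_sum_of_many_large {V : Type*} [Fintype V] {f g : V → ℝ} {a b c : ℝ} (ha : 0 < a)
    (hc : 0 ≤ c) (hfa : ∀ w, f w ≤ a) (hf : 2 * b * Fintype.card V * a ≤ ∑ w, f w)
    (hg : ∀ w, 0 ≤ g w) (hfg : ∀ w, b * a ≤ f w → c ≤ g w) :
    b * Fintype.card V * c ≤ ∑ w, g w := by
  have h1 : ∑ w, f w ≤ ((Finset.univ.filter fun w => b * a ≤ f w).card : ℝ) * a +
      Fintype.card V * (b * a) ∨ b < 0 := by
    by_cases hb : 0 ≤ b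
    · left
      calc ∑ w, f w ≤ ∑ w, ((if b * a ≤ f w then a else 0) + b * a) := by
            refine Finset.sum_le_sum fun w _ => ?_
            split_ifs with h
            · have := hfa w
              have : 0 ≤ b * a := by positivity
              linarith
            · push Not at h
              linarith
        _ = _ := by
            rw [Finset.sum_add_distrib, ← Finset.sum_filter]
            simp
    · exact Or.inr (not_le.1 hb)
  rcases h1 with h1 | hb
  · have h2 : b * Fintype.card V ≤ (Finset.univ.filter fun w => b * a ≤ f w).card := by
      refine le_of_mul_le_mul_right ?_ ha
      linarith
    calc b * Fintype.card V * c ≤ (Finset.univ.filter fun w => b * a ≤ f w).card * c := by gcongr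
      _ = ∑ w with b * a ≤ f w, c := by simp
      _ ≤ ∑ w with b * a ≤ f w, g w :=
          Finset.sum_le_sum fun w hw => hfg w (Finset.mem_filter.1 hw).2
      _ ≤ _ := Finset.sum_le_sum_of_subset_of_nonneg (Finset.subset_univ _) fun w _ _ => hg w
  · have h3 : b * Fintype.card V * c ≤ 0 := by
      have : 0 ≤ (Fintype.card V : ℝ) * c := by positivity
      nlinarith
    exact h3.trans (Finset.sum_nonneg fun w _ => hg w)

theorem sum_le_card {V : Type*} {f : V → ℝ} (hf : ∀ x, f x ≤ 1) (S : Finset V) :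
    ∑ x ∈ S, f x ≤ S.card := by
  refine (Finset.sum_le_sum fun x _ => hf x).trans ?_
  simp

theorem trace_pow_ge_of_dense {V : Type*} [Fintype V] [DecidableEq V] {A M : Matrix V V ℝ}
    (hA : ∀ x y, 0 ≤ A x y) (hMA : ∀ x y, M x y ≤ A x y) (hM : ∀ x y, M x y = M y x)
    (hM1 : ∀ x y, M x y ≤ 1) (hV : 0 < Fintype.card V) {ε : ℝ} (hε : 0 < ε) (l : ℕ)
    (X Y : V → Finset V) (hX : ∀ w, ∀ x ∈ X w, A w x = 1)
    (hY : ∀ w, ∀ z ∈ if Even l then X w else Y w, A z w = 1)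
    (hsum : ε * (Fintype.card V : ℝ) ^ 3 ≤ ∑ w, ∑ x ∈ X w, ∑ y ∈ Y w, M x y) :
    (ε / 8) ^ (l + 2) * (Fintype.card V : ℝ) ^ (l + 2) ≤ (A ^ (l + 2)).trace := by
  have hn : (0 : ℝ) < Fintype.card V := by exact_mod_cast hV
  have hcard : ∀ S : Finset V, (S.card : ℝ) ≤ Fintype.card V := fun S => by
    exact_mod_cast Finset.card_le_univ S
  have htr : (A ^ (l + 2)).trace = ∑ w, (A * A ^ l * A) w w := by
    rw [pow_succ, pow_succ']
    rfl
  have key := le_sum_of_many_large (V := V) (f := fun w => ∑ x ∈ X w, ∑ y ∈ Y w, M x y)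
    (g := fun w => (A * A ^ l * A) w w) (a := (Fintype.card V : ℝ) ^ 2) (b := ε / 2)
    (c := (ε / 8 * Fintype.card V) ^ (l + 1)) (by positivity) (by positivity) ?_ ?_ ?_ ?_
  · rw [htr]
    refine le_trans ?_ key
    rw [← mul_pow, pow_succ' _ (l + 1)]
    gcongr
    linarith
  · intro w
    calc _ ≤ ∑ x ∈ X w, (Fintype.card V : ℝ) :=
          Finset.sum_le_sum fun x _ => (sum_le_card (hM1 x) _).trans (hcard _)
      _ = (X w).card * (Fintype.card V : ℝ) := by simp
      _ ≤ Fintype.card V * (Fintype.card V : ℝ) := by gcongr; exact Finset.card_le_univ _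
      _ = _ := by ring
  · refine le_trans (le_of_eq ?_) hsum
    ring
  · intro w
    exact matrix_mul_nonneg (matrix_mul_nonneg hA (matrix_pow_nonneg hA l)) hA w w
  · intro w hw
    refine (pow_le_sum_pow_of_dense hA hMA hM hM1 (by positivity) l (X := X w) (Y := Y w) ?_).trans
      (sum_sum_le_mul_mul_apply hA (matrix_pow_nonneg hA l) w (hX w) (hY w))
    have h1 := hcard (X w)
    have h2 := hcard (Y w)
    calc ε / 8 * Fintype.card V * ((X w).card + (Y w).card)
        ≤ ε / 8 * Fintype.card V * (Fintype.card V + Fintype.card V) := by gcongr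
      _ < ε / 2 * (Fintype.card V : ℝ) ^ 2 := by nlinarith [mul_pos hε (mul_pos hn hn)]
      _ ≤ _ := hw

/-- Many copies of a double edge contained in a triangle give many closed `k`-walks. -/
theorem trace_pow_ge_of_doubleEdge_triangle {V : Type*} [Fintype V] [DecidableEq V]
    {A : Matrix V V ℝ} (hA : IsZeroOne A) {k : ℕ} (hk : 3 ≤ k) (hV : 0 < Fintype.card V)
    {ε : ℝ} (hε : 0 < ε) (hε1 : ε ≤ 1)
    (h : ε * (Fintype.card V : ℝ) ^ 3 ≤ ∑ u, ∑ v, A u v * A v u * (A * A) v u) :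
    (ε ^ 2 / 8) ^ k * (Fintype.card V : ℝ) ^ k ≤ (A ^ k).trace := by
  obtain ⟨l, rfl⟩ : ∃ l, k = l + 2 := ⟨k - 2, by omega⟩
  have hn : (0 : ℝ) < Fintype.card V := by exact_mod_cast hV
  set M : Matrix V V ℝ := fun x y => A x y * A y x with hMdef
  have hM : IsZeroOne M := fun x y => by
    rcases hA x y with h1 | h1 <;> rcases hA y x with h2 | h2 <;> simp [hMdef, h1, h2]
  have hMA : ∀ x y, M x y ≤ A x y := fun x y =>
    mul_le_of_le_one_right (hA.nonneg x y) (hA.le_one y x)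
  have hMs : ∀ x y, M x y = M y x := fun x y => mul_comm _ _
  by_cases hl : Even l
  · refine trace_pow_ge_of_dense hA.nonneg hMA hMs hM.le_one hV (by positivity) l
      (fun w => Finset.univ.filter fun x => M w x = 1) (fun _ => Finset.univ) ?_ ?_ ?_
    · intro w x hx
      refine le_antisymm (hA.le_one w x) ?_
      rw [← (Finset.mem_filter.1 hx).2]
      exact hMA w x
    · intro w x hx
      rw [if_pos hl] at hx
      refine le_antisymm (hA.le_one x w) ?_
      rw [← (Finset.mem_filter.1 hx).2, hMs]
      exact hMA x w
    · have e1 : ∑ w, ∑ x with M w x = 1, ∑ y, M x y = ∑ x, (∑ y, M x y) ^ 2 := by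
        simp_rw [Finset.sum_filter]
        rw [Finset.sum_comm]
        refine Finset.sum_congr rfl fun x _ => ?_
        rw [sq, Finset.sum_mul]
        refine Finset.sum_congr rfl fun w _ => ?_
        rw [hMs x w]
        rcases hM w x with h1 | h1 <;> simp [h1]
      rw [e1]
      have h2 : ε * (Fintype.card V : ℝ) ^ 2 ≤ ∑ x, ∑ y, M x y := by
        refine le_of_mul_le_mul_right ?_ hn
        calc ε * (Fintype.card V : ℝ) ^ 2 * Fintype.card V
            = ε * (Fintype.card V : ℝ) ^ 3 := by ring
          _ ≤ _ := h
          _ ≤ ∑ u, ∑ v, M u v * Fintype.card V := by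
              refine Finset.sum_le_sum fun u _ => Finset.sum_le_sum fun v _ =>
                mul_le_mul_of_nonneg_left ?_ (hM.nonneg u v)
              rw [Matrix.mul_apply]
              exact sum_le_card (fun z => mul_le_one₀ (hA.le_one _ _) (hA.nonneg _ _)
                (hA.le_one _ _)) _
          _ = _ := by simp_rw [Finset.sum_mul]
      have h3 := sq_sum_le_card_mul_sum_sq (s := (Finset.univ : Finset V))
        (f := fun x => ∑ y, M x y)
      rw [Finset.card_univ] at h3
      refine le_of_mul_le_mul_left ?_ hn
      calc Fintype.card V * (ε ^ 2 * (Fintype.card V : ℝ) ^ 3)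
          = (ε * (Fintype.card V : ℝ) ^ 2) ^ 2 := by ring
        _ ≤ _ := by gcongr
        _ ≤ _ := h3
  · refine trace_pow_ge_of_dense hA.nonneg hMA hMs hM.le_one hV (by positivity) l
      (fun w => Finset.univ.filter fun x => A w x = 1)
      (fun w => Finset.univ.filter fun y => A y w = 1) ?_ ?_ ?_
    · exact fun w x hx => (Finset.mem_filter.1 hx).2
    · intro w x hx
      rw [if_neg hl] at hx
      exact (Finset.mem_filter.1 hx).2
    · refine le_trans ?_ (h.trans (le_of_eq ?_))
      · have : ε ^ 2 ≤ ε := by nlinarith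
        gcongr
      · simp_rw [← sum_rect_eq hA hA M]
        rw [Finset.sum_comm (f := fun w x => ∑ y, A w x * M x y * A y w)]
        refine Finset.sum_congr rfl fun u _ => ?_
        rw [Finset.sum_comm (f := fun w y => A w u * M u y * A y w)]
        refine Finset.sum_congr rfl fun v _ => ?_
        rw [Matrix.mul_apply, Finset.mul_sum]
        refine Finset.sum_congr rfl fun w _ => ?_
        simp only [hMdef]
        ring

theorem sum_le_of_doubleEdge_bound {V : Type*} [Fintype V] [DecidableEq V] {a : Matrix V V ℝ}
    (ha : IsZeroOne a) (hdiag : ∀ x, a x x = 0) {θ : ℝ} (hθ : 0 ≤ θ)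
    (h : ∀ u v, a u v = 1 → a v u = 1 → (a * a) v u ≤ θ) (U : Finset V) :
    ∑ x ∈ U, ∑ y ∈ U, a x y ≤ (U.card : ℝ) ^ 2 / 2 + θ * U.card := by
  induction U using Finset.strongInduction with
  | H U ih =>
    by_cases hdbl : ∃ u ∈ U, ∃ v ∈ U, a u v = 1 ∧ a v u = 1
    · obtain ⟨u, hu, v, hv, huv, hvu⟩ := hdbl
      have hne : u ≠ v := by
        rintro rfl
        rw [hdiag] at huv
        norm_num at huv
      obtain ⟨W, huW, hvW, rfl⟩ : ∃ W : Finset V, u ∉ insert v W ∧ v ∉ W ∧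
          U = insert u (insert v W) := by
        refine ⟨(U.erase u).erase v, ?_, by simp, ?_⟩
        · simp [hne]
        · rw [Finset.insert_erase (Finset.mem_erase.2 ⟨hne.symm, hv⟩), Finset.insert_erase hu]
      have hW := ih W (Finset.ssubset_of_subset_of_ssubset (Finset.subset_insert v W)
        (Finset.ssubset_insert huW))
      rw [Finset.card_insert_of_notMem huW, Finset.card_insert_of_notMem hvW]
      simp only [Finset.sum_insert huW, Finset.sum_insert hvW, Finset.sum_add_distrib, hdiag,
        huv, hvu]
      have hb : ∀ p q, a p q = 1 → a q p = 1 → ∑ w ∈ W, (a q w + a w p) ≤ W.card + θ := by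
        intro p q hpq hqp
        calc ∑ w ∈ W, (a q w + a w p) ≤ ∑ w ∈ W, (1 + a q w * a w p) := by
              refine Finset.sum_le_sum fun w _ => ?_
              rcases ha q w with h1 | h1 <;> rcases ha w p with h2 | h2 <;>
                rw [h1, h2] <;> norm_num
          _ = W.card + ∑ w ∈ W, a q w * a w p := by
              rw [Finset.sum_add_distrib]
              simp
          _ ≤ W.card + (a * a) q p := by
              rw [Matrix.mul_apply]
              refine (add_le_add_iff_left _).2 ?_
              exact Finset.sum_le_sum_of_subset_of_nonneg (Finset.subset_univ W)
                fun w _ _ => mul_nonneg (ha.nonneg _ _) (ha.nonneg _ _)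
          _ ≤ _ := by gcongr; exact h p q hpq hqp
      have h1 := hb u v huv hvu
      have h2 := hb v u hvu huv
      rw [Finset.sum_add_distrib] at h1 h2
      push_cast
      linarith
    · push Not at hdbl
      have h1 : ∑ x ∈ U, ∑ y ∈ U, (a x y + a y x) ≤ (U.card : ℝ) ^ 2 := by
        calc ∑ x ∈ U, ∑ y ∈ U, (a x y + a y x) ≤ ∑ x ∈ U, ∑ y ∈ U, (1 : ℝ) := by
              refine Finset.sum_le_sum fun x hx => Finset.sum_le_sum fun y hy => ?_
              have := hdbl x hx y hy
              rcases ha x y with h1 | h1 <;> rcases ha y x with h2 | h2 <;>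
                simp_all
          _ = _ := by simp [sq]
      have h2 : ∑ x ∈ U, ∑ y ∈ U, a y x = ∑ x ∈ U, ∑ y ∈ U, a x y := Finset.sum_comm
      simp_rw [Finset.sum_add_distrib] at h1
      have : 0 ≤ θ * U.card := by positivity
      linarith

/-- A digraph with few triangles containing a double edge has at most about `n ^ 2 / 2` arcs. -/
theorem sum_le_of_doubleEdge_triangle {V : Type*} [Fintype V] [DecidableEq V]
    {A : Matrix V V ℝ} (hA : IsZeroOne A) {θ : ℝ} (hθ : 0 < θ) :
    ∑ x, ∑ y, A x y ≤ (Fintype.card V : ℝ) ^ 2 / 2 + θ * Fintype.card V + Fintype.card V +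
      (∑ u, ∑ v, A u v * A v u * (A * A) v u) / θ := by
  set a : Matrix V V ℝ := fun x y =>
    if x = y ∨ (A x y = 1 ∧ A y x = 1 ∧ θ < (A * A) y x) then 0 else A x y with ha_def
  have ha : IsZeroOne a := fun x y => by
    simp only [ha_def]
    split_ifs
    · exact Or.inl rfl
    · exact hA x y
  have haA : ∀ x y, a x y ≤ A x y := fun x y => by
    simp only [ha_def]
    split_ifs
    · exact hA.nonneg x y
    · exact le_rfl
  have h1 := sum_le_of_doubleEdge_bound ha (fun x => by simp [ha_def]) hθ.le (fun u v huv hvu => by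
    have hle : (a * a) v u ≤ (A * A) v u := by
      simp only [Matrix.mul_apply]
      exact Finset.sum_le_sum fun w _ =>
        mul_le_mul (haA _ _) (haA _ _) (ha.nonneg _ _) (hA.nonneg _ _)
    refine hle.trans ?_
    have hAuv : A u v = 1 := le_antisymm (hA.le_one _ _) (huv ▸ haA u v)
    have hAvu : A v u = 1 := le_antisymm (hA.le_one _ _) (hvu ▸ haA v u)
    by_contra hcon
    push Not at hcon
    simp [ha_def, hAuv, hAvu, hcon] at huv) Finset.univ
  rw [Finset.card_univ] at h1
  have hAA : ∀ x y, 0 ≤ (A * A) x y := matrix_mul_nonneg hA.nonneg hA.nonneg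
  have h2 : ∀ x y, A x y ≤ a x y + (if x = y then 1 else 0) +
      A x y * A y x * (A * A) y x / θ := by
    intro x y
    have h0 : 0 ≤ A x y * A y x * (A * A) y x / θ :=
      div_nonneg (mul_nonneg (mul_nonneg (hA.nonneg _ _) (hA.nonneg _ _)) (hAA _ _)) hθ.le
    by_cases hxy : x = y
    · have := hA.le_one x y
      have := ha.nonneg x y
      rw [if_pos hxy]
      linarith
    · rw [if_neg hxy]
      by_cases hbad : A x y = 1 ∧ A y x = 1 ∧ θ < (A * A) y x
      · obtain ⟨e1, e2, e3⟩ := hbad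
        have : 1 ≤ A x y * A y x * (A * A) y x / θ := by
          rw [e1, e2, one_mul, one_mul, le_div_iff₀ hθ, one_mul]
          exact e3.le
        have := ha.nonneg x y
        linarith
      · have : a x y = A x y := by simp [ha_def, hxy, hbad]
        linarith
  have h3 := Finset.sum_le_sum fun x (_ : x ∈ (Finset.univ : Finset V)) =>
    Finset.sum_le_sum fun y (_ : y ∈ (Finset.univ : Finset V)) => h2 x y
  simp_rw [Finset.sum_add_distrib, ← Finset.sum_div] at h3
  have h4 : ∑ x : V, ∑ y : V, (if x = y then (1 : ℝ) else 0) = Fintype.card V := by simp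
  linarith

theorem sum_outNeighbors_ge {V : Type*} {T : Matrix V V ℝ}
    (hT : IsZeroOne T) (hT1 : ∀ x y, 1 ≤ T x y + T y x) (S : Finset V) :
    (S.card : ℝ) ^ 2 / 2 ≤ ∑ x ∈ S, ((S.filter fun z => T x z = 1).card : ℝ) := by
  have e : ∀ x, ((S.filter fun z => T x z = 1).card : ℝ) = ∑ y ∈ S, T x y := by
    intro x
    rw [Finset.card_filter]
    push_cast
    refine Finset.sum_congr rfl fun y _ => ?_
    rcases hT x y with h | h <;> simp [h]
  simp_rw [e]
  have h1 : (S.card : ℝ) ^ 2 ≤ ∑ x ∈ S, ∑ y ∈ S, (T x y + T y x) := by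
    calc (S.card : ℝ) ^ 2 = ∑ x ∈ S, ∑ y ∈ S, (1 : ℝ) := by simp [sq]
      _ ≤ _ := Finset.sum_le_sum fun x _ => Finset.sum_le_sum fun y _ => hT1 x y
  have h2 : ∑ x ∈ S, ∑ y ∈ S, T y x = ∑ x ∈ S, ∑ y ∈ S, T x y := Finset.sum_comm
  simp_rw [Finset.sum_add_distrib] at h1
  linarith

/-- Reflexive semicomplete digraphs have many walks of every length inside every set. -/
theorem exists_walks_semicomplete (j : ℕ) : ∃ c : ℝ, 0 < c ∧
    ∀ {V : Type*} [Fintype V] [DecidableEq V] (T : Matrix V V ℝ), IsZeroOne T →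
      (∀ x y, 1 ≤ T x y + T y x) → ∀ S : Finset V,
        c * (S.card : ℝ) ^ (j + 1) ≤ ∑ x ∈ S, ∑ y ∈ S, (T ^ j) x y := by
  induction j with
  | zero =>
    refine ⟨1, one_pos, fun T _ _ S => ?_⟩
    simp [Matrix.one_apply]
  | succ j ih =>
    obtain ⟨c, hc, ih⟩ := ih
    refine ⟨c / 2 ^ (j + 1), by positivity, fun {V} _ _ T hT hT1 S => ?_⟩
    rcases S.eq_empty_or_nonempty with rfl | hS
    · simp
    have hs : (0 : ℝ) < S.card := by exact_mod_cast hS.card_pos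
    have hTj := matrix_pow_nonneg hT.nonneg j
    have h1 : ∑ x ∈ S, c * ((S.filter fun z => T x z = 1).card : ℝ) ^ (j + 1) ≤
        ∑ x ∈ S, ∑ y ∈ S, (T ^ (j + 1)) x y := by
      refine Finset.sum_le_sum fun x _ => (ih T hT hT1 _).trans ?_
      simp_rw [pow_succ' T, Matrix.mul_apply]
      rw [Finset.sum_comm (s := S)]
      calc _ ≤ ∑ z ∈ S with T x z = 1, ∑ y ∈ S, (T ^ j) z y :=
            Finset.sum_le_sum fun z _ => Finset.sum_le_sum_of_subset_of_nonneg
              (Finset.filter_subset _ _) fun y _ _ => hTj z y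
        _ = ∑ z ∈ S with T x z = 1, ∑ y ∈ S, T x z * (T ^ j) z y :=
            Finset.sum_congr rfl fun z hz => by simp [(Finset.mem_filter.1 hz).2]
        _ ≤ _ := Finset.sum_le_sum_of_subset_of_nonneg (Finset.subset_univ _) fun z _ _ =>
              Finset.sum_nonneg fun y _ => mul_nonneg (hT.nonneg _ _) (hTj _ _)
    refine le_trans ?_ h1
    rw [← Finset.mul_sum, div_mul_eq_mul_div, div_le_iff₀ (by positivity), mul_assoc]
    refine mul_le_mul_of_nonneg_left ?_ hc.le
    have h2 := pow_sum_div_card_le_sum_pow (s := S)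
      (f := fun x => ((S.filter fun z => T x z = 1).card : ℝ)) (fun x _ => Nat.cast_nonneg _) j
    calc (S.card : ℝ) ^ (j + 1 + 1)
        = ((S.card : ℝ) ^ 2 / 2) ^ (j + 1) / (S.card : ℝ) ^ j * 2 ^ (j + 1) := by
          rw [div_pow]
          field_simp
          ring
      _ ≤ _ := by
          refine mul_le_mul_of_nonneg_right (le_trans ?_ h2) (by positivity)
          gcongr
          exact sum_outNeighbors_ge hT hT1 S

/-- Reflexive semicomplete digraphs with many cyclic triangles have many closed `k`-walks. -/
theorem exists_trace_pow_ge_trace_pow_three {k : ℕ} (hk : 3 ≤ k) : ∃ c : ℝ, 0 < c ∧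
    ∀ {V : Type*} [Fintype V] [DecidableEq V] (T : Matrix V V ℝ), IsZeroOne T →
      (∀ x y, 1 ≤ T x y + T y x) → 0 < Fintype.card V → ∀ ε : ℝ, 0 ≤ ε →
        ε * (Fintype.card V : ℝ) ^ 3 ≤ (T ^ 3).trace →
        c * ε ^ (k - 2) * (Fintype.card V : ℝ) ^ k ≤ (T ^ k).trace := by
  obtain ⟨j, rfl⟩ : ∃ j, k = j + 3 := ⟨k - 3, by omega⟩
  obtain ⟨c, hc, hwalk⟩ := exists_walks_semicomplete j
  refine ⟨c, hc, fun {V} _ _ T hT hT1 hV ε hε h3 => ?_⟩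
  have hn : (0 : ℝ) < Fintype.card V := by exact_mod_cast hV
  set S : V → V → Finset V := fun b c =>
    Finset.univ.filter fun a => T c a = 1 ∧ T a b = 1 with hS
  have hST : ∀ b c, ((S b c).card : ℝ) = (T * T) c b := by
    intro b c
    rw [Matrix.mul_apply, hS, Finset.card_filter]
    push_cast
    refine Finset.sum_congr rfl fun y _ => ?_
    rcases hT c y with h | h <;> rcases hT y b with h' | h' <;> simp [h, h']
  have e3 : (T ^ 3).trace = ∑ p : V × V, T p.1 p.2 * (S p.1 p.2).card := by
    rw [pow_succ', sq, trace_mul_eq_sum, Fintype.sum_prod_type]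
    simp_rw [hST]
  have hlow : ∑ p : V × V, c * (T p.1 p.2 * (S p.1 p.2).card) ^ (j + 1) ≤ (T ^ (j + 3)).trace := by
    have e : T ^ (j + 3) = T * (T * T ^ j * T) := by
      rw [← pow_succ', ← pow_succ, ← pow_succ']
    rw [e, trace_mul_eq_sum, Fintype.sum_prod_type]
    refine Finset.sum_le_sum fun x _ => Finset.sum_le_sum fun y _ => ?_
    rcases hT x y with h | h
    · simp [h]
    · simp only [h, one_mul]
      refine (hwalk T hT hT1 (S x y)).trans ?_
      have hTj := matrix_pow_nonneg hT.nonneg j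
      rw [mul_assoc T]
      simp only [Matrix.mul_apply (M := T), Matrix.mul_apply (M := T ^ j)]
      calc _ = ∑ a ∈ S x y, T y a * ∑ b ∈ S x y, (T ^ j) a b * T b x := by
            refine Finset.sum_congr rfl fun a ha => ?_
            rw [(Finset.mem_filter.1 ha).2.1, one_mul]
            refine Finset.sum_congr rfl fun b hb => ?_
            rw [(Finset.mem_filter.1 hb).2.2, mul_one]
        _ ≤ ∑ a ∈ S x y, T y a * ∑ b, (T ^ j) a b * T b x :=
            Finset.sum_le_sum fun a _ => mul_le_mul_of_nonneg_left
              (Finset.sum_le_sum_of_subset_of_nonneg (Finset.subset_univ _)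
                fun z _ _ => mul_nonneg (hTj _ _) (hT.nonneg _ _)) (hT.nonneg _ _)
        _ ≤ _ := Finset.sum_le_sum_of_subset_of_nonneg (Finset.subset_univ _)
            fun a _ _ => mul_nonneg (hT.nonneg _ _)
              (Finset.sum_nonneg fun z _ => mul_nonneg (hTj _ _) (hT.nonneg _ _))
  refine le_trans ?_ hlow
  rw [← Finset.mul_sum, mul_assoc]
  refine mul_le_mul_of_nonneg_left ?_ hc.le
  have hp := pow_sum_div_card_le_sum_pow (s := (Finset.univ : Finset (V × V)))
    (f := fun p => T p.1 p.2 * ((S p.1 p.2).card : ℝ))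
    (fun p _ => mul_nonneg (hT.nonneg _ _) (Nat.cast_nonneg _)) j
  refine le_trans ?_ hp
  rw [← e3, Finset.card_univ, Fintype.card_prod]
  push_cast
  rw [le_div_iff₀ (by positivity)]
  calc ε ^ (j + 3 - 2) * (Fintype.card V : ℝ) ^ (j + 3) *
        ((Fintype.card V : ℝ) * (Fintype.card V : ℝ)) ^ j
      = (ε * (Fintype.card V : ℝ) ^ 3) ^ (j + 1) := by
        rw [show j + 3 - 2 = j + 1 by omega]
        ring
    _ ≤ _ := by gcongr

/-- The adjacency matrix of a tournament with all loops added. -/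
structure IsReflexiveTournament {V : Type*} (T : Matrix V V ℝ) : Prop where
  zeroOne : IsZeroOne T
  diag : ∀ x, T x x = 1
  add_eq_one : ∀ x y, x ≠ y → T x y + T y x = 1

theorem IsReflexiveTournament.one_le_add {V : Type*} {T : Matrix V V ℝ}
    (hT : IsReflexiveTournament T) (x y : V) : 1 ≤ T x y + T y x := by
  by_cases h : x = y
  · subst h
    rw [hT.diag]
    norm_num
  · exact (hT.add_eq_one x y h).ge

/-- The number of vertices dominated by `x` but not by `y`. -/
noncomputable def outDiff {V : Type*} [Fintype V] (T : Matrix V V ℝ) (x y : V) : ℝ :=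
  ∑ z, T x z * (1 - T y z)

theorem outDiff_sub {V : Type*} [Fintype V] (T : Matrix V V ℝ) (x y : V) :
    outDiff T x y - outDiff T y x = (∑ z, T x z) - ∑ z, T y z := by
  unfold outDiff
  rw [← Finset.sum_sub_distrib, ← Finset.sum_sub_distrib]
  exact Finset.sum_congr rfl fun z _ => by ring

theorem outDiff_nonneg {V : Type*} [Fintype V] {T : Matrix V V ℝ} (hT : IsZeroOne T) (x y : V) :
    0 ≤ outDiff T x y :=
  Finset.sum_nonneg fun _ _ => mul_nonneg (hT.nonneg _ _) (sub_nonneg.2 (hT.le_one _ _))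

theorem sum_mul_outDiff_le {V : Type*} [Fintype V] [DecidableEq V] {T : Matrix V V ℝ}
    (hT : IsReflexiveTournament T) :
    ∑ x, ∑ y, T x y * outDiff T y x ≤ (T ^ 3).trace := by
  rw [pow_succ', sq, trace_mul_eq_sum]
  refine Finset.sum_le_sum fun x _ => Finset.sum_le_sum fun y _ =>
    mul_le_mul_of_nonneg_left ?_ (hT.zeroOne.nonneg x y)
  rw [Matrix.mul_apply]
  refine Finset.sum_le_sum fun z _ => mul_le_mul_of_nonneg_left ?_ (hT.zeroOne.nonneg y z)
  linarith [hT.one_le_add x z]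

theorem card_pow_three_le_of_close {V : Type*} [Fintype V] [DecidableEq V] {T : Matrix V V ℝ}
    (hT : IsReflexiveTournament T) {θ : ℝ} {B : Finset V}
    (hθ : 0 ≤ θ) (hB : ∀ x ∈ B, ∀ y ∈ B, (∑ z, T x z) - (∑ z, T y z) ≤ θ) :
    (B.card : ℝ) ^ 3 ≤ 8 * (T ^ 3).trace + 8 * θ * (Fintype.card V : ℝ) ^ 2 +
      4 * (Fintype.card V : ℝ) ^ 2 := by
  have hn : (B.card : ℝ) ≤ Fintype.card V := by exact_mod_cast Finset.card_le_univ B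
  rcases B.eq_empty_or_nonempty with rfl | hne
  · have : 0 ≤ (T ^ 3).trace := Finset.sum_nonneg fun x _ =>
      matrix_pow_nonneg hT.zeroOne.nonneg 3 x x
    have h0 : 0 ≤ 8 * (T ^ 3).trace + 8 * θ * (Fintype.card V : ℝ) ^ 2 +
        4 * (Fintype.card V : ℝ) ^ 2 := by positivity
    simpa using h0
  have hb : (0 : ℝ) < B.card := by exact_mod_cast hne.card_pos
  have hT0 := hT.zeroOne
  have hup : ∑ x ∈ B, ∑ y ∈ B, T x y * outDiff T x y ≤
      (T ^ 3).trace + θ * (Fintype.card V : ℝ) ^ 2 := by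
    calc ∑ x ∈ B, ∑ y ∈ B, T x y * outDiff T x y
        ≤ ∑ x ∈ B, ∑ y ∈ B, (T x y * outDiff T y x + θ) := by
          refine Finset.sum_le_sum fun x hx => Finset.sum_le_sum fun y hy => ?_
          have h1 := outDiff_sub T x y
          have h2 := hB x hx y hy
          have h3 : T x y * outDiff T x y ≤ T x y * outDiff T y x + T x y * θ := by
            rw [← mul_add]
            exact mul_le_mul_of_nonneg_left (by linarith) (hT0.nonneg x y)
          have h4 := mul_le_mul_of_nonneg_right (hT0.le_one x y) hθ
          linarith
      _ = ∑ x ∈ B, ∑ y ∈ B, T x y * outDiff T y x + θ * (B.card : ℝ) ^ 2 := by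
          simp_rw [Finset.sum_add_distrib]
          simp only [Finset.sum_const, nsmul_eq_mul]
          ring
      _ ≤ ∑ x, ∑ y, T x y * outDiff T y x + θ * (Fintype.card V : ℝ) ^ 2 := by
          have h0 : ∀ x y, 0 ≤ T x y * outDiff T y x := fun x y =>
            mul_nonneg (hT0.nonneg _ _) (outDiff_nonneg hT0 _ _)
          refine add_le_add ?_ (by gcongr)
          refine (Finset.sum_le_sum fun x _ => Finset.sum_le_sum_of_subset_of_nonneg
            (Finset.subset_univ B) fun y _ _ => h0 x y).trans ?_
          exact Finset.sum_le_sum_of_subset_of_nonneg (Finset.subset_univ B)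
            fun x _ _ => Finset.sum_nonneg fun y _ => h0 x y
      _ ≤ _ := by gcongr; exact sum_mul_outDiff_le hT
  have hlow : ∀ x ∈ B, (((B.filter fun z => T x z = 1).card : ℝ) ^ 2 - Fintype.card V) / 2 ≤
      ∑ y ∈ B, T x y * outDiff T x y := by
    intro x hx
    set S := B.filter fun z => T x z = 1 with hS
    have h1 : ∑ y ∈ S, ∑ z ∈ S, (1 - T y z) ≤ ∑ y ∈ B, T x y * outDiff T x y := by
      calc ∑ y ∈ S, ∑ z ∈ S, (1 - T y z) = ∑ y ∈ S, T x y * ∑ z ∈ S, T x z * (1 - T y z) := by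
            refine Finset.sum_congr rfl fun y hy => ?_
            rw [(Finset.mem_filter.1 hy).2, one_mul]
            exact Finset.sum_congr rfl fun z hz => by rw [(Finset.mem_filter.1 hz).2, one_mul]
        _ ≤ ∑ y ∈ S, T x y * outDiff T x y :=
            Finset.sum_le_sum fun y _ => mul_le_mul_of_nonneg_left
              (Finset.sum_le_sum_of_subset_of_nonneg (Finset.subset_univ _) fun z _ _ =>
                mul_nonneg (hT0.nonneg _ _) (sub_nonneg.2 (hT0.le_one _ _))) (hT0.nonneg _ _)
        _ ≤ _ := Finset.sum_le_sum_of_subset_of_nonneg (Finset.filter_subset _ _) fun y _ _ =>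
            mul_nonneg (hT0.nonneg _ _) (outDiff_nonneg hT0 _ _)
    have h2 : ∑ y ∈ S, ∑ z ∈ S, ((1 - T y z) + (1 - T z y)) = (S.card : ℝ) ^ 2 - S.card := by
      have : ∀ y ∈ S, ∀ z ∈ S, (1 - T y z) + (1 - T z y) = 1 - if y = z then 1 else 0 := by
        intro y _ z _
        by_cases h : y = z
        · subst h
          simp [hT.diag]
        · rw [if_neg h]
          linarith [hT.add_eq_one y z h]
      rw [Finset.sum_congr rfl fun y hy => Finset.sum_congr rfl fun z hz => this y hy z hz]
      simp_rw [Finset.sum_sub_distrib]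
      simp [sq]
    have h3 : ∑ y ∈ S, ∑ z ∈ S, (1 - T z y) = ∑ y ∈ S, ∑ z ∈ S, (1 - T y z) := Finset.sum_comm
    rw [Finset.sum_congr rfl fun y _ => Finset.sum_add_distrib .., Finset.sum_add_distrib, h3] at h2
    have h4 : (S.card : ℝ) ≤ Fintype.card V := by exact_mod_cast Finset.card_le_univ S
    linarith
  have h1 := Finset.sum_le_sum hlow
  rw [← Finset.sum_div, Finset.sum_sub_distrib] at h1
  have h2 := sum_outNeighbors_ge hT0 hT.one_le_add B
  have h3 := sq_sum_le_card_mul_sum_sq (s := B)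
    (f := fun x => ((B.filter fun z => T x z = 1).card : ℝ))
  have h4 : ((B.card : ℝ) ^ 2 / 2) ^ 2 ≤
      B.card * ∑ x ∈ B, ((B.filter fun z => T x z = 1).card : ℝ) ^ 2 :=
    le_trans (by gcongr) h3
  have h5 : (B.card : ℝ) ^ 3 / 4 ≤ ∑ x ∈ B, ((B.filter fun z => T x z = 1).card : ℝ) ^ 2 := by
    refine le_of_mul_le_mul_left ?_ hb
    calc _ = ((B.card : ℝ) ^ 2 / 2) ^ 2 := by ring
      _ ≤ _ := h4
  have h6 : ∑ x ∈ B, (Fintype.card V : ℝ) ≤ (Fintype.card V : ℝ) ^ 2 := by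
    rw [Finset.sum_const, nsmul_eq_mul, sq]
    gcongr
  linarith

theorem exists_perm_antitone {n : ℕ} (d : Fin n → ℝ) :
    ∃ σ : Equiv.Perm (Fin n), ∀ x y, σ y < σ x → d x ≤ d y := by
  refine ⟨(Tuple.sort fun x => - d x).symm, fun x y h => ?_⟩
  have := Tuple.monotone_sort (fun x => - d x) h.le
  simp only [Function.comp_apply, Equiv.apply_symm_apply] at this
  linarith

/-- A tournament with few cyclic triangles has an ordering with few backwards arcs. -/
theorem exists_perm_few_backwards {n : ℕ} {T : Matrix (Fin n) (Fin n) ℝ}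
    (hT : IsReflexiveTournament T) {ζ : ℝ} (hζ : 0 < ζ)
    (h3 : (T ^ 3).trace ≤ ζ ^ 4 / 64 * (n : ℝ) ^ 3) (hn : 16 ≤ ζ ^ 3 * n) (hζ1 : ζ ≤ 1) :
    ∃ σ : Equiv.Perm (Fin n),
      ∑ x, ∑ y, (if σ y < σ x then T x y else 0) ≤ 2 * ζ * (n : ℝ) ^ 2 := by
  obtain ⟨σ, hσ⟩ := exists_perm_antitone fun x => ∑ z, T x z
  refine ⟨σ, ?_⟩
  have hT0 := hT.zeroOne
  have hn0 : (0 : ℝ) < n := by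
    have h0 : 0 < ζ ^ 3 := by positivity
    by_contra hcon
    nlinarith [not_lt.1 hcon]
  set θ : ℝ := ζ ^ 3 / 64 * n with hθ_def
  have hθ : 0 < θ := by positivity
  set B : Fin n → Finset (Fin n) := fun x =>
    Finset.univ.filter fun y => |(∑ z, T y z) - ∑ z, T x z| ≤ θ with hB_def
  have hB : ∀ x, ((B x).card : ℝ) ≤ ζ * n := by
    intro x
    have h := card_pow_three_le_of_close hT (θ := 2 * θ) (B := B x) (by positivity) (by
      intro y hy z hz
      have h1 := abs_le.1 (Finset.mem_filter.1 hy).2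
      have h2 := abs_le.1 (Finset.mem_filter.1 hz).2
      linarith [h1.2, h2.1])
    rw [Fintype.card_fin] at h
    refine le_of_pow_le_pow_left₀ three_ne_zero (by positivity) (h.trans ?_)
    have h4 : ζ ^ 4 ≤ ζ ^ 3 := pow_le_pow_of_le_one hζ.le hζ1 (by norm_num)
    have h5 : ζ ^ 4 / 64 * (n : ℝ) ^ 3 ≤ ζ ^ 3 / 64 * (n : ℝ) ^ 3 := by gcongr
    have h6 : 16 * (n : ℝ) ^ 2 ≤ ζ ^ 3 * n * (n : ℝ) ^ 2 := by gcongr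
    rw [hθ_def]
    have h7 : 0 ≤ ζ ^ 3 * (n : ℝ) ^ 3 := by positivity
    linarith [h3, h5, h6, h7, mul_pow ζ (n : ℝ) 3]
  have hpt : ∀ x y, (if σ y < σ x then T x y else 0) ≤
      T x y * outDiff T y x / θ + if y ∈ B x then 1 else 0 := by
    intro x y
    have h0 : 0 ≤ T x y * outDiff T y x / θ :=
      div_nonneg (mul_nonneg (hT0.nonneg _ _) (outDiff_nonneg hT0 _ _)) hθ.le
    by_cases hyB : y ∈ B x
    · rw [if_pos hyB]
      split_ifs
      · linarith [hT0.le_one x y]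
      · linarith
    · rw [if_neg hyB]
      split_ifs with hlt
      · have h1 := hσ x y hlt
        have h2 : θ < (∑ z, T y z) - ∑ z, T x z := by
          by_contra hcon
          exact hyB (Finset.mem_filter.2 ⟨Finset.mem_univ _, abs_le.2 ⟨by linarith, not_lt.1 hcon⟩⟩)
        have h3 := outDiff_sub T y x
        have h4 := outDiff_nonneg hT0 x y
        rw [add_zero, le_div_iff₀ hθ]
        exact mul_le_mul_of_nonneg_left (by linarith) (hT0.nonneg x y)
      · linarith
  calc _ ≤ ∑ x, ∑ y, (T x y * outDiff T y x / θ + if y ∈ B x then 1 else 0) :=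
        Finset.sum_le_sum fun x _ => Finset.sum_le_sum fun y _ => hpt x y
    _ = (∑ x, ∑ y, T x y * outDiff T y x) / θ + ∑ x, ((B x).card : ℝ) := by
        simp_rw [Finset.sum_add_distrib, ← Finset.sum_div]
        simp
    _ ≤ (ζ ^ 4 / 64 * (n : ℝ) ^ 3) / θ + ∑ _x : Fin n, ζ * n := by
        gcongr with x
        · exact (sum_mul_outDiff_le hT).trans h3
        · exact hB x
    _ = _ := by
        rw [hθ_def]
        field_simp
        simp
        ring

/-- The unordered pairs of distinct vertices, represented by the increasing ones. -/
def upperPairs (n : ℕ) : Finset (Fin n × Fin n) := Finset.univ.filter fun p => p.1 < p.2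

theorem mem_upperPairs {n : ℕ} {p : Fin n × Fin n} : p ∈ upperPairs n ↔ p.1 < p.2 := by
  simp [upperPairs]

theorem sum_sum_eq_diag_add_upperPairs {n : ℕ} (f : Fin n → Fin n → ℝ) :
    ∑ x, ∑ y, f x y = ∑ x, f x x + ∑ p ∈ upperPairs n, (f p.1 p.2 + f p.2 p.1) := by
  have hlow : ∑ p ∈ upperPairs n, f p.2 p.1 =
      ∑ p ∈ Finset.univ.filter (fun p : Fin n × Fin n => p.2 < p.1), f p.1 p.2 :=
    Finset.sum_nbij' Prod.swap Prod.swap (by simp [upperPairs]) (by simp [upperPairs])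
      (by simp) (by simp) (by simp)
  have hdiag : ∑ x, f x x =
      ∑ p ∈ Finset.univ.filter (fun p : Fin n × Fin n => p.1 = p.2), f p.1 p.2 :=
    Finset.sum_nbij' (fun x => (x, x)) Prod.fst (by simp) (by simp) (by simp)
      (by rintro ⟨x, y⟩ h; simpa using h) (by simp)
  rw [Finset.sum_add_distrib, hlow, hdiag, ← Fintype.sum_prod_type' f, upperPairs,
    Finset.sum_filter, Finset.sum_filter, Finset.sum_filter, ← Finset.sum_add_distrib,
    ← Finset.sum_add_distrib]
  refine Finset.sum_congr rfl fun p _ => ?_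
  rcases lt_trichotomy p.1 p.2 with h | h | h
  · simp [h, h.ne, h.not_gt]
  · simp [h]
  · simp [h, h.ne', h.not_gt]

theorem two_mul_card_upperPairs (n : ℕ) :
    2 * ((upperPairs n).card : ℝ) = (n : ℝ) ^ 2 - n := by
  have h := sum_sum_eq_diag_add_upperPairs (n := n) fun _ _ => 1
  simp only [Finset.sum_const, Finset.card_univ, Fintype.card_fin, nsmul_eq_mul] at h
  linarith

/-- The number of arcs of `D` on the pair `p`. -/
def pairMult {n : ℕ} (D : ArcSet n) (p : Fin n × Fin n) : ℕ :=
  (if p ∈ D then 1 else 0) + if p.swap ∈ D then 1 else 0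

/-- The number of oriented graphs contained in `D`. -/
def orientedCount {n : ℕ} (D : ArcSet n) : ℕ := ∏ p ∈ upperPairs n, (1 + pairMult D p)

/-- The number of pairs carrying exactly `j` arcs of `D`. -/
def pairCount {n : ℕ} (D : ArcSet n) (j : ℕ) : ℕ :=
  ((upperPairs n).filter fun p => pairMult D p = j).card

theorem pairMult_cases {n : ℕ} (D : ArcSet n) (p : Fin n × Fin n) :
    pairMult D p = 0 ∨ pairMult D p = 1 ∨ pairMult D p = 2 := by
  unfold pairMult
  split_ifs <;> simp

theorem pairCount_eq_sum {n : ℕ} (D : ArcSet n) (j : ℕ) :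
    (pairCount D j : ℝ) = ∑ p ∈ upperPairs n, if pairMult D p = j then (1 : ℝ) else 0 := by
  simp [pairCount]

theorem sum_pairMult_le {n : ℕ} (D : ArcSet n) :
    ∑ p ∈ upperPairs n, (pairMult D p : ℝ) ≤ ∑ x, ∑ y, arcMatrix D x y := by
  rw [sum_sum_eq_diag_add_upperPairs fun x y => arcMatrix D x y]
  have h0 : 0 ≤ ∑ x, arcMatrix D x x :=
    Finset.sum_nonneg fun x _ => (arcMatrix_isZeroOne D).nonneg x x
  have h1 : ∑ p ∈ upperPairs n, (pairMult D p : ℝ) =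
      ∑ p ∈ upperPairs n, (arcMatrix D p.1 p.2 + arcMatrix D p.2 p.1) :=
    Finset.sum_congr rfl fun p _ => by simp [pairMult, arcMatrix, Prod.swap]
  linarith

theorem orientedCount_le_rpow {n : ℕ} (D : ArcSet n) (g : ℕ → ℝ)
    (h0 : 1 ≤ (2 : ℝ) ^ g 0) (h1 : 2 ≤ (2 : ℝ) ^ g 1) (h2 : 3 ≤ (2 : ℝ) ^ g 2) :
    (orientedCount D : ℝ) ≤ 2 ^ ∑ p ∈ upperPairs n, g (pairMult D p) := by
  rw [Real.rpow_sum_of_pos two_pos, orientedCount, Nat.cast_prod]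
  refine Finset.prod_le_prod (fun _ _ => Nat.cast_nonneg _) fun p _ => ?_
  rcases pairMult_cases D p with h | h | h <;> rw [h] <;> norm_num <;> assumption

theorem orientedCount_le_sum_sub {n : ℕ} (D : ArcSet n) :
    (orientedCount D : ℝ) ≤
      2 ^ (∑ x, ∑ y, arcMatrix D x y - 2 / 5 * pairCount D 2) := by
  have h2 : (3 : ℝ) ≤ 2 ^ (8 / 5 : ℝ) := by
    refine le_of_pow_le_pow_left₀ (n := 5) (by norm_num) (by positivity) ?_
    rw [← Real.rpow_mul_natCast zero_le_two]
    norm_num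
  refine (orientedCount_le_rpow D (fun j => j - 2 / 5 * if j = 2 then 1 else 0) (by simp)
    (by simp) (by norm_num; exact h2)).trans ?_
  refine Real.rpow_le_rpow_of_exponent_le one_le_two ?_
  rw [Finset.sum_sub_distrib, ← Finset.mul_sum, ← pairCount_eq_sum]
  linarith [sum_pairMult_le D]

theorem orientedCount_le_card_add {n : ℕ} (D : ArcSet n) :
    (orientedCount D : ℝ) ≤ 2 ^ ((n : ℝ) ^ 2 / 2 + pairCount D 2 - pairCount D 0) := by
  refine (orientedCount_le_rpow D
    (fun j => 1 + (if j = 2 then 1 else 0) - if j = 0 then 1 else 0) (by norm_num)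
    (by norm_num) (by norm_num)).trans ?_
  refine Real.rpow_le_rpow_of_exponent_le one_le_two ?_
  rw [Finset.sum_sub_distrib, Finset.sum_add_distrib, ← pairCount_eq_sum, ← pairCount_eq_sum]
  have := two_mul_card_upperPairs n
  simp only [Finset.sum_const, nsmul_eq_mul, mul_one]
  have h0 : (0 : ℝ) ≤ n := n.cast_nonneg
  linarith

/-- The reflexive tournament that agrees with `D` on increasing pairs. -/
noncomputable def tournamentOf {n : ℕ} (D : ArcSet n) : Matrix (Fin n) (Fin n) ℝ := fun x y =>
  if x = y then 1 else if x < y then (if (x, y) ∈ D then 1 else 0)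
    else (if (y, x) ∈ D then 0 else 1)

theorem tournamentOf_isReflexiveTournament {n : ℕ} (D : ArcSet n) :
    IsReflexiveTournament (tournamentOf D) where
  zeroOne x y := by unfold tournamentOf; split_ifs <;> simp
  diag x := by simp [tournamentOf]
  add_eq_one x y h := by
    rcases lt_or_gt_of_ne h with h' | h'
    · by_cases hD : (x, y) ∈ D <;> simp [tournamentOf, h, h.symm, h', h'.not_gt, hD]
    · by_cases hD : (y, x) ∈ D <;> simp [tournamentOf, h, h.symm, h', h'.not_gt, hD]

theorem sum_tournamentOf_sub_le {n : ℕ} (D : ArcSet n) :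
    ∑ x, ∑ y, max (tournamentOf D x y - arcMatrix D x y) 0 ≤ n + pairCount D 0 := by
  rw [sum_sum_eq_diag_add_upperPairs, pairCount_eq_sum]
  refine add_le_add ?_ (Finset.sum_le_sum fun p hp => ?_)
  · calc _ ≤ ∑ _x : Fin n, (1 : ℝ) := Finset.sum_le_sum fun x _ => by
          rw [(tournamentOf_isReflexiveTournament D).diag]
          exact max_le (by linarith [(arcMatrix_isZeroOne D).nonneg x x]) zero_le_one
      _ = n := by simp
  · obtain ⟨x, y⟩ := p
    have hlt : x < y := mem_upperPairs.1 hp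
    by_cases h1 : (x, y) ∈ D <;> by_cases h2 : (y, x) ∈ D <;>
      simp [tournamentOf, arcMatrix, pairMult, hlt.ne, hlt.ne', hlt, hlt.not_gt, h1, h2]

theorem backCount_le_sum_tournamentOf {n : ℕ} (D : ArcSet n) (σ : Equiv.Perm (Fin n)) :
    (backCount D σ : ℝ) ≤
      ∑ x, ∑ y, (if σ y < σ x then tournamentOf D x y else 0) + pairCount D 2 := by
  have h0 : (backCount D σ : ℝ) =
      ∑ x, ∑ y, (if σ y < σ x then arcMatrix D x y else 0) := by
    rw [← Fintype.sum_prod_type' fun x y => if σ y < σ x then arcMatrix D x y else 0, backCount,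
      Finset.card_filter, Nat.cast_sum, ← Finset.sum_ite_mem_eq D]
    refine Finset.sum_congr rfl fun p _ => ?_
    simp only [arcMatrix]
    split_ifs <;> simp
  rw [h0, sum_sum_eq_diag_add_upperPairs, sum_sum_eq_diag_add_upperPairs, pairCount_eq_sum,
    add_assoc, ← Finset.sum_add_distrib]
  refine add_le_add (by simp) (Finset.sum_le_sum fun p hp => ?_)
  obtain ⟨x, y⟩ := p
  have hlt : x < y := mem_upperPairs.1 hp
  by_cases h1 : (x, y) ∈ D <;> by_cases h2 : (y, x) ∈ D <;>
    rcases lt_or_gt_of_ne (σ.injective.ne hlt.ne) with h3 | h3 <;>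
    simp [tournamentOf, arcMatrix, pairMult, hlt.ne, hlt.ne', hlt, hlt.not_gt, h1, h2, h3,
      h3.not_gt]

/-- Stability: an arc set with few closed walks of length `k` either is almost transitive or
contains few oriented graphs. -/
theorem exists_stability {k : ℕ} (hk : 3 ≤ k) {γ : ℝ} (hγ : 0 < γ) :
    ∃ c > (0 : ℝ), ∃ η > (0 : ℝ), ∃ N : ℕ, ∀ n, N ≤ n → ∀ D : ArcSet n,
      (arcMatrix D ^ k).trace ≤ η * (n : ℝ) ^ k →
      (∃ σ, (backCount D σ : ℝ) ≤ γ * (n : ℝ) ^ 2) ∨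
        (orientedCount D : ℝ) ≤ 2 ^ ((1 / 2 - c) * (n : ℝ) ^ 2) := by
  obtain ⟨c, hc, hwalk⟩ := exists_trace_pow_ge_trace_pow_three hk
  obtain ⟨ζ, hζ, hζ1, hζγ⟩ : ∃ ζ : ℝ, 0 < ζ ∧ ζ ≤ 1 ∧ ζ ≤ γ / 4 :=
    ⟨min 1 (γ / 4), by positivity, min_le_left _ _, min_le_right _ _⟩
  set ε : ℝ := ζ ^ 4 / 64 with hε_def
  have hε : 0 < ε := by positivity
  set K : ℝ := c * ε ^ (k - 2) with hK_def
  have hK : 0 < K := by positivity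
  have hk0 : (0 : ℝ) < k := by exact_mod_cast (by omega : 0 < k)
  obtain ⟨τ, hτ, hτ1, hτγ, hτK⟩ : ∃ τ : ℝ, 0 < τ ∧ τ ≤ 1 ∧ τ ≤ γ / 20 ∧ τ ≤ K / (48 * k) :=
    ⟨min 1 (min (γ / 20) (K / (48 * k))), by positivity, min_le_left _ _,
      (min_le_right _ _).trans (min_le_left _ _), (min_le_right _ _).trans (min_le_right _ _)⟩
  rw [le_div_iff₀ (by positivity)] at hτK
  obtain ⟨η, hη, hηK, hητ⟩ : ∃ η : ℝ, 0 < η ∧ η ≤ K / 4 ∧ η < ((τ ^ 2) ^ 2 / 8) ^ k := by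
    have h : 0 < ((τ ^ 2) ^ 2 / 8) ^ k := by positivity
    exact ⟨min (K / 4) (((τ ^ 2) ^ 2 / 8) ^ k / 2), by positivity, min_le_left _ _,
      (min_le_right _ _).trans_lt (half_lt_self h)⟩
  obtain ⟨N, hN⟩ := exists_nat_gt (max (1 / τ) (16 / ζ ^ 3))
  refine ⟨τ, hτ, η, hη, N, fun n hn D htr => ?_⟩
  have hNn : max (1 / τ) (16 / ζ ^ 3) < n := hN.trans_le (by exact_mod_cast hn)
  have hnτ : 1 ≤ τ * n := by
    have := ((le_max_left _ _).trans_lt hNn).le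
    rwa [div_le_iff₀' hτ] at this
  have hnζ : 16 ≤ ζ ^ 3 * n := by
    have := ((le_max_right _ _).trans_lt hNn).le
    rwa [div_le_iff₀' (by positivity)] at this
  have hn0 : (0 : ℝ) < n := (lt_max_of_lt_left (by positivity)).trans hNn
  have hn0' : 0 < Fintype.card (Fin n) := by
    rw [Fintype.card_fin]; exact_mod_cast hn0
  have hnk : (0 : ℝ) < (n : ℝ) ^ k := by positivity
  have hnn : (n : ℝ) ≤ τ * (n : ℝ) ^ 2 := by nlinarith
  refine or_iff_not_imp_right.2 fun hbig => ?_
  rw [not_le] at hbig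
  have hA := arcMatrix_isZeroOne D
  have hP : ∑ u, ∑ v, arcMatrix D u v * arcMatrix D v u * (arcMatrix D * arcMatrix D) v u ≤
      τ ^ 2 * (n : ℝ) ^ 3 := by
    by_contra! hcon
    have h := trace_pow_ge_of_doubleEdge_triangle hA hk hn0' (ε := τ ^ 2) (by positivity)
      (pow_le_one₀ hτ.le hτ1) (by rw [Fintype.card_fin]; exact hcon.le)
    rw [Fintype.card_fin] at h
    have := le_of_mul_le_mul_right (h.trans htr) hnk
    linarith
  have hsum : ∑ x, ∑ y, arcMatrix D x y ≤ (n : ℝ) ^ 2 / 2 + 3 * τ * (n : ℝ) ^ 2 := by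
    have h := sum_le_of_doubleEdge_triangle hA (θ := τ * n) (by positivity)
    rw [Fintype.card_fin] at h
    have h2 : (∑ u, ∑ v, arcMatrix D u v * arcMatrix D v u *
        (arcMatrix D * arcMatrix D) v u) / (τ * n) ≤ τ * (n : ℝ) ^ 2 := by
      rw [div_le_iff₀ (by positivity)]
      linarith
    linarith
  have hf2 : (pairCount D 2 : ℝ) ≤ 10 * τ * (n : ℝ) ^ 2 := by
    have := (Real.rpow_lt_rpow_left_iff one_lt_two).1 (hbig.trans_le (orientedCount_le_sum_sub D))
    linarith
  have hf0 : (pairCount D 0 : ℝ) ≤ 11 * τ * (n : ℝ) ^ 2 := by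
    have := (Real.rpow_lt_rpow_left_iff one_lt_two).1 (hbig.trans_le (orientedCount_le_card_add D))
    linarith
  have hT := tournamentOf_isReflexiveTournament D
  have htrT : (tournamentOf D ^ k).trace < K * (n : ℝ) ^ k := by
    have h := trace_pow_le_add hA hT.zeroOne (sum_tournamentOf_sub_le D) hk
    rw [Fintype.card_fin] at h
    have h1 : k * ((n + pairCount D 0 : ℝ) * (n : ℝ) ^ (k - 2)) ≤
        k * (12 * τ * (n : ℝ) ^ 2 * (n : ℝ) ^ (k - 2)) := by
      gcongr
      linarith
    have h2 : (n : ℝ) ^ 2 * (n : ℝ) ^ (k - 2) = (n : ℝ) ^ k := by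
      rw [← pow_add]; congr 1; omega
    calc _ ≤ η * (n : ℝ) ^ k + k * (12 * τ * (n : ℝ) ^ 2 * (n : ℝ) ^ (k - 2)) := by linarith
      _ = (η + 12 * (τ * k)) * (n : ℝ) ^ k := by rw [mul_assoc (12 * τ), h2]; ring
      _ < _ := by gcongr; linarith
  have h3 : (tournamentOf D ^ 3).trace ≤ ε * (n : ℝ) ^ 3 := by
    by_contra! hcon
    have h := hwalk (tournamentOf D) hT.zeroOne hT.one_le_add hn0' ε hε.le
      (by rw [Fintype.card_fin]; exact hcon.le)
    rw [Fintype.card_fin] at h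
    linarith
  obtain ⟨σ, hσ⟩ := exists_perm_few_backwards hT hζ h3 hnζ hζ1
  refine ⟨σ, (backCount_le_sum_tournamentOf D σ).trans ?_⟩
  have h4 : ζ * (n : ℝ) ^ 2 ≤ γ / 4 * (n : ℝ) ^ 2 := by gcongr
  have h5 : τ * (n : ℝ) ^ 2 ≤ γ / 20 * (n : ℝ) ^ 2 := by gcongr
  linarith

theorem card_oriented_subsets_le {n : ℕ} (D : ArcSet n) :
    (D.powerset.filter IsOriented).card ≤ orientedCount D := by
  set choices : Fin n × Fin n → Finset (ArcSet n) := fun p =>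
    insert ∅ ((({p, p.swap} : ArcSet n) ∩ D).image fun q => {q}) with hchoices
  have hcard : ∀ p, (choices p).card ≤ 1 + pairMult D p := by
    intro p
    have h1 : ((({p, p.swap} : ArcSet n) ∩ D).image fun q => ({q} : ArcSet n)).card ≤ pairMult D p := by
      refine Finset.card_image_le.trans ?_
      have h2 : (({p.swap} : ArcSet n) ∩ D).card = if p.swap ∈ D then 1 else 0 := by
        rw [Finset.singleton_inter]
        split_ifs <;> simp
      rw [pairMult, ← h2]
      by_cases hp : p ∈ D
      · rw [Finset.insert_inter_of_mem hp, if_pos hp, add_comm]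
        exact Finset.card_insert_le _ _
      · rw [Finset.insert_inter_of_notMem hp, if_neg hp, zero_add]
    exact (Finset.card_insert_le _ _).trans (by omega)
  calc (D.powerset.filter IsOriented).card ≤ ((upperPairs n).pi choices).card := by
        refine Finset.card_le_card_of_injOn (fun F p _ => F ∩ {p, p.swap}) ?_ ?_
        · intro F hF
          obtain ⟨hFD, hF⟩ := Finset.mem_filter.1 hF
          rw [Finset.mem_powerset] at hFD
          refine Finset.mem_coe.2 (Finset.mem_pi.2 fun p _ => ?_)
          obtain ⟨x, y⟩ := p
          have h := hF.2 x y
          by_cases hx : (x, y) ∈ F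
          · refine Finset.mem_insert_of_mem (Finset.mem_image.2 ⟨(x, y), ?_, ?_⟩)
            · simp [hFD hx]
            · ext q
              simp only [Finset.mem_singleton, Finset.mem_inter, Finset.mem_insert, Prod.swap]
              constructor
              · rintro rfl
                exact ⟨hx, Or.inl rfl⟩
              · rintro ⟨hq, rfl | rfl⟩
                · rfl
                · exact absurd hq (h hx)
          · by_cases hy : (y, x) ∈ F
            · refine Finset.mem_insert_of_mem (Finset.mem_image.2 ⟨(y, x), ?_, ?_⟩)
              · simp [hFD hy]
              · ext q
                simp only [Finset.mem_singleton, Finset.mem_inter, Finset.mem_insert, Prod.swap]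
                constructor
                · rintro rfl
                  exact ⟨hy, Or.inr rfl⟩
                · rintro ⟨hq, rfl | rfl⟩
                  · exact absurd hq hx
                  · rfl
            · refine Finset.mem_insert.2 (Or.inl ?_)
              ext q
              simp only [Finset.mem_inter, Finset.mem_insert, Finset.mem_singleton, Prod.swap,
                Finset.notMem_empty, iff_false]
              rintro ⟨hq, rfl | rfl⟩
              · exact hx hq
              · exact hy hq
        · intro F hF F' hF' h
          have hl := (Finset.mem_filter.1 hF).2.1
          have hl' := (Finset.mem_filter.1 hF').2.1
          have h0 : ∀ p ∈ upperPairs n, F ∩ {p, p.swap} = F' ∩ {p, p.swap} := fun p hp =>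
            congrFun (congrFun h p) hp
          ext ⟨x, y⟩
          rcases lt_trichotomy x y with hxy | rfl | hxy
          · simpa using Finset.ext_iff.1 (h0 (x, y) (mem_upperPairs.2 hxy)) (x, y)
          · exact iff_of_false (hl x) (hl' x)
          · simpa using Finset.ext_iff.1 (h0 (y, x) (mem_upperPairs.2 hxy)) (x, y)
    _ = ∏ p ∈ upperPairs n, (choices p).card := Finset.card_pi _ _
    _ ≤ _ := Finset.prod_le_prod' fun p _ => hcard p

theorem card_oriented_almost_subset_le {n : ℕ} (D : ArcSet n) (t : ℝ) :
    (Finset.univ.filter fun E : ArcSet n => IsOriented E ∧ ((E \ D).card : ℝ) ≤ t).card ≤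
      (Finset.univ.filter fun S : ArcSet n => (S.card : ℝ) ≤ t).card * orientedCount D := by
  calc _ ≤ ((Finset.univ.filter fun S : ArcSet n => (S.card : ℝ) ≤ t) ×ˢ
        (D.powerset.filter IsOriented)).card := by
        refine Finset.card_le_card_of_injOn (fun E => (E \ D, E ∩ D)) ?_ ?_
        · intro E hE
          obtain ⟨hE, hEt⟩ := (Finset.mem_filter.1 hE).2
          refine Finset.mem_coe.2 (Finset.mem_product.2 ⟨by simpa using hEt,
            Finset.mem_filter.2 ⟨Finset.mem_powerset.2 Finset.inter_subset_right, ?_, ?_⟩⟩)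
          · exact fun v hv => hE.1 v (Finset.mem_inter.1 hv).1
          · exact fun u v huv hvu => hE.2 u v (Finset.mem_inter.1 huv).1 (Finset.mem_inter.1 hvu).1
        · intro E _ E' _ h
          obtain ⟨h1, h2⟩ := Prod.mk.inj h
          rw [← Finset.sdiff_union_inter E D, ← Finset.sdiff_union_inter E' D, h1, h2]
    _ ≤ _ := by
        rw [Finset.card_product]
        exact Nat.mul_le_mul_left _ (card_oriented_subsets_le D)

theorem card_small_sets_le {α : Type*} [Fintype α] {x : ℝ} (hx : 0 < x) (hx1 : x ≤ 1) (t : ℝ) :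
    ((Finset.univ.filter fun S : Finset α => (S.card : ℝ) ≤ t).card : ℝ) * x ^ t ≤
      (1 + x) ^ Fintype.card α := by
  calc _ = ∑ S ∈ Finset.univ.filter fun S : Finset α => (S.card : ℝ) ≤ t, x ^ t := by simp
    _ ≤ ∑ S ∈ Finset.univ.filter fun S : Finset α => (S.card : ℝ) ≤ t, x ^ S.card := by
        refine Finset.sum_le_sum fun S hS => ?_
        rw [← Real.rpow_natCast]
        exact Real.rpow_le_rpow_of_exponent_ge hx hx1 (Finset.mem_filter.1 hS).2
    _ ≤ ∑ S : Finset α, x ^ S.card :=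
        Finset.sum_le_sum_of_subset_of_nonneg (Finset.subset_univ _) fun _ _ _ => by positivity
    _ = _ := by
        have h := Fintype.sum_pow_mul_eq_add_pow α x 1
        simp only [one_pow, mul_one] at h
        rw [h, add_comm]

/-- A set has few subsets of small density. -/
theorem exists_card_small_sets_le {c : ℝ} (hc : 0 < c) :
    ∃ δ > (0 : ℝ), ∀ n : ℕ,
      ((Finset.univ.filter fun S : ArcSet n => (S.card : ℝ) ≤ δ * (n : ℝ) ^ 2).card : ℝ) ≤
        2 ^ (c * (n : ℝ) ^ 2) := by
  have h1 : (1 : ℝ) < 2 ^ (c / 2) := Real.one_lt_rpow one_lt_two (by positivity)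
  obtain ⟨x, hx, hx1, hxc⟩ : ∃ x : ℝ, 0 < x ∧ x ≤ 1 ∧ 1 + x ≤ 2 ^ (c / 2) :=
    ⟨min 1 (2 ^ (c / 2) - 1), lt_min one_pos (by linarith), min_le_left _ _,
      by linarith [min_le_right 1 ((2 : ℝ) ^ (c / 2) - 1)]⟩
  set L : ℝ := - Real.logb 2 x with hL_def
  have hL : 0 ≤ L := neg_nonneg.2 (Real.logb_nonpos one_lt_two hx.le hx1)
  have hxL : x = 2 ^ (-L) := by
    rw [hL_def, neg_neg, Real.rpow_logb two_pos (by norm_num) hx]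
  refine ⟨c / (2 * (L + 1)), by positivity, fun n => ?_⟩
  set δ := c / (2 * (L + 1)) with hδ
  have hδL : L * δ ≤ c / 2 := by
    rw [hδ, ← mul_div_assoc, div_le_iff₀ (by positivity)]
    linarith
  have h := card_small_sets_le (α := Fin n × Fin n) hx hx1 (δ * (n : ℝ) ^ 2)
  rw [Fintype.card_prod, Fintype.card_fin] at h
  have h2 : (1 + x) ^ (n * n) ≤ (2 : ℝ) ^ (c / 2 * (n : ℝ) ^ 2) := by
    rw [Real.rpow_mul zero_le_two, ← Nat.cast_pow, Real.rpow_natCast, sq]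
    gcongr
  have h3 : (2 : ℝ) ^ (- (c / 2 * (n : ℝ) ^ 2)) ≤ x ^ (δ * (n : ℝ) ^ 2) := by
    rw [hxL, ← Real.rpow_mul zero_le_two]
    refine Real.rpow_le_rpow_of_exponent_le one_le_two ?_
    have := mul_le_mul_of_nonneg_right hδL (sq_nonneg (n : ℝ))
    linarith
  have h4 := (mul_le_mul_of_nonneg_left h3 (Nat.cast_nonneg
    (Finset.univ.filter fun S : ArcSet n => (S.card : ℝ) ≤ δ * (n : ℝ) ^ 2).card)).trans
      (h.trans h2)
  rw [Real.rpow_neg zero_le_two, ← div_eq_mul_inv, div_le_iff₀ (by positivity),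
    ← Real.rpow_add two_pos] at h4
  exact h4.trans_eq (by congr 1; ring)

theorem ckFree_of_subset_upperPairs {n k : ℕ} (hk : k ≠ 0) {E : ArcSet n}
    (hE : E ⊆ upperPairs n) : CkFree k E := by
  rintro ⟨f, -, hf⟩
  have hmono : StrictMono fun i : ℕ => f i := strictMono_nat_of_lt_succ fun i => by
    have := mem_upperPairs.1 (hE (hf i))
    simpa using this
  have := hmono (Nat.pos_of_ne_zero hk)
  simp at this

theorem isOriented_of_subset_upperPairs {n : ℕ} {E : ArcSet n} (hE : E ⊆ upperPairs n) :
    IsOriented E :=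
  ⟨fun _ hv => (mem_upperPairs.1 (hE hv)).ne rfl,
    fun _ _ huv hvu => (mem_upperPairs.1 (hE huv)).not_gt (mem_upperPairs.1 (hE hvu))⟩

theorem two_pow_le_fnk {n k : ℕ} (hk : k ≠ 0) : 2 ^ (upperPairs n).card ≤ fnk n k := by
  rw [← Finset.card_powerset]
  refine Finset.card_le_card fun E hE => ?_
  rw [Finset.mem_powerset] at hE
  exact Finset.mem_filter.2 ⟨Finset.mem_univ _, isOriented_of_subset_upperPairs hE,
    ckFree_of_subset_upperPairs hk hE⟩

theorem rpow_le_fnk {n k : ℕ} (hk : k ≠ 0) :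
    (2 : ℝ) ^ ((n : ℝ) ^ 2 / 2 - n / 2) ≤ fnk n k := by
  have h : (n : ℝ) ^ 2 / 2 - n / 2 = ((upperPairs n).card : ℝ) := by
    linarith [two_mul_card_upperPairs n]
  rw [h, Real.rpow_natCast]
  exact_mod_cast two_pow_le_fnk hk

theorem backCount_le_add_card_sdiff {n : ℕ} (E D : ArcSet n) (σ : Equiv.Perm (Fin n)) :
    backCount E σ ≤ backCount D σ + (E \ D).card := by
  refine le_trans (Finset.card_le_card fun e he => ?_) (Finset.card_union_le _ _)
  obtain ⟨he, hσ⟩ := Finset.mem_filter.1 he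
  by_cases hD : e ∈ D
  · exact Finset.mem_union_left _ (Finset.mem_filter.2 ⟨hD, hσ⟩)
  · exact Finset.mem_union_right _ (Finset.mem_sdiff.2 ⟨he, hD⟩)

/-- An exponential upper bound for the number of `C_k`-free oriented graphs that are far from
being transitive. -/
theorem exists_card_many_backwards_le {k : ℕ} (hk : 3 ≤ k) {γ : ℝ} (hγ : 0 < γ) :
    ∃ c > (0 : ℝ), ∃ m N : ℕ, ∀ n, N ≤ n →
      ((Finset.univ.filter fun E : ArcSet n =>
        IsOriented E ∧ CkFree k E ∧ γ * (n : ℝ) ^ 2 ≤ (bMin E : ℝ)).card : ℝ) ≤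
        2 ^ (2 * m * n + (1 / 2 - c) * (n : ℝ) ^ 2) := by
  obtain ⟨c, hc, η, hη, N₁, hstab⟩ := exists_stability hk (half_pos hγ)
  obtain ⟨δ₀, hδ₀, hsmall⟩ := exists_card_small_sets_le (half_pos hc)
  obtain ⟨δ, hδ, hδ1, hδγ, hδδ₀⟩ : ∃ δ : ℝ, 0 < δ ∧ δ ≤ 1 ∧ δ ≤ γ / 4 ∧ δ ≤ δ₀ :=
    ⟨min 1 (min (γ / 4) δ₀), by positivity, min_le_left _ _,
      (min_le_right _ _).trans (min_le_left _ _), (min_le_right _ _).trans (min_le_right _ _)⟩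
  obtain ⟨m, N₂, hcont⟩ := exists_container hk hδ hδ1 hη
  refine ⟨c / 2, half_pos hc, m, max 1 (max N₁ N₂), fun n hn => ?_⟩
  have hn0 : (0 : ℝ) < n := by exact_mod_cast (le_max_left _ _).trans hn
  have hn1 : N₁ ≤ n := (le_max_left _ _).trans ((le_max_right _ _).trans hn)
  have hn2 : N₂ ≤ n := (le_max_right _ _).trans ((le_max_right _ _).trans hn)
  set 𝒟 := (rectangleComplements (Fin n) m).filter fun D =>
    (orientedCount D : ℝ) ≤ 2 ^ ((1 / 2 - c) * (n : ℝ) ^ 2) with h𝒟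
  set near : ArcSet n → Finset (ArcSet n) := fun D => Finset.univ.filter fun E : ArcSet n =>
    IsOriented E ∧ ((E \ D).card : ℝ) ≤ δ₀ * (n : ℝ) ^ 2 with hnear
  have hcover : (Finset.univ.filter fun E : ArcSet n =>
      IsOriented E ∧ CkFree k E ∧ γ * (n : ℝ) ^ 2 ≤ (bMin E : ℝ)) ⊆ 𝒟.biUnion near := by
    intro E hE
    obtain ⟨hEo, hEf, hEb⟩ := (Finset.mem_filter.1 hE).2
    obtain ⟨D, hD, hED, htr⟩ := hcont n hn2 E hEf
    refine Finset.mem_biUnion.2 ⟨D, Finset.mem_filter.2 ⟨hD, ?_⟩, Finset.mem_filter.2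
      ⟨Finset.mem_univ _, hEo, hED.trans (by gcongr)⟩⟩
    refine (hstab n hn1 D htr).resolve_left ?_
    rintro ⟨σ, hσ⟩
    have h1 : bMin E ≤ backCount E σ := Finset.inf'_le _ (Finset.mem_univ σ)
    have h2 : (bMin E : ℝ) ≤ backCount D σ + (E \ D).card := by
      exact_mod_cast h1.trans (backCount_le_add_card_sdiff E D σ)
    have h3 : δ * (n : ℝ) ^ 2 ≤ γ / 4 * (n : ℝ) ^ 2 := by gcongr
    have h4 : 0 < γ * (n : ℝ) ^ 2 := by positivity
    linarith
  have hcard : ∀ D ∈ 𝒟, ((near D).card : ℝ) ≤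
      2 ^ (c / 2 * (n : ℝ) ^ 2) * 2 ^ ((1 / 2 - c) * (n : ℝ) ^ 2) := by
    intro D hD
    have h : ((near D).card : ℝ) ≤ (Finset.univ.filter fun S : ArcSet n =>
        (S.card : ℝ) ≤ δ₀ * (n : ℝ) ^ 2).card * orientedCount D := by
      rw [← Nat.cast_mul]
      exact Nat.cast_le.2 (card_oriented_almost_subset_le D _)
    exact h.trans (mul_le_mul (hsmall n) (Finset.mem_filter.1 hD).2 (by positivity) (by positivity))
  have h𝒟card : (𝒟.card : ℝ) ≤ 2 ^ (2 * m * n : ℝ) := by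
    have h := (Finset.card_le_card (Finset.filter_subset _ _ : 𝒟 ⊆ _)).trans (card_rectangleComplements_le (Fin n) m)
    rw [Fintype.card_fin] at h
    calc (𝒟.card : ℝ) ≤ ((2 ^ (2 * m * n) : ℕ) : ℝ) := Nat.cast_le.2 h
      _ = 2 ^ (2 * m * n : ℝ) := by
        rw [Nat.cast_pow, ← Real.rpow_natCast]
        push_cast
        rfl
  calc _ ≤ ((𝒟.biUnion near).card : ℝ) := by exact_mod_cast Finset.card_le_card hcover
    _ ≤ ∑ D ∈ 𝒟, ((near D).card : ℝ) := by exact_mod_cast Finset.card_biUnion_le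
    _ ≤ ∑ D ∈ 𝒟, (2 : ℝ) ^ (c / 2 * (n : ℝ) ^ 2) * 2 ^ ((1 / 2 - c) * (n : ℝ) ^ 2) :=
        Finset.sum_le_sum hcard
    _ = 𝒟.card * ((2 : ℝ) ^ (c / 2 * (n : ℝ) ^ 2) * 2 ^ ((1 / 2 - c) * (n : ℝ) ^ 2)) := by
        rw [Finset.sum_const, nsmul_eq_mul]
    _ ≤ 2 ^ (2 * m * n : ℝ) *
          ((2 : ℝ) ^ (c / 2 * (n : ℝ) ^ 2) * 2 ^ ((1 / 2 - c) * (n : ℝ) ^ 2)) := by gcongr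
    _ = _ := by
        rw [← Real.rpow_add two_pos, ← Real.rpow_add two_pos]
        congr 1
        ring

/-- For `k ≥ 3` and every `γ > 0`, the number of `C_k`-free
oriented graphs on `[n]` with `b(G) ≥ γ n²` is `o(f(n,C_k))`. -/
theorem many_backwards_rare (k : ℕ) (hk : 3 ≤ k) (γ : ℝ) (hγ : 0 < γ) :
    Filter.Tendsto
      (fun n : ℕ =>
        (((Finset.univ.filter fun E : ArcSet n =>
            IsOriented E ∧ CkFree k E ∧ γ * (n : ℝ) ^ 2 ≤ (bMin E : ℝ)).card : ℝ) /
          (fnk n k : ℝ)))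
      Filter.atTop (nhds 0) := by
  obtain ⟨c, hc, m, N, hN⟩ := exists_card_many_backwards_le hk hγ
  obtain ⟨M, hM⟩ := exists_nat_ge ((2 * m + 3 / 2) / c)
  rw [div_le_iff₀ hc] at hM
  refine squeeze_zero' (Filter.Eventually.of_forall fun n => by positivity)
    (g := fun n : ℕ => (1 / 2 : ℝ) ^ n) ?_
    (tendsto_pow_atTop_nhds_zero_of_lt_one (by norm_num) (by norm_num))
  filter_upwards [Filter.eventually_ge_atTop (max N M)] with n hn
  have hfnk := rpow_le_fnk (n := n) (k := k) (by omega)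
  have hpos : (0 : ℝ) < 2 ^ ((n : ℝ) ^ 2 / 2 - n / 2) := by positivity
  rw [div_le_iff₀ (hpos.trans_le hfnk)]
  refine (hN n ((le_max_left _ _).trans hn)).trans
    (le_trans ?_ (mul_le_mul_of_nonneg_left hfnk (by positivity)))
  have hhalf : (1 / 2 : ℝ) ^ n = 2 ^ (-(n : ℝ)) := by
    rw [Real.rpow_neg zero_le_two, Real.rpow_natCast, one_div, inv_pow]
  rw [hhalf, ← Real.rpow_add two_pos]
  refine Real.rpow_le_rpow_of_exponent_le one_le_two ?_
  have hMn : (M : ℝ) ≤ n := by exact_mod_cast (le_max_right _ _).trans hn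
  have h1 : 2 * m + 3 / 2 ≤ (n : ℝ) * c := hM.trans (by gcongr)
  have h2 := mul_le_mul_of_nonneg_right h1 (Nat.cast_nonneg (α := ℝ) n)
  linarith
end
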